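/- Fix, for every pair (β,s)∈Δ⁺×ℤ, a choice of the parameters λ_k∈v^ℤ and of the decomposition of s used in the definition of the quantum root vector E_{β,s}. Then the ordered PBWD monomials {E_h}_{h∈H} form a basis of U_v^>(Lo_{2n}) as a ℚ(v)-vector space. -/

import Mathlib

noncomputable section
open scoped BigOperators DirectSum

/-! ### Base field ℚ(v) and quantum numbers -/

/-- the base field `ℚ(v)`. -/
abbrev KK : Type := RatFunc ℚ
/-- the variable `v ∈ ℚ(v)`. -/
def vv : KK := RatFunc.X
/-- integer powers of `v`. -/
def vpow (m : ℤ) : KK := vv ^ m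
/-- the quantum integer `[m]_u = (uᵐ - u⁻ᵐ)/(u - u⁻¹)`. -/
def qInt (u : KK) (m : ℕ) : KK := (u ^ (m : ℤ) - u ^ (-(m : ℤ))) / (u - u⁻¹)
/-- the quantum factorial `[m]_u!`. -/
def qFact (u : KK) (m : ℕ) : KK := ∏ k ∈ Finset.range m, qInt u (k + 1)
/-- the quantum binomial coefficient. -/
def qBinom (u : KK) (m k : ℕ) : KK := qFact u m / (qFact u k * qFact u (m - k))
/-- `⟨m⟩_v = vᵐ - v⁻ᵐ`. -/
def qBrack (m : ℕ) : KK := vpow (m : ℤ) - vpow (-(m : ℤ))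
/-- `l` is an integer power of `v`. -/
def IsVpow (l : KK) : Prop := ∃ m : ℤ, l = vpow m

/-! ### Cartan data of types `C_n` and `D_n` (1-based indices) -/

/-- the Cartan matrix of type `C_n` (1-based indices). -/
def aC (n i j : ℕ) : ℤ :=
  if i = j then 2 else if i + 1 = n ∧ j = n then -2
  else if i + 1 = j ∨ j + 1 = i then -1 else 0
/-- the symmetrizing integers `d_i` of type `C_n`. -/
def dC (n i : ℕ) : ℕ := if i = n then 2 else 1
/-- the Cartan matrix of type `D_n` (1-based indices). -/
def aD (n i j : ℕ) : ℤ :=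
  if i = j then 2
  else if (i + 1 = j ∧ j + 1 ≤ n) ∨ (j + 1 = i ∧ i + 1 ≤ n) then -1
  else if (i + 2 = n ∧ j = n) ∨ (j + 2 = n ∧ i = n) then -1 else 0
/-- the symmetrizing integers `d_i` of type `D_n` (all equal to `1`). -/
def dD (n i : ℕ) : ℕ := 1

/-! ### The positive subalgebra of the quantum loop algebra, for Cartan data `(A, Dd)` -/

section Ualg
variable (n : ℕ) (A : ℕ → ℕ → ℤ) (Dd : ℕ → ℕ)

/-- the free `ℚ(v)`-algebra on generators `e_{i,r}`, `i ∈ I`, `r ∈ ℤ`. -/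
abbrev FA := FreeAlgebra KK (Fin n × ℤ)
/-- the free generator `e_{i,r}`. -/
def fg (i : Fin n) (r : ℤ) : FA n := FreeAlgebra.ι KK (i, r)

/-- the `z^{-r₁}⋯z^{-r_m}w^{-t}`-coefficient of the Serre relation between colors `i ≠ j`. -/
def serreElt (i j : Fin n) (m : ℕ) (r : Fin m → ℤ) (t : ℤ) : FA n :=
  ∑ σ : Equiv.Perm (Fin m), ∑ k ∈ Finset.range (m + 1),
    ((-1 : KK) ^ k * qBinom (vpow (Dd (i.1 + 1))) m k) •
      (((List.ofFn fun l => fg n i (r (σ l))).take k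
        ++ fg n j t :: (List.ofFn fun l => fg n i (r (σ l))).drop k).prod)

/-- the defining relations of `U_v^>(Lg)` in the new Drinfeld realization: the coefficients of
`(z - v_i^{a_ij} w) e_i(z) e_j(w) = (v_i^{a_ij} z - w) e_j(w) e_i(z)` and of the Serre relations. -/
inductive URel : FA n → FA n → Prop
  | loop (i j : Fin n) (r s : ℤ) :
      URel (fg n i (r + 1) * fg n j s
             - vpow ((Dd (i.1 + 1) : ℤ) * A (i.1 + 1) (j.1 + 1)) • (fg n i r * fg n j (s + 1)))
           (vpow ((Dd (i.1 + 1) : ℤ) * A (i.1 + 1) (j.1 + 1)) • (fg n j s * fg n i (r + 1))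
             - fg n j (s + 1) * fg n i r)
  | serre (i j : Fin n) (hij : i ≠ j) (r : Fin (1 - A (i.1 + 1) (j.1 + 1)).toNat → ℤ) (t : ℤ) :
      URel (serreElt n Dd i j _ r t) 0

/-- the positive subalgebra `U_v^>(Lg)` of the quantum loop algebra. -/
abbrev UA := RingQuot (URel n A Dd)
/-- the generator `e_{i,r}` of `U_v^>(Lg)`. -/
def ug (i : Fin n) (r : ℤ) : UA n A Dd := RingQuot.mkAlgHom KK (URel n A Dd) (fg n i r)
/-- the generator `e_{i,r}` with a 1-based index `1 ≤ i ≤ n` (and junk value `0` otherwise). -/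
def g1 (i : ℕ) (r : ℤ) : UA n A Dd := if h : 1 ≤ i ∧ i ≤ n then ug n A Dd ⟨i - 1, by omega⟩ r else 0

end Ualg

/-! ### `q`-brackets, ordered monomials, and ℤ[v,v⁻¹]-forms -/

section Aux
variable {B : Type} [Ring B] [Module KK B]

/-- the `u`-commutator `[x,y]_u = xy - u · yx`. -/
def qcm (u : KK) (x y : B) : B := x * y - u • (y * x)

/-- the iterated `q`-bracket `[⋯[[g i₁ s₁, g i₂ s₂]_{λ₁}, g i₃ s₃]_{λ₂}, ⋯]_{λ_{ℓ-1}}`. -/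
def chainE (g : ℕ → ℤ → B) (w : List ℕ) (ss : List ℤ) (ls : List KK) : B :=
  match w, ss with
  | i :: w', s :: ss' =>
      ((w'.zip ss').zip ls).foldl
        (fun acc p => acc * g p.1.1 p.1.2 - p.2 • (g p.1.1 p.1.2 * acc)) (g i s)
  | _, _ => 0
end Aux

section Mon
variable {B : Type} [Ring B] {ι : Type} [LinearOrder ι]
/-- the ordered monomial `∏→ (E p)^(h p)`, the product taken in increasing order of `p`. -/
def ordMon (E : ι → B) (h : ι →₀ ℕ) : B := ((h.support.sort (· ≤ ·)).map (fun p => E p ^ h p)).prod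
end Mon

/-- the subring `ℤ[v,v⁻¹] ⊆ ℚ(v)`. -/
def Rint : Subring KK := Subring.closure {vv, vv⁻¹}

section Forms
variable {B : Type} [Ring B] [Algebra KK B]
/-- the `ℤ[v,v⁻¹]`-subalgebra of a `ℚ(v)`-algebra generated by a set `X`, realized as the subring
generated by `X` together with the central scalars `v^{±1}`. -/
def zvForm (X : Set B) : Subring B :=
  Subring.closure ({algebraMap KK B vv, algebraMap KK B vv⁻¹} ∪ X)
end Forms

/-! ### Positive roots of type `D_n` with the fixed convex (lexicographic) order -/

section RootsD
variable (n : ℕ)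

/-- Positive roots of type `D_n`, encoded as lexicographically ordered pairs `(i,t)`:
`[i,i+t]` for `i+t<n` or `i=n`; `[i,n]` for `i+t=n`; `[i,n,n-1]` for `i+t=n+1`;
`[i,n,j]` with `j = 2n-i-t` for `i+t ≥ n+2`.  The induced linear order is exactly the
convex order coming from standard Lyndon words. -/
def IsPosRootD (p : Fin (n + 1) ×ₗ Fin (2 * n + 1)) : Prop :=
  1 ≤ ((ofLex p).1 : ℕ) ∧ (n - 1 ≤ ((ofLex p).1 : ℕ) → ((ofLex p).2 : ℕ) = 0) ∧
    (((ofLex p).2 : ℕ) = 0 ∨ ((ofLex p).2 : ℕ) + 2 * ((ofLex p).1 : ℕ) + 1 ≤ 2 * n)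

instance : DecidablePred (IsPosRootD n) := fun p => by unfold IsPosRootD; infer_instance

/-- the set `Δ⁺` of positive roots of type `D_n`, with its convex linear order. -/
abbrev PosRootD := {p : Fin (n + 1) ×ₗ Fin (2 * n + 1) // IsPosRootD n p}

variable {n}
/-- the first index `i` of a positive root. -/
def riD (β : PosRootD n) : ℕ := ((ofLex β.1).1 : ℕ)
/-- the offset `t` of a positive root within its block. -/
def rtD (β : PosRootD n) : ℕ := ((ofLex β.1).2 : ℕ)

/-- multiplicity of `α_c` (1-based color `c`) in the positive root `β` (type `D_n`). -/
def nuD (β : PosRootD n) (c : ℕ) : ℕ :=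
  let i := riD β; let t := rtD β
  if i + t < n ∨ i = n then (if i ≤ c ∧ c ≤ i + t then 1 else 0)
  else if i + t = n then (if (i ≤ c ∧ c ≤ n - 2) ∨ c = n then 1 else 0)
  else if i + t = n + 1 then (if i ≤ c ∧ c ≤ n then 1 else 0)
  else (if i ≤ c ∧ c < 2 * n - i - t then 1
        else if 2 * n - i - t ≤ c ∧ c ≤ n - 2 then 2
        else if c = n - 1 ∨ c = n then 1 else 0)

/-- standard Lyndon word (list of 1-based simple-root indices) of `β` (type `D_n`). -/
def wordD (β : PosRootD n) : List ℕ :=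
  let i := riD β; let t := rtD β
  if i + t < n ∨ i = n then List.range' i (t + 1)
  else if i + t = n then List.range' i (n - 1 - i) ++ [n]
  else if i + t = n + 1 then List.range' i (n - 1 - i) ++ [n, n - 1]
  else List.range' i (n - 1 - i) ++ [n] ++ (List.range' (2 * n - i - t) (n - (2 * n - i - t))).reverse

/-- the height `|β|` of a positive root (type `D_n`). -/
def heightD (β : PosRootD n) : ℕ := (wordD β).length

/-- `β` is a root of the form `[i,n,j]` with `i < j ≤ n-2`. -/
def isSpecD (β : PosRootD n) : Prop := n + 2 ≤ riD β + rtD β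
instance (β : PosRootD n) : Decidable (isSpecD β) := by unfold isSpecD; infer_instance
end RootsD

/-! ### General quantum root vectors of type `D_n` -/

section RVD
variable (n : ℕ)

/-- the positive subalgebra `U_v^>(Lo_{2n})`. -/
abbrev UD := UA n (aD n) (dD n)
/-- generators of `U_v^>(Lo_{2n})` with 1-based indices. -/
def genD : ℕ → ℤ → UD n := g1 n (aD n) (dD n)

variable {n}
/-- `E` is a quantum root vector `E_{β,s}` of type `D_n` for some choice of the parameters
`λ_k ∈ v^ℤ` and of a decomposition of `s`: an iterated `q`-bracket along the standard Lyndon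
word of `β`. -/
def IsRVD (β : PosRootD n) (s : ℤ) (E : UD n) : Prop :=
  ∃ (ss : List ℤ) (ls : List KK),
    ss.length = (wordD β).length ∧ ls.length + 1 = (wordD β).length ∧ ss.sum = s ∧
    (∀ l ∈ ls, IsVpow l) ∧ E = chainE (genD n) (wordD β) ss ls
end RVD

/-! ### The local ring of `ℚ(v)` at `v = 1` -/

/-- evaluation of rational functions at `v = 1` (junk value at poles). -/
def evOne (f : KK) : ℚ := RatFunc.eval (RingHom.id ℚ) 1 f

theorem denom_eval_ne_zero_of_dvd {p q : Polynomial ℚ} (h : p ∣ q) (hq : q.eval 1 ≠ 0) :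
    p.eval 1 ≠ 0 := by
  obtain ⟨r, rfl⟩ := h
  rw [Polynomial.eval_mul] at hq
  exact left_ne_zero_of_mul hq

/-- the subring of rational functions that are regular at `v = 1`. -/
def locOne : Subring KK where
  carrier := {f | f.denom.eval 1 ≠ 0}
  mul_mem' {a b} ha hb := denom_eval_ne_zero_of_dvd (RatFunc.denom_mul_dvd a b) (by
    rw [Polynomial.eval_mul]; exact mul_ne_zero ha hb)
  one_mem' := by simp
  add_mem' {a b} ha hb := denom_eval_ne_zero_of_dvd (RatFunc.denom_add_dvd a b) (by
    rw [Polynomial.eval_mul]; exact mul_ne_zero ha hb)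
  zero_mem' := by simp
  neg_mem' {a} ha := by
    have h : (-a).denom ∣ (RatFunc.C (-1 : ℚ)).denom * a.denom := by
      have := RatFunc.denom_mul_dvd (RatFunc.C (-1 : ℚ)) a
      have h2 : (RatFunc.C (-1 : ℚ)) * a = -a := by simp
      rwa [h2] at this
    refine denom_eval_ne_zero_of_dvd h ?_
    rw [RatFunc.denom_C, one_mul]; exact ha

theorem mem_locOne {f : KK} : f ∈ locOne ↔ f.denom.eval 1 ≠ 0 := Iff.rfl

theorem mem_locOne' {f : KK} :
    f ∈ locOne ↔ Polynomial.eval₂ (RingHom.id ℚ) 1 f.denom ≠ 0 := by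
  rw [mem_locOne, Polynomial.eval]

theorem evOne_add {a b : KK} (ha : a ∈ locOne) (hb : b ∈ locOne) :
    evOne (a + b) = evOne a + evOne b :=
  RatFunc.eval_add _ _ (mem_locOne'.1 ha) (mem_locOne'.1 hb)

theorem evOne_mul {a b : KK} (ha : a ∈ locOne) (hb : b ∈ locOne) :
    evOne (a * b) = evOne a * evOne b :=
  RatFunc.eval_mul _ _ (mem_locOne'.1 ha) (mem_locOne'.1 hb)

@[simp] theorem evOne_one : evOne 1 = 1 := RatFunc.eval_one _ _
@[simp] theorem evOne_zero : evOne 0 = 0 := RatFunc.eval_zero _ _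
@[simp] theorem evOne_vv : evOne vv = 1 := RatFunc.eval_X ..

theorem C_mem_locOne (c : ℚ) : RatFunc.C c ∈ locOne := by
  rw [mem_locOne, RatFunc.denom_C]; simp

theorem evOne_C (c : ℚ) : evOne (RatFunc.C c) = c := by
  exact RatFunc.eval_C _ _

theorem vv_mem : vv ∈ locOne := by
  rw [mem_locOne, vv, RatFunc.denom_X]; simp

theorem vv_ne_zero : vv ≠ 0 := RatFunc.X_ne_zero

/-- evaluation at `v = 1` as a ring homomorphism. -/
def evHom : locOne →+* ℚ where
  toFun f := evOne f
  map_one' := evOne_one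
  map_zero' := evOne_zero
  map_add' a b := evOne_add a.2 b.2
  map_mul' a b := evOne_mul a.2 b.2

theorem mem_of_denom_or_num {f : KK} : f ∈ locOne ∨ (f.num.eval 1 ≠ 0) := by
  by_contra! h
  obtain ⟨h1, h2⟩ := h
  rw [mem_locOne, not_not] at h1
  obtain ⟨a, b, hab⟩ := RatFunc.isCoprime_num_denom f
  have := congrArg (Polynomial.eval 1) hab
  simp [h1, h2] at this

theorem inv_mem_of_num {f : KK} (h : f.num.eval 1 ≠ 0) : f⁻¹ ∈ locOne := by
  have hf : f ≠ 0 := by rintro rfl; simp at h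
  exact denom_eval_ne_zero_of_dvd (RatFunc.denom_inv_dvd hf) h

theorem mem_or_inv_mem (f : KK) : f ∈ locOne ∨ f⁻¹ ∈ locOne :=
  mem_of_denom_or_num.imp_right inv_mem_of_num

theorem num_eval_of_evOne {f : KK} (h : evOne f ≠ 0) : f.num.eval 1 ≠ 0 := by
  intro h0
  apply h
  rw [evOne, RatFunc.eval, Polynomial.eval₂_id, h0, zero_div]

theorem inv_mem_of_evOne {f : KK} (h : evOne f ≠ 0) : f⁻¹ ∈ locOne :=
  inv_mem_of_num (num_eval_of_evOne h)

theorem evOne_inv {f : KK} (hf : f ∈ locOne) (h : evOne f ≠ 0) : evOne f⁻¹ = (evOne f)⁻¹ := by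
  have h0 : f ≠ 0 := by rintro rfl; simp at h
  have := evOne_mul hf (inv_mem_of_evOne h)
  rw [mul_inv_cancel₀ h0, evOne_one] at this
  exact eq_inv_of_mul_eq_one_right this.symm

theorem vpow_mem (m : ℤ) : vpow m ∈ locOne := by
  have hi : vv⁻¹ ∈ locOne := inv_mem_of_evOne (by simp)
  rcases m with m | m
  · simpa [vpow] using pow_mem vv_mem m
  · rw [vpow, zpow_negSucc, ← inv_pow]; exact pow_mem hi _

theorem vpow_ne_zero (m : ℤ) : vpow m ≠ 0 := zpow_ne_zero _ vv_ne_zero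

theorem vpow_add (a b : ℤ) : vpow (a + b) = vpow a * vpow b := zpow_add₀ vv_ne_zero a b

theorem evOne_pow {f : KK} (hf : f ∈ locOne) (k : ℕ) : evOne (f ^ k) = evOne f ^ k := by
  exact map_pow evHom ⟨f, hf⟩ k

theorem evOne_vpow (m : ℤ) : evOne (vpow m) = 1 := by
  rcases m with m | m
  · simp [vpow, evOne_pow vv_mem]
  · rw [vpow, zpow_negSucc, evOne_inv (pow_mem vv_mem _)] <;> simp [evOne_pow vv_mem]

theorem evOne_sub {a b : KK} (ha : a ∈ locOne) (hb : b ∈ locOne) :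
    evOne (a - b) = evOne a - evOne b := map_sub evHom ⟨a, ha⟩ ⟨b, hb⟩

/-- the uniformizer `v - 1` of the local ring. -/
def unif : locOne := ⟨vv - 1, sub_mem vv_mem (one_mem _)⟩

theorem evHom_unif : evHom unif = 0 := by
  show evOne (vv - 1) = 0
  rw [evOne_sub vv_mem (one_mem _)]; simp

theorem dvd_of_evHom_eq_zero {f : locOne} (h : evHom f = 0) : unif ∣ f := by
  have hf : Polynomial.eval 1 f.1.denom ≠ 0 := f.2
  have hnum : f.1.num.eval 1 = 0 := by
    have : evOne f.1 = 0 := h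
    rw [evOne, RatFunc.eval, Polynomial.eval₂_id, Polynomial.eval₂_id] at this
    exact (div_eq_zero_iff.1 this).resolve_right hf
  obtain ⟨q, hq⟩ := Polynomial.dvd_iff_isRoot.2 hnum
  have hd : (algebraMap (Polynomial ℚ) KK f.1.denom)⁻¹ ∈ locOne := by
    apply inv_mem_of_num
    rw [RatFunc.num_algebraMap]; exact hf
  have hqm : algebraMap (Polynomial ℚ) KK q ∈ locOne := by
    rw [mem_locOne, RatFunc.denom_algebraMap]; simp
  refine ⟨⟨_, mul_mem hqm hd⟩, Subtype.ext ?_⟩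
  have : f.1 = algebraMap (Polynomial ℚ) KK f.1.num * (algebraMap (Polynomial ℚ) KK f.1.denom)⁻¹ := by
    rw [← div_eq_mul_inv]; exact (RatFunc.num_div_denom f.1).symm
  refine this.trans ?_
  rw [hq]
  simp only [unif, MulMemClass.mk_mul_mk, map_mul, map_sub, map_one,
    RatFunc.algebraMap_X, vv, mul_assoc]

theorem isUnit_of_evHom_ne_zero {f : locOne} (h : evHom f ≠ 0) : IsUnit f := by
  have h0 : f.1 ≠ 0 := by
    intro h0
    apply h
    show evOne f.1 = 0
    rw [h0, evOne_zero]
  exact IsUnit.of_mul_eq_one ⟨f.1⁻¹, inv_mem_of_evOne h⟩ (Subtype.ext (mul_inv_cancel₀ h0))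

theorem unif_mem_jacobson : Ideal.span {unif} ≤ (⊥ : Ideal locOne).jacobson := by
  rw [Ideal.span_singleton_le_iff_mem, Ideal.mem_jacobson_bot]
  intro y
  apply isUnit_of_evHom_ne_zero
  simp [evHom_unif]

theorem exists_scale {ι : Type*} (s : Finset ι) (c : ι → KK) (h : ∃ i ∈ s, c i ≠ 0) :
    ∃ i ∈ s, c i ≠ 0 ∧ ∀ j ∈ s, c j / c i ∈ locOne := by
  classical
  induction s using Finset.induction_on with
  | empty => simp at h
  | insert a s ha ih =>
    by_cases hs : ∃ i ∈ s, c i ≠ 0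
    · obtain ⟨i, his, hi, hj⟩ := ih hs
      rcases mem_or_inv_mem (c a / c i) with h1 | h1
      · refine ⟨i, Finset.mem_insert_of_mem his, hi, ?_⟩
        simpa [Finset.forall_mem_insert] using ⟨h1, hj⟩
      · by_cases ha0 : c a = 0
        · refine ⟨i, Finset.mem_insert_of_mem his, hi, ?_⟩
          rw [Finset.forall_mem_insert]
          exact ⟨by simp [ha0, zero_mem], hj⟩
        · refine ⟨a, Finset.mem_insert_self _ _, ha0, ?_⟩
          rw [Finset.forall_mem_insert]
          refine ⟨by simp [ha0, one_mem], fun j hjs => ?_⟩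
          have := mul_mem (hj j hjs) h1
          rwa [inv_div, div_mul_div_cancel₀ hi] at this
    · push Not at hs
      obtain ⟨i, hi, hi0⟩ := h
      rcases Finset.mem_insert.1 hi with rfl | hi
      · refine ⟨i, Finset.mem_insert_self _ _, hi0, ?_⟩
        rw [Finset.forall_mem_insert]
        refine ⟨by simp [hi0, one_mem], fun j hjs => ?_⟩
        simp [hs j hjs, zero_mem]
      · exact absurd (hs i hi) hi0

/-! ### Representations on spans of order ideals -/

/-- A finite coloured poset of points with spectral parameters `x` and structure constants `θ`
satisfying the pair relations needed to represent `U_v^>(Lo_{2n})`. -/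
structure PointData (n : ℕ) where
  X : Type
  [fin : Fintype X]
  [dec : DecidableEq X]
  col : X → ℕ
  x : X → KK
  lt : X → X → Prop
  θ : X → X → KK
  lt_irrefl : ∀ p, ¬ lt p p
  x_ne : ∀ p, x p ≠ 0
  θ_zero : ∀ p q, lt p q → θ p q = 0
  pair : ∀ p q, p ≠ q → (∀ r, ¬ (lt p r ∧ lt r q)) → (∀ r, ¬ (lt q r ∧ lt r p)) →
    (x p - vpow (aD n (col p) (col q)) * x q) * θ p q =
      (vpow (aD n (col p) (col q)) * x p - x q) * θ q p
  pair_zero : ∀ p q, p ≠ q → (∀ r, ¬ (lt p r ∧ lt r q)) → (∀ r, ¬ (lt q r ∧ lt r p)) →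
    aD n (col p) (col q) = 0 → θ p q = θ q p
  same_col : ∀ p q, p ≠ q → col p = col q →
    (∃ r s, r ≠ s ∧ lt p r ∧ lt r q ∧ lt p s ∧ lt s q) ∨
    (∃ r s, r ≠ s ∧ lt q r ∧ lt r p ∧ lt q s ∧ lt s p) ∨
    (¬ lt p q ∧ ¬ lt q p ∧ ∀ r, ¬ ((lt p r ∨ lt r p) ∧ (lt q r ∨ lt r q)))

namespace PointData
variable {n : ℕ} (D : PointData n)

instance : Fintype D.X := D.fin
instance : DecidableEq D.X := D.dec

/-- order ideals of the point poset. -/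
def IsIdeal (S : Finset D.X) : Prop := ∀ q ∈ S, ∀ p, D.lt p q → p ∈ S

/-- the total structure constant of a point against a set of points. -/
def W (S : Finset D.X) (p : D.X) : KK := ∏ q ∈ S, D.θ p q

open Classical in
/-- matrix coefficient for adding the point `p` to `S`. -/
def coef (c : ℕ) (r : ℤ) (S : Finset D.X) (p : D.X) : KK :=
  if D.col p = c ∧ p ∉ S ∧ D.IsIdeal (insert p S) then D.x p ^ r * D.W S p else 0

/-- the operator of `e_{c,r}`: add a point of colour `c`. -/
def op (c : ℕ) (r : ℤ) : Module.End KK (Finset D.X →₀ KK) :=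
  Finsupp.linearCombination KK
    (fun S => ∑ p, D.coef c r S p • Finsupp.single (insert p S) (1 : KK))

theorem op_single (c : ℕ) (r : ℤ) (S : Finset D.X) :
    D.op c r (Finsupp.single S 1) =
      ∑ p, D.coef c r S p • Finsupp.single (insert p S) (1 : KK) := by
  simp [op]

theorem op_op (c d : ℕ) (r s : ℤ) (S : Finset D.X) :
    (D.op c r * D.op d s) (Finsupp.single S 1) = ∑ q, ∑ p,
      (D.coef d s S q * D.coef c r (insert q S) p) •
        Finsupp.single (insert p (insert q S)) (1 : KK) := by
  simp only [Module.End.mul_apply, op_single, map_sum, map_smul, Finset.smul_sum, smul_smul]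

theorem op_op_op (c d e : ℕ) (r s t : ℤ) (S : Finset D.X) :
    (D.op c r * D.op d s * D.op e t) (Finsupp.single S 1) = ∑ q, ∑ p, ∑ o,
      (D.coef e t S q * D.coef d s (insert q S) p * D.coef c r (insert p (insert q S)) o) •
        Finsupp.single (insert o (insert p (insert q S))) (1 : KK) := by
  simp only [Module.End.mul_apply, op_single, map_sum, map_smul, Finset.smul_sum, smul_smul,
    mul_assoc]

variable {D}

theorem W_ne {S : Finset D.X} {p : D.X} (h : D.W S p ≠ 0) : ∀ q ∈ S, ¬ D.lt p q := fun q hq hl =>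
  h (Finset.prod_eq_zero hq (D.θ_zero p q hl))

theorem IsIdeal.of_insert {S : Finset D.X} {p : D.X} (h : D.IsIdeal (insert p S))
    (hp : D.W S p ≠ 0) : D.IsIdeal S := fun q hq r hr =>
  (Finset.mem_insert.1 (h q (Finset.mem_insert_of_mem hq) r hr)).resolve_left
    (fun e => W_ne hp q hq (e ▸ hr))

theorem W_insert {S : Finset D.X} {p q : D.X} (h : q ∉ S) :
    D.W (insert q S) p = D.θ p q * D.W S p := Finset.prod_insert h

open Classical in
theorem coef_two (c d : ℕ) (r s : ℤ) (S : Finset D.X) (p q : D.X) :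
    D.coef d s S q * D.coef c r (insert q S) p =
      if D.col p = c ∧ D.col q = d ∧ p ≠ q ∧ p ∉ S ∧ q ∉ S ∧ D.IsIdeal (insert p (insert q S)) then
        D.x p ^ r * D.x q ^ s * D.θ p q * (D.W S p * D.W S q) else 0 := by
  by_cases hq : q ∈ S
  · simp [coef, hq]
  by_cases hpq : p = q
  · simp [coef, hpq]
  by_cases hp : p ∈ S
  · simp [coef, hp]
  by_cases hc : D.col p = c
  swap
  · simp [coef, hc]
  by_cases hd : D.col q = d
  swap
  · simp [coef, hd]
  by_cases hI : D.IsIdeal (insert p (insert q S))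
  swap
  · simp [coef, hI]
  by_cases hW : D.W (insert q S) p = 0
  · have hW' := hW
    rw [W_insert hq] at hW'
    simp only [coef, hW, mul_zero, ite_self]
    rw [show D.x p ^ r * D.x q ^ s * D.θ p q * (D.W S p * D.W S q) =
      D.x p ^ r * D.x q ^ s * (D.θ p q * D.W S p) * D.W S q by ring, hW']
    simp
  · have hI' := hI.of_insert hW
    simp only [coef, hc, hd, hq, hpq, hp, hI, hI', Finset.mem_insert, not_false_eq_true, ne_eq,
      or_self, and_self, if_true, W_insert hq]
    ring

open Classical in
theorem coef_three (c d e : ℕ) (r s t : ℤ) (S : Finset D.X) (o p q : D.X) :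
    D.coef e t S q * D.coef d s (insert q S) p * D.coef c r (insert p (insert q S)) o =
      if D.col o = c ∧ D.col p = d ∧ D.col q = e ∧ o ≠ p ∧ o ≠ q ∧ p ≠ q ∧
        o ∉ S ∧ p ∉ S ∧ q ∉ S ∧ D.IsIdeal (insert o (insert p (insert q S))) then
        D.x o ^ r * D.x p ^ s * D.x q ^ t * (D.θ o p * D.θ o q * D.θ p q) *
          (D.W S o * D.W S p * D.W S q) else 0 := by
  rw [coef_two]
  by_cases hq : q ∈ S
  · simp [hq]
  by_cases hpq : p = q
  · simp [hpq]
  by_cases hp : p ∈ S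
  · simp [hp]
  by_cases hop : o = p
  · simp [coef, hop]
  by_cases hoq : o = q
  · simp [coef, hoq]
  by_cases ho : o ∈ S
  · simp [coef, ho]
  by_cases hc : D.col o = c
  swap
  · simp [coef, hc]
  by_cases hd : D.col p = d
  swap
  · simp [hd]
  by_cases he : D.col q = e
  swap
  · simp [he]
  by_cases hI : D.IsIdeal (insert o (insert p (insert q S)))
  swap
  · simp [coef, hI]
  have hpS : p ∉ insert q S := by simp [hpq, hp]
  by_cases hW : D.W (insert p (insert q S)) o = 0
  · have hW' := hW
    rw [W_insert hpS, W_insert hq] at hW'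
    simp only [coef, hW, mul_zero, ite_self]
    rw [show D.x o ^ r * D.x p ^ s * D.x q ^ t * (D.θ o p * D.θ o q * D.θ p q) *
          (D.W S o * D.W S p * D.W S q) = D.x o ^ r * D.x p ^ s * D.x q ^ t * D.θ p q *
            (D.W S p * D.W S q) * (D.θ o p * (D.θ o q * D.W S o)) by ring, hW']
    simp
  · have hI' := hI.of_insert hW
    simp only [coef, hc, hd, he, hq, hpq, hp, ho, hop, hoq, hI, hI', Finset.mem_insert,
      not_false_eq_true, ne_eq, or_self, and_self, if_true, W_insert hq, W_insert hpS]
    ring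

variable (D)

theorem end_ext {f g : Module.End KK (Finset D.X →₀ KK)}
    (h : ∀ S, f (Finsupp.single S 1) = g (Finsupp.single S 1)) : f = g := by
  apply Finsupp.lhom_ext'
  intro S
  ext
  simpa using DFunLike.congr_fun (h S) _

theorem no_between {S : Finset D.X} {p q : D.X} (hI : D.IsIdeal (insert p (insert q S)))
    (h : D.W S p ≠ 0) (r : D.X) : ¬ (D.lt p r ∧ D.lt r q) := by
  rintro ⟨h1, h2⟩
  have := hI q (by simp) r h2
  simp only [Finset.mem_insert] at this
  rcases this with rfl | rfl | hr
  · exact D.lt_irrefl _ h1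
  · exact D.lt_irrefl _ h2
  · exact W_ne h r hr h1

theorem pair_ideal {S : Finset D.X} {p q : D.X} (hpq : p ≠ q)
    (hI : D.IsIdeal (insert p (insert q S))) :
    ((D.x p - vpow (aD n (D.col p) (D.col q)) * D.x q) * D.θ p q -
      (vpow (aD n (D.col p) (D.col q)) * D.x p - D.x q) * D.θ q p) * (D.W S p * D.W S q) = 0 := by
  by_cases hp : D.W S p = 0
  · simp [hp]
  by_cases hq : D.W S q = 0
  · simp [hq]
  rw [D.pair p q hpq (D.no_between hI hp) (D.no_between (Finset.insert_comm p q S ▸ hI) hq)]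
  simp

theorem op_loop (i j : ℕ) (r s : ℤ) :
    D.op i (r + 1) * D.op j s - vpow (aD n i j) • (D.op i r * D.op j (s + 1)) =
    vpow (aD n i j) • (D.op j s * D.op i (r + 1)) - D.op j (s + 1) * D.op i r := by
  classical
  apply D.end_ext
  intro S
  simp only [LinearMap.sub_apply, LinearMap.smul_apply, op_op]
  conv_rhs => rw [Finset.sum_comm]
              enter [2]
              rw [Finset.sum_comm]
  simp only [Finset.smul_sum, ← Finset.sum_sub_distrib, smul_smul]
  refine Finset.sum_congr rfl fun q _ => Finset.sum_congr rfl fun p _ => ?_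
  rw [Finset.insert_comm q p, ← sub_smul, ← sub_smul]
  congr 1
  simp only [coef_two]
  rw [Finset.insert_comm q p]
  by_cases hc : D.col p = i ∧ D.col q = j ∧ p ≠ q ∧ p ∉ S ∧ q ∉ S ∧
      D.IsIdeal (insert p (insert q S))
  · obtain ⟨rfl, rfl, hpq, hp, hq, hI⟩ := hc
    simp only [hpq, hpq.symm, hp, hq, hI, not_false_eq_true, ne_eq, and_self, if_true,
      zpow_add_one₀ (D.x_ne _)]
    have := D.pair_ideal hpq hI
    linear_combination (D.x p ^ r * D.x q ^ s) * this
  · have hc' : ¬ (D.col q = j ∧ D.col p = i ∧ q ≠ p ∧ q ∉ S ∧ p ∉ S ∧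
      D.IsIdeal (insert p (insert q S))) := by
      rintro ⟨a, b, c, d, e, f⟩
      exact hc ⟨b, a, c.symm, e, d, f⟩
    simp [hc, hc']

theorem op_comm (i j : ℕ) (hij : aD n i j = 0) (r s : ℤ) :
    D.op i r * D.op j s = D.op j s * D.op i r := by
  classical
  apply D.end_ext
  intro S
  simp only [op_op]
  conv_rhs => rw [Finset.sum_comm]
  refine Finset.sum_congr rfl fun q _ => Finset.sum_congr rfl fun p _ => ?_
  rw [Finset.insert_comm q p]
  congr 1
  simp only [coef_two]
  rw [Finset.insert_comm q p]
  by_cases hc : D.col p = i ∧ D.col q = j ∧ p ≠ q ∧ p ∉ S ∧ q ∉ S ∧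
      D.IsIdeal (insert p (insert q S))
  · obtain ⟨rfl, rfl, hpq, hp, hq, hI⟩ := hc
    simp only [hpq, hpq.symm, hp, hq, hI, not_false_eq_true, ne_eq, and_self, if_true]
    by_cases hWp : D.W S p = 0
    · simp [hWp]
    by_cases hWq : D.W S q = 0
    · simp [hWq]
    rw [D.pair_zero p q hpq (D.no_between hI hWp)
      (D.no_between (Finset.insert_comm p q S ▸ hI) hWq) hij]
    ring
  · have hc' : ¬ (D.col q = j ∧ D.col p = i ∧ q ≠ p ∧ q ∉ S ∧ p ∉ S ∧
      D.IsIdeal (insert p (insert q S))) := by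
      rintro ⟨a, b, c, d, e, f⟩
      exact hc ⟨b, a, c.symm, e, d, f⟩
    simp [hc, hc']

end PointData

theorem exists_factor {a b u t : KK} (h : a * u = b * t) (hab : a ≠ 0 ∨ b ≠ 0) :
    ∃ A, u = b * A ∧ t = a * A := by
  by_cases ha : a = 0
  · have hb : b ≠ 0 := hab.resolve_left (not_not.2 ha)
    refine ⟨u / b, by field_simp, ?_⟩
    subst ha
    simpa [hb] using h.symm
  · exact ⟨t / a, by field_simp; linear_combination h, by field_simp⟩

theorem vpow_ne_one {m : ℤ} (hm : m ≠ 0) : vpow m ≠ 1 := by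
  have key : ∀ k : ℕ, k ≠ 0 → vv ^ k ≠ 1 := by
    intro k hk h
    have h2 : algebraMap (Polynomial ℚ) KK (Polynomial.X ^ k) = algebraMap (Polynomial ℚ) KK 1 := by
      rw [map_pow, RatFunc.algebraMap_X, map_one]; exact h
    have h3 := congrArg Polynomial.natDegree (RatFunc.algebraMap_injective ℚ h2)
    simp at h3
    exact hk h3
  rcases m with m | m
  · simpa [vpow] using key m (by rintro rfl; exact hm rfl)
  · simpa [vpow, zpow_negSucc] using key (m + 1) (by omega)

theorem vpow_coprime {m : ℤ} (hm : m ≠ 0) {x y : KK} (hx : x ≠ 0) :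
    x - vpow m * y ≠ 0 ∨ vpow m * x - y ≠ 0 := by
  by_contra! h
  obtain ⟨h1, h2⟩ := h
  have h3 : (vpow (m + m) - 1) * x = 0 := by
    rw [vpow_add]; linear_combination vpow m * h2 - h1
  exact vpow_ne_one (by omega) (sub_eq_zero.1 ((mul_eq_zero.1 h3).resolve_right hx))

/-- the cancellation behind the quantum Serre relation between two adjacent nodes. -/
theorem serre_identity {z₁ z₂ w a b c d e f : KK} (hz₁ : z₁ ≠ 0) (hz₂ : z₂ ≠ 0)
    (h12 : (z₁ - vpow 2 * z₂) * a = (vpow 2 * z₁ - z₂) * b)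
    (h1 : (z₁ - vpow (-1) * w) * c = (vpow (-1) * z₁ - w) * d)
    (h2 : (z₂ - vpow (-1) * w) * e = (vpow (-1) * z₂ - w) * f) :
    a * c * e - (vv + vv⁻¹) * (a * c * f) + a * d * f +
      (b * e * c - (vv + vv⁻¹) * (b * e * d) + b * f * d) = 0 := by
  obtain ⟨A, rfl, rfl⟩ := exists_factor h12 (vpow_coprime (by norm_num) hz₁)
  obtain ⟨B, rfl, rfl⟩ := exists_factor h1 (vpow_coprime (by norm_num) hz₁)
  obtain ⟨C, rfl, rfl⟩ := exists_factor h2 (vpow_coprime (by norm_num) hz₂)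
  have hv := vv_ne_zero
  simp only [vpow, zpow_neg_one, show vv ^ (2 : ℤ) = vv ^ 2 from by norm_cast]
  field_simp
  ring

namespace PointData
variable {n : ℕ} (D : PointData n)

open Classical in
/-- coefficient of adding `q`, then `p`, then `o`. -/
def coefThree (c d e : ℕ) (r s t : ℤ) (S : Finset D.X) (o p q : D.X) : KK :=
  if D.col o = c ∧ D.col p = d ∧ D.col q = e ∧ o ≠ p ∧ o ≠ q ∧ p ≠ q ∧
    o ∉ S ∧ p ∉ S ∧ q ∉ S ∧ D.IsIdeal (insert o (insert p (insert q S))) then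
    D.x o ^ r * D.x p ^ s * D.x q ^ t * (D.θ o p * D.θ o q * D.θ p q) *
      (D.W S o * D.W S p * D.W S q) else 0

theorem op_three (c d e : ℕ) (r s t : ℤ) (S : Finset D.X) :
    (D.op c r * D.op d s * D.op e t) (Finsupp.single S 1) = ∑ o, ∑ p, ∑ q,
      D.coefThree c d e r s t S o p q •
        Finsupp.single (insert o (insert p (insert q S))) (1 : KK) := by
  rw [op_op_op]
  simp only [coef_three]
  unfold coefThree
  rw [Finset.sum_comm]
  rw [Finset.sum_congr rfl fun p _ => Finset.sum_comm]
  rw [Finset.sum_comm]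

theorem coefThree_serre (i j : ℕ) (hij : aD n i j = -1) (r s t : ℤ) (S : Finset D.X)
    (p q w : D.X) :
    D.coefThree i i j r s t S p q w - (vv + vv⁻¹) * D.coefThree i j i r t s S p w q +
      D.coefThree j i i t r s S w p q +
    (D.coefThree i i j s r t S q p w - (vv + vv⁻¹) * D.coefThree i j i s t r S q w p +
      D.coefThree j i i t s r S w q p) = 0 := by
  classical
  have e1 : insert p (insert w (insert q S)) = insert p (insert q (insert w S)) := by
    ext; simp only [Finset.mem_insert]; tauto
  have e2 : insert w (insert p (insert q S)) = insert p (insert q (insert w S)) := by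
    ext; simp only [Finset.mem_insert]; tauto
  have e3 : insert q (insert p (insert w S)) = insert p (insert q (insert w S)) := by
    ext; simp only [Finset.mem_insert]; tauto
  have e4 : insert q (insert w (insert p S)) = insert p (insert q (insert w S)) := by
    ext; simp only [Finset.mem_insert]; tauto
  have e5 : insert w (insert q (insert p S)) = insert p (insert q (insert w S)) := by
    ext; simp only [Finset.mem_insert]; tauto
  simp only [coefThree, e1, e2, e3, e4, e5]
  by_cases hp : D.col p = i
  swap
  · simp [hp]
  by_cases hq : D.col q = i
  swap
  · simp [hq]
  by_cases hw : D.col w = j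
  swap
  · simp [hw]
  by_cases hpq : p = q
  · simp [hpq]
  by_cases hpw : p = w
  · simp [hpw]
  by_cases hqw : q = w
  · simp [hqw]
  by_cases hpS : p ∈ S
  · simp [hpS]
  by_cases hqS : q ∈ S
  · simp [hqS]
  by_cases hwS : w ∈ S
  · simp [hwS]
  by_cases hI : D.IsIdeal (insert p (insert q (insert w S)))
  swap
  · simp [hI]
  have hqp : q ≠ p := fun h => hpq h.symm
  have hwp : w ≠ p := fun h => hpw h.symm
  have hwq : w ≠ q := fun h => hqw h.symm
  simp only [hp, hq, hw, hpq, hpw, hqw, hqp, hwp, hwq, hpS, hqS, hwS, hI, not_false_eq_true, ne_eq,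
    and_self, if_true]
  by_cases Wp : D.W S p = 0
  · simp [Wp]
  by_cases Wq : D.W S q = 0
  · simp [Wq]
  by_cases Ww : D.W S w = 0
  · simp [Ww]
  have mem : ∀ a b, (b = p ∨ b = q ∨ b = w) → D.lt a b → a = p ∨ a = q ∨ a = w ∨ a ∈ S := by
    intro a b hb hab
    have := hI b (by simpa [Finset.mem_insert] using by tauto) a hab
    simpa [Finset.mem_insert] using this
  have bad : ∀ a b, (a = p ∨ a = q ∨ a = w) → D.lt a b → b ∉ S := by
    rintro a b (rfl | rfl | rfl) hab hb
    exacts [W_ne Wp b hb hab, W_ne Wq b hb hab, W_ne Ww b hb hab]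
  have btw : ∀ a b, (a = p ∨ a = q) → (b = p ∨ b = q) → ∀ u, D.lt a u → D.lt u b → u ≠ p → u ≠ q →
      u = w := by
    intro a b ha hb u hau hub hup huq
    rcases mem u b (by tauto) hub with h | h | h | h
    · exact absurd h hup
    · exact absurd h huq
    · exact h
    · exact absurd h (bad a u (by tauto) hau)
  have irr := D.lt_irrefl
  have inc : ¬ D.lt p q ∧ ¬ D.lt q p ∧
      ∀ u, ¬ ((D.lt p u ∨ D.lt u p) ∧ (D.lt q u ∨ D.lt u q)) := by
    rcases D.same_col p q hpq (hp.trans hq.symm) with ⟨u, u', hu, h1, h2, h3, h4⟩ |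
      ⟨u, u', hu, h1, h2, h3, h4⟩ | h
    · refine absurd ((btw p q (by simp) (by simp) u h1 h2 ?_ ?_).trans
        (btw p q (by simp) (by simp) u' h3 h4 ?_ ?_).symm) hu <;> rintro rfl <;>
        first | exact irr _ ‹_›
    · refine absurd ((btw q p (by simp) (by simp) u h1 h2 ?_ ?_).trans
        (btw q p (by simp) (by simp) u' h3 h4 ?_ ?_).symm) hu <;> rintro rfl <;>
        first | exact irr _ ‹_›
    · exact h
  obtain ⟨i1, i2, i3⟩ := inc
  have nb : ∀ a b, a ≠ b → (a = p ∨ a = q ∨ a = w) → (b = p ∨ b = q ∨ b = w) →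
      ∀ u, ¬ (D.lt a u ∧ D.lt u b) := by
    rintro a b hab ha hb u ⟨h1, h2⟩
    have hu := mem u b hb h2
    have hu' : u ∉ S := bad a u ha h1
    have := i3 w
    have := irr p
    have := irr q
    have := irr w
    rcases ha with rfl | rfl | rfl <;> rcases hb with rfl | rfl | rfl <;>
      rcases hu with rfl | rfl | rfl | hu <;> first | exact absurd rfl hab | tauto
  have P12 := D.pair p q hpq (nb p q hpq (by simp) (by simp)) (nb q p hqp (by simp) (by simp))
  have P1 := D.pair p w hpw (nb p w hpw (by simp) (by simp)) (nb w p hwp (by simp) (by simp))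
  have P2 := D.pair q w hqw (nb q w hqw (by simp) (by simp)) (nb w q hwq (by simp) (by simp))
  rw [hp, hq, show aD n i i = 2 by simp [aD]] at P12
  rw [hp, hw, hij] at P1
  rw [hq, hw, hij] at P2
  have := serre_identity (D.x_ne p) (D.x_ne q) P12 P1 P2
  linear_combination (D.x p ^ r * D.x q ^ s * D.x w ^ t * (D.W S p * D.W S q * D.W S w)) * this

theorem op_serre (i j : ℕ) (hij : aD n i j = -1) (r s t : ℤ) :
    D.op i r * D.op i s * D.op j t - (vv + vv⁻¹) • (D.op i r * D.op j t * D.op i s) +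
      D.op j t * D.op i r * D.op i s +
    (D.op i s * D.op i r * D.op j t - (vv + vv⁻¹) • (D.op i s * D.op j t * D.op i r) +
      D.op j t * D.op i s * D.op i r) = 0 := by
  apply D.end_ext
  intro S
  simp only [LinearMap.add_apply, LinearMap.sub_apply, LinearMap.smul_apply, op_three,
    LinearMap.zero_apply]
  have f2 : ∀ f : D.X → D.X → D.X → Finset D.X →₀ KK,
      ∑ o, ∑ p, ∑ q, f o p q = ∑ o, ∑ q, ∑ p, f o p q := fun f =>
    Finset.sum_congr rfl fun _ _ => Finset.sum_comm
  have f3 : ∀ f : D.X → D.X → D.X → Finset D.X →₀ KK,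
      ∑ o, ∑ p, ∑ q, f o p q = ∑ p, ∑ q, ∑ o, f o p q := fun f => by
    rw [Finset.sum_comm]; exact f2 _
  have f4 : ∀ f : D.X → D.X → D.X → Finset D.X →₀ KK,
      ∑ o, ∑ p, ∑ q, f o p q = ∑ q, ∑ o, ∑ p, f o p q := fun f => by
    rw [f2]; exact Finset.sum_comm
  have f5 : ∀ f : D.X → D.X → D.X → Finset D.X →₀ KK,
      ∑ o, ∑ p, ∑ q, f o p q = ∑ q, ∑ p, ∑ o, f o p q := fun f => by
    rw [f2, Finset.sum_comm]; exact f2 _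
  rw [f2 fun o p q => D.coefThree i j i r t s S o p q • _,
    f3 fun o p q => D.coefThree j i i t r s S o p q • _,
    Finset.sum_comm (f := fun o p => ∑ q, D.coefThree i i j s r t S o p q • _),
    f4 fun o p q => D.coefThree i j i s t r S o p q • _,
    f5 fun o p q => D.coefThree j i i t s r S o p q • _]
  simp only [Finset.smul_sum, ← Finset.sum_sub_distrib, smul_smul, ← Finset.sum_add_distrib]
  refine Finset.sum_eq_zero fun p _ => Finset.sum_eq_zero fun q _ =>
    Finset.sum_eq_zero fun w _ => ?_
  have e1 : insert p (insert w (insert q S)) = insert p (insert q (insert w S)) := by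
    ext; simp only [Finset.mem_insert]; tauto
  have e2 : insert w (insert p (insert q S)) = insert p (insert q (insert w S)) := by
    ext; simp only [Finset.mem_insert]; tauto
  have e3 : insert q (insert p (insert w S)) = insert p (insert q (insert w S)) := by
    ext; simp only [Finset.mem_insert]; tauto
  have e4 : insert q (insert w (insert p S)) = insert p (insert q (insert w S)) := by
    ext; simp only [Finset.mem_insert]; tauto
  have e5 : insert w (insert q (insert p S)) = insert p (insert q (insert w S)) := by
    ext; simp only [Finset.mem_insert]; tauto
  rw [e1, e2, e3, e4, e5, ← sub_smul, ← sub_smul, ← add_smul, ← add_smul, ← add_smul,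
    D.coefThree_serre i j hij, zero_smul]

end PointData

theorem vv_ne_inv : vv - vv⁻¹ ≠ 0 := by
  intro h
  have h2 : vv = vv⁻¹ := sub_eq_zero.1 h
  apply vpow_ne_one (m := 2) (by norm_num)
  have hv := vv_ne_zero
  rw [vpow, zpow_ofNat, pow_two]
  nth_rewrite 1 [h2]
  exact inv_mul_cancel₀ hv

theorem qInt_one : qInt vv 1 = 1 := by
  simp [qInt, div_self vv_ne_inv]

theorem qInt_two : qInt vv 2 = vv + vv⁻¹ := by
  have hv := vv_ne_zero
  rw [qInt, div_eq_iff vv_ne_inv]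
  have h1 : vv ^ ((2 : ℕ) : ℤ) = vv ^ 2 := zpow_natCast _ _
  have h2 : vv ^ (-((2 : ℕ) : ℤ)) = (vv⁻¹) ^ 2 := by rw [zpow_neg, zpow_natCast, inv_pow]
  rw [h1, h2]; ring

theorem qBinom_one_zero : qBinom vv 1 0 = 1 := by
  simp [qBinom, qFact, qInt_one]
theorem qBinom_one_one : qBinom vv 1 1 = 1 := by
  simp [qBinom, qFact, qInt_one]

theorem qInt_two_ne : qInt vv 2 ≠ 0 := by
  intro h
  rw [qInt_two] at h
  have := evOne_add vv_mem (inv_mem_of_evOne (f := vv) (by simp))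
  rw [h, evOne_inv vv_mem (by simp)] at this
  norm_num at this

theorem qBinom_two_zero : qBinom vv 2 0 = 1 := by
  simp [qBinom, qFact, Finset.prod_range_succ, qInt_one, qInt_two_ne]
theorem qBinom_two_one : qBinom vv 2 1 = vv + vv⁻¹ := by
  simp [qBinom, qFact, Finset.prod_range_succ, qInt_one, qInt_two]
theorem qBinom_two_two : qBinom vv 2 2 = 1 := by
  simp [qBinom, qFact, Finset.prod_range_succ, qInt_one, qInt_two_ne]

theorem vpow_dD (n i : ℕ) : vpow (dD n i) = vv := by simp [dD, vpow]

theorem aD_cases (n i j : ℕ) (h : i ≠ j) : aD n i j = -1 ∨ aD n i j = 0 := by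
  simp only [aD, if_neg h]; split_ifs <;> simp

theorem aD_symm (n i j : ℕ) : aD n i j = aD n j i := by
  simp only [aD]; split_ifs <;> first | rfl | omega

theorem serreElt_one (n : ℕ) (i j : Fin n) (r : Fin 1 → ℤ) (t : ℤ) :
    serreElt n (dD n) i j 1 r t =
      fg n j t * fg n i (r 0) - fg n i (r 0) * fg n j t := by
  simp [serreElt, vpow_dD, Finset.sum_range_succ, qBinom_one_zero, qBinom_one_one]
  abel

theorem serreElt_two (n : ℕ) (i j : Fin n) (r : Fin 2 → ℤ) (t : ℤ) :
    serreElt n (dD n) i j 2 r t =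
      fg n i (r 0) * fg n i (r 1) * fg n j t -
        (vv + vv⁻¹) • (fg n i (r 0) * fg n j t * fg n i (r 1)) +
        fg n j t * fg n i (r 0) * fg n i (r 1) +
      (fg n i (r 1) * fg n i (r 0) * fg n j t -
        (vv + vv⁻¹) • (fg n i (r 1) * fg n j t * fg n i (r 0)) +
        fg n j t * fg n i (r 1) * fg n i (r 0)) := by
  have huniv : (Finset.univ : Finset (Equiv.Perm (Fin 2))) = {1, Equiv.swap 0 1} := by decide
  rw [serreElt, huniv, Finset.sum_insert (by decide), Finset.sum_singleton]
  simp only [vpow_dD, Finset.sum_range_succ, Finset.sum_range_zero, qBinom_two_zero,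
    qBinom_two_one, qBinom_two_two, List.ofFn_succ, List.ofFn_zero]
  simp [mul_assoc]
  simp only [add_smul, neg_smul, sub_eq_add_neg, neg_add]
  abel

namespace PointData
variable {n : ℕ} (D : PointData n)

/-- the lift of the operators to the free algebra. -/
def repFree : FA n →ₐ[KK] Module.End KK (Finset D.X →₀ KK) :=
  FreeAlgebra.lift KK fun p => D.op (p.1.1 + 1) p.2

theorem repFree_fg (i : Fin n) (r : ℤ) : D.repFree (fg n i r) = D.op (i.1 + 1) r := by
  simp [repFree, fg]

theorem repFree_serre (i j : Fin n) (hij : i ≠ j) (m : ℕ)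
    (hm : m = (1 - aD n (i.1 + 1) (j.1 + 1)).toNat) (r : Fin m → ℤ) (t : ℤ) :
    D.repFree (serreElt n (dD n) i j m r t) = 0 := by
  rcases aD_cases n (i.1 + 1) (j.1 + 1) (by simpa using fun h => hij (Fin.ext h)) with h | h
  · obtain rfl : m = 2 := by rw [hm, h]; rfl
    rw [serreElt_two]
    simp only [map_add, map_sub, map_smul, map_mul, repFree_fg]
    exact D.op_serre _ _ h _ _ _
  · obtain rfl : m = 1 := by rw [hm, h]; rfl
    rw [serreElt_one]
    simp only [map_sub, map_mul, repFree_fg]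
    rw [D.op_comm _ _ h, sub_self]

/-- the representation of `U_v^>(Lo_{2n})` attached to the point data. -/
def rep : UD n →ₐ[KK] Module.End KK (Finset D.X →₀ KK) :=
  RingQuot.liftAlgHom KK ⟨D.repFree, by
    intro x y h
    induction h with
    | loop i j r s =>
      simp only [map_sub, map_smul, map_mul, repFree_fg, dD, Nat.cast_one, one_mul]
      exact D.op_loop _ _ _ _
    | serre i j hij r t => rw [D.repFree_serre i j hij _ rfl, map_zero]⟩

theorem rep_genD (c : ℕ) (r : ℤ) (hc : 1 ≤ c ∧ c ≤ n) : D.rep (genD n c r) = D.op c r := by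
  rw [genD, g1, dif_pos hc, ug, rep, RingQuot.liftAlgHom_mkAlgHom_apply, repFree_fg]
  congr 1
  exact Nat.sub_add_cancel hc.1

end PointData

/-! ### Combinatorics of the standard Lyndon words -/

/-- the pairs `(i, t)` encoding positive roots. -/
def ValidRoot (n i t : ℕ) : Prop :=
  1 ≤ i ∧ i ≤ n ∧ (n - 1 ≤ i → t = 0) ∧ (t = 0 ∨ t + 2 * i + 1 ≤ 2 * n)

/-- letter number `k` of the word of the root `(i, t)`. -/
def ltr (n i t k : ℕ) : ℕ :=
  if i + t < n ∨ i = n then i + k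
  else if k < n - 1 - i then i + k
  else if k = n - 1 - i then n else 2 * n - 1 - i - k

/-- length of the word of the root `(i, t)`. -/
def len (n i t : ℕ) : ℕ := if i + t < n ∨ i = n then t + 1 else t

/-- depth of the letter number `k` of a word starting with `i`. -/
def dpt (n i k : ℕ) : ℕ := if k + i ≤ n - 1 then k else k - 1

set_option linter.unusedSectionVars false
set_option linter.unusedVariables false

section
variable {n i t : ℕ} (hn : 4 ≤ n) (hv : ValidRoot n i t)
include hn hv

theorem ltr_bounds {k : ℕ} (hk : k < len n i t) : 1 ≤ ltr n i t k ∧ ltr n i t k ≤ n := by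
  unfold ValidRoot at hv
  unfold len at hk
  unfold ltr
  split_ifs at * <;> omega

theorem ltr_zero : ltr n i t 0 = i := by
  unfold ValidRoot at hv
  unfold ltr
  split_ifs at * <;> omega

theorem ltr_gt {k : ℕ} (hk : k < len n i t) (h0 : k ≠ 0) : i < ltr n i t k := by
  unfold ValidRoot at hv
  unfold len at hk
  unfold ltr
  split_ifs at * <;> omega

theorem len_pos : 0 < len n i t := by
  unfold ValidRoot at hv
  unfold len
  split_ifs at * <;> omega

theorem dpt_zero_iff {k : ℕ} (hk : k < len n i t) : dpt n i k = 0 ↔ k = 0 := by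
  unfold ValidRoot at hv
  unfold len at hk
  unfold dpt
  split_ifs at * <;> omega

theorem aD_adjacent {p q : ℕ} (hp : p < len n i t) (hq : q < len n i t)
    (h : dpt n i q = dpt n i p + 1) : aD n (ltr n i t p) (ltr n i t q) = -1 := by
  unfold ValidRoot at hv
  unfold len at hp hq
  unfold dpt at h
  unfold ltr aD
  split_ifs at * <;> first | rfl | omega

theorem exists_depth_between {p q : ℕ} (hp : p < len n i t) (hq : q < len n i t)
    (h : dpt n i p + 1 < dpt n i q) :
    ∃ r < len n i t, dpt n i p < dpt n i r ∧ dpt n i r < dpt n i q := by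
  unfold ValidRoot at hv
  refine ⟨if p + i = n - 1 then p + 2 else p + 1, ?_⟩
  unfold len at *
  unfold dpt at *
  split_ifs at * <;> omega

theorem exists_two_between {p q : ℕ} (hp : p < len n i t) (hq : q < len n i t)
    (h : dpt n i p < dpt n i q) (hc : ltr n i t p = ltr n i t q) :
    ∃ r < len n i t, ∃ s < len n i t, r ≠ s ∧ dpt n i p < dpt n i r ∧ dpt n i r < dpt n i q ∧
      dpt n i p < dpt n i s ∧ dpt n i s < dpt n i q := by
  unfold ValidRoot at hv
  refine ⟨n - 1 - i, ?_, n - i, ?_, ?_⟩ <;>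
  unfold len at * <;>
  unfold dpt at * <;>
  unfold ltr at hc <;>
  split_ifs at * <;> omega

theorem aD_same_depth {p q : ℕ} (hp : p < len n i t) (hq : q < len n i t) (hpq : p ≠ q)
    (h : dpt n i p = dpt n i q) : aD n (ltr n i t p) (ltr n i t q) = 0 := by
  unfold ValidRoot at hv
  unfold len at hp hq
  unfold dpt at h
  unfold ltr aD
  split_ifs at * <;> first | rfl | omega

theorem root_eq_of_agree {t' : ℕ} (hv' : ValidRoot n i t') (ht : t ≤ t')
    (hl : len n i t' ≤ len n i t)
    (h : ∀ k < len n i t', ltr n i t k = ltr n i t' k) : t = t' := by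
  unfold ValidRoot at hv hv'
  by_contra hne
  have h1 := h (n - 1 - i)
  unfold len at *
  unfold ltr at h1
  split_ifs at * <;> omega

end

section
variable {n : ℕ}

theorem validRoot (β : PosRootD n) : ValidRoot n (riD β) (rtD β) := by
  obtain ⟨h1, h2, h3⟩ := β.2
  refine ⟨h1, Nat.lt_succ_iff.1 (ofLex β.1).1.2, h2, h3⟩

theorem length_wordD (hn : 4 ≤ n) (β : PosRootD n) :
    (wordD β).length = len n (riD β) (rtD β) := by
  have hv := validRoot β
  unfold ValidRoot at hv
  unfold wordD len
  dsimp only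
  split_ifs <;> simp <;> omega

theorem getElem_wordD (hn : 4 ≤ n) (β : PosRootD n) (k : ℕ) (hk : k < (wordD β).length) :
    (wordD β)[k] = ltr n (riD β) (rtD β) k := by
  have hv := validRoot β
  have hk' := hk
  rw [length_wordD hn] at hk'
  unfold ValidRoot at hv
  unfold len at hk'
  generalize hi : riD β = i at *
  generalize ht : rtD β = t at *
  unfold ltr
  by_cases c1 : i + t < n ∨ i = n
  · have : wordD β = List.range' i (t + 1) := by simp only [wordD, hi, ht, if_pos c1]
    simp only [this, List.getElem_range', if_pos c1]
    omega
  rw [if_neg c1] at hk' ⊢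
  by_cases c2 : i + t = n
  · have : wordD β = List.range' i (n - 1 - i) ++ [n] := by
      simp only [wordD, hi, ht, if_neg c1, if_pos c2]
    simp only [this, List.getElem_append, List.length_range', List.getElem_range',
      List.getElem_singleton]
    split_ifs <;> omega
  by_cases c3 : i + t = n + 1
  · have : wordD β = List.range' i (n - 1 - i) ++ [n, n - 1] := by
      simp only [wordD, hi, ht, if_neg c1, if_neg c2, if_pos c3]
    simp only [this, List.getElem_append, List.length_range', List.getElem_range']
    by_cases c4 : k < n - 1 - i
    · simp [c4]
    by_cases c5 : k = n - 1 - i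
    · simp [c5]
    · obtain rfl : k = n - 1 - i + 1 := by omega
      simp
      omega
  · have : wordD β = List.range' i (n - 1 - i) ++ [n] ++
        (List.range' (2 * n - i - t) (n - (2 * n - i - t))).reverse := by
      simp only [wordD, hi, ht, if_neg c1, if_neg c2, if_neg c3]
    simp only [this, List.getElem_append, List.length_range', List.getElem_range',
      List.getElem_singleton, List.length_append, List.length_singleton, List.getElem_reverse]
    split_ifs <;> omega

theorem wordD_eq (hn : 4 ≤ n) (β : PosRootD n) :
    wordD β = (List.range (len n (riD β) (rtD β))).map (ltr n (riD β) (rtD β)) := by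
  apply List.ext_getElem
  · simp [length_wordD hn]
  · intro k h1 h2
    rw [getElem_wordD hn β k h1]
    simp

theorem root_le_iff {β γ : PosRootD n} :
    β ≤ γ ↔ riD β < riD γ ∨ riD β = riD γ ∧ rtD β ≤ rtD γ := by
  rw [← Subtype.coe_le_coe, Prod.Lex.le_iff]
  simp only [riD, rtD, Fin.ext_iff]
  rfl

theorem root_ext {β γ : PosRootD n} (h1 : riD β = riD γ) (h2 : rtD β = rtD γ) : β = γ := by
  apply le_antisymm <;> rw [root_le_iff] <;> omega

end

/-! ### The point data of a list of roots -/

section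
variable {n : ℕ} (hn : 4 ≤ n) {N : ℕ} (β : Fin N → PosRootD n) (w : Fin N → ℚ)

/-- points of the clusters attached to a family of positive roots. -/
abbrev Pt : Type := Σ a : Fin N, Fin (len n (riD (β a)) (rtD (β a)))

namespace Pt
variable {β}
/-- colour of a point. -/
def col (p : Pt β) : ℕ := ltr n (riD (β p.1)) (rtD (β p.1)) p.2
/-- depth of a point in its cluster. -/
def dep (p : Pt β) : ℕ := dpt n (riD (β p.1)) p.2
/-- spectral parameter of a point. -/
def x (p : Pt β) : KK := vpow (-(p.dep : ℤ)) * RatFunc.C (w p.1)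
open Classical in
/-- structure constant of a pair of points. -/
def θ (p q : Pt β) : KK :=
  if p.1 = q.1 then (if p.dep < q.dep then 0 else 1)
  else if aD n p.col q.col = 0 then 1
  else (vpow (aD n p.col q.col) * x w p - x w q) / (x w p - x w q)

theorem x_mem (p : Pt β) : x w p ∈ locOne := mul_mem (vpow_mem _) (C_mem_locOne _)

theorem evOne_x (p : Pt β) : evOne (x w p) = w p.1 := by
  rw [x, evOne_mul (vpow_mem _) (C_mem_locOne _), evOne_vpow, evOne_C, one_mul]

theorem evOne_x_sub (p q : Pt β) : evOne (x w p - x w q) = w p.1 - w q.1 := by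
  rw [evOne_sub (x_mem w p) (x_mem w q), evOne_x, evOne_x]

variable {w} (hw : Function.Injective w)
include hw

theorem x_sub_ne {p q : Pt β} (h : p.1 ≠ q.1) : x w p - x w q ≠ 0 := by
  intro h0
  have := evOne_x_sub w p q
  rw [h0, evOne_zero] at this
  exact h (hw (sub_eq_zero.1 this.symm))

theorem θ_regular {p q : Pt β} (h : p.1 ≠ q.1) : θ w p q ∈ locOne ∧ evOne (θ w p q) = 1 := by
  rw [θ, if_neg h]
  split_ifs with h0
  · exact ⟨one_mem _, evOne_one⟩
  have h1 : evOne (x w p - x w q) ≠ 0 := by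
    rw [evOne_x_sub]; exact sub_ne_zero.2 fun e => h (hw e)
  have h2 := sub_mem (x_mem w p) (x_mem w q)
  have h3 := mul_mem (vpow_mem (aD n p.col q.col)) (x_mem w p)
  have h4 := sub_mem h3 (x_mem w q)
  rw [div_eq_mul_inv]
  refine ⟨mul_mem h4 (inv_mem_of_evOne h1), ?_⟩
  rw [evOne_mul h4 (inv_mem_of_evOne h1), evOne_inv h2 h1, evOne_sub h3 (x_mem w q),
    evOne_mul (vpow_mem _) (x_mem w p), evOne_vpow, one_mul, ← evOne_sub (x_mem w p) (x_mem w q)]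
  exact mul_inv_cancel₀ h1

end Pt

include hn in
theorem Pt.same_cluster {p q : Pt β} (hpq : p ≠ q) (h1 : p.1 = q.1)
    (hb1 : ∀ r : Pt β, ¬ ((p.1 = r.1 ∧ p.dep < r.dep) ∧ (r.1 = q.1 ∧ r.dep < q.dep)))
    (hb2 : ∀ r : Pt β, ¬ ((q.1 = r.1 ∧ q.dep < r.dep) ∧ (r.1 = p.1 ∧ r.dep < p.dep))) :
    (p.dep = q.dep ∧ aD n p.col q.col = 0) ∨
    (q.dep = p.dep + 1 ∧ aD n p.col q.col = -1) ∨
    (p.dep = q.dep + 1 ∧ aD n p.col q.col = -1) := by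
  obtain ⟨a, k, hk⟩ := p
  obtain ⟨b, l, hl⟩ := q
  obtain rfl : a = b := h1
  have hv := validRoot (β a)
  have hkl : k ≠ l := by rintro rfl; exact hpq rfl
  simp only [Pt.dep, Pt.col] at *
  rcases lt_trichotomy (dpt n (riD (β a)) k) (dpt n (riD (β a)) l) with h | h | h
  · right; left
    have : dpt n (riD (β a)) l = dpt n (riD (β a)) k + 1 := by
      by_contra hne
      obtain ⟨r, hr, h2, h3⟩ := exists_depth_between hn hv hk hl (by omega)
      exact hb1 ⟨a, r, hr⟩ ⟨⟨rfl, h2⟩, rfl, h3⟩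
    exact ⟨this, aD_adjacent hn hv hk hl this⟩
  · exact Or.inl ⟨h, aD_same_depth hn hv hk hl hkl h⟩
  · right; right
    have : dpt n (riD (β a)) k = dpt n (riD (β a)) l + 1 := by
      by_contra hne
      obtain ⟨r, hr, h2, h3⟩ := exists_depth_between hn hv hl hk (by omega)
      exact hb2 ⟨a, r, hr⟩ ⟨⟨rfl, h2⟩, rfl, h3⟩
    exact ⟨this, by rw [aD_symm]; exact aD_adjacent hn hv hl hk this⟩

variable {w}

/-- the point data of a family of positive roots with generic base points. -/
def rootData (hw : Function.Injective w) (hw0 : ∀ a, w a ≠ 0) : PointData n where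
  X := Pt β
  col := Pt.col
  x := Pt.x w
  lt p q := p.1 = q.1 ∧ p.dep < q.dep
  θ := Pt.θ w
  lt_irrefl p h := lt_irrefl _ h.2
  x_ne p := mul_ne_zero (vpow_ne_zero _) (by
    rw [ne_eq, map_eq_zero]; exact hw0 _)
  θ_zero p q h := by rw [Pt.θ, if_pos h.1, if_pos h.2]
  pair p q hpq hb1 hb2 := by
    by_cases h : p.1 = q.1
    · rcases Pt.same_cluster hn β hpq h hb1 hb2 with ⟨hd, ha⟩ | ⟨hd, ha⟩ | ⟨hd, ha⟩
      · have hx : Pt.x w p = Pt.x w q := by rw [Pt.x, Pt.x, hd, h]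
        rw [ha, hx]
        simp [Pt.θ, h, hd, vpow]
      · have hx : Pt.x w p = vpow 1 * Pt.x w q := by
          rw [Pt.x, Pt.x, hd, h, ← mul_assoc, ← vpow_add]; congr 2; push_cast; ring
        have h1 : vpow (-1) * vpow 1 = 1 := by rw [← vpow_add]; simp [vpow]
        rw [ha, hx, ← mul_assoc, h1]
        simp [Pt.θ, h, hd]
      · have hx : Pt.x w p = vpow (-1) * Pt.x w q := by
          rw [Pt.x, Pt.x, hd, h, ← mul_assoc, ← vpow_add]; congr 2; push_cast; ring
        rw [ha, hx]
        simp [Pt.θ, h, hd]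
    · have h' : ¬ q.1 = p.1 := fun e => h e.symm
      have hx := Pt.x_sub_ne hw h
      have hx' := Pt.x_sub_ne hw h'
      rw [Pt.θ, Pt.θ, if_neg h, if_neg h', aD_symm n q.col p.col]
      split_ifs with h0
      · simp [h0, vpow]
      · field_simp
        ring
  pair_zero p q hpq hb1 hb2 ha := by
    by_cases h : p.1 = q.1
    · rcases Pt.same_cluster hn β hpq h hb1 hb2 with ⟨hd, _⟩ | ⟨_, ha'⟩ | ⟨_, ha'⟩
      · simp [Pt.θ, h, hd]
      · omega
      · omega
    · have h' : ¬ q.1 = p.1 := fun e => h e.symm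
      rw [Pt.θ, Pt.θ, if_neg h, if_neg h', aD_symm n q.col p.col, if_pos ha, if_pos ha]
  same_col p q hpq hc := by
    by_cases h : p.1 = q.1
    · obtain ⟨a, k, hk⟩ := p
      obtain ⟨b, l, hl⟩ := q
      obtain rfl : a = b := h
      have hv := validRoot (β a)
      have hkl : k ≠ l := by rintro rfl; exact hpq rfl
      simp only [Pt.dep, Pt.col] at *
      rcases lt_trichotomy (dpt n (riD (β a)) k) (dpt n (riD (β a)) l) with h | h | h
      · left
        obtain ⟨r, hr, s, hs, hrs, h1, h2, h3, h4⟩ := exists_two_between hn hv hk hl h hc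
        exact ⟨⟨a, r, hr⟩, ⟨a, s, hs⟩, by simpa using hrs, ⟨rfl, h1⟩, ⟨rfl, h2⟩, ⟨rfl, h3⟩,
          ⟨rfl, h4⟩⟩
      · exfalso
        have := aD_same_depth hn hv hk hl hkl h
        rw [hc] at this
        simp [aD] at this
      · right; left
        obtain ⟨r, hr, s, hs, hrs, h1, h2, h3, h4⟩ := exists_two_between hn hv hl hk h hc.symm
        exact ⟨⟨a, r, hr⟩, ⟨a, s, hs⟩, by simpa using hrs, ⟨rfl, h1⟩, ⟨rfl, h2⟩, ⟨rfl, h3⟩,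
          ⟨rfl, h4⟩⟩
    · refine Or.inr (Or.inr ⟨fun e => h e.1, fun e => h e.1.symm, fun r hr => ?_⟩)
      rcases hr with ⟨h1 | h1, h2 | h2⟩
      · exact h (h1.1.trans h2.1.symm)
      · exact h (h1.1.trans h2.1)
      · exact h (h1.1.symm.trans h2.1.symm)
      · exact h (h1.1.symm.trans h2.1)

end

section
variable {B : Type} [Ring B] [Module KK B]

/-- iterated `q`-brackets with the data given by functions. -/
def chainF (g : ℕ → ℤ → B) (c : ℕ → ℕ) (s : ℕ → ℤ) (l : ℕ → KK) : ℕ → B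
  | 0 => g (c 0) (s 0)
  | k + 1 => chainF g c s l k * g (c (k + 1)) (s (k + 1)) -
      l k • (g (c (k + 1)) (s (k + 1)) * chainF g c s l k)

theorem chainE_eq_chainF (g : ℕ → ℤ → B) (c : ℕ → ℕ) (m : ℕ) (ss : List ℤ) (ls : List KK)
    (h1 : ss.length = m + 1) (h2 : ls.length = m) :
    chainE g ((List.range (m + 1)).map c) ss ls =
      chainF g c (fun k => ss.getD k 0) (fun k => ls.getD k 1) m := by
  obtain ⟨s, ss', rfl⟩ : ∃ s ss', ss = s :: ss' := by
    cases ss with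
    | nil => simp at h1
    | cons s ss' => exact ⟨s, ss', rfl⟩
  rw [List.range_succ_eq_map, List.map_cons, List.map_map, chainE]
  have h1' : ss'.length = m := by simpa using h1
  have hz : (((List.range m).map (c ∘ Nat.succ)).zip ss').zip ls =
      (List.range m).map fun k => ((c (k + 1), ss'.getD k 0), ls.getD k 1) := by
    apply List.ext_getElem
    · simp [h1', h2]
    · intro k hk1 hk2
      have hk : k < m := by simpa using hk2
      simp [h1', h2, hk]
  rw [hz, List.foldl_map]
  clear hz h1 h1' h2
  induction m with
  | zero => simp [chainF]
  | succ m ih =>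
    rw [List.range_succ, List.foldl_append, ih]
    simp [chainF]

end

theorem IsRVD.exists_chainF {n : ℕ} (hn : 4 ≤ n) {γ : PosRootD n} {s : ℤ} {E : UD n}
    (h : IsRVD γ s E) :
    ∃ (ss : ℕ → ℤ) (l : ℕ → KK), (∀ k, IsVpow (l k)) ∧
      ∑ k ∈ Finset.range (len n (riD γ) (rtD γ)), ss k = s ∧
      E = chainF (genD n) (ltr n (riD γ) (rtD γ)) ss l (len n (riD γ) (rtD γ) - 1) := by
  obtain ⟨ss, ls, h1, h2, h3, h4, rfl⟩ := h
  have hp := len_pos hn (validRoot γ)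
  rw [length_wordD hn] at h1 h2
  refine ⟨fun k => ss.getD k 0, fun k => ls.getD k 1, fun k => ?_, ?_, ?_⟩
  · show IsVpow (ls.getD k 1)
    by_cases hk : k < ls.length
    · rw [List.getD_eq_getElem _ _ hk]; exact h4 _ (List.getElem_mem hk)
    · rw [List.getD_eq_default _ _ (by omega)]; exact ⟨0, by simp [vpow]⟩
  · rw [← h1, ← h3]
    rw [Finset.sum_range, ← List.sum_ofFn]
    congr 1
    apply List.ext_getElem <;> simp
  · rw [wordD_eq hn]
    have := chainE_eq_chainF (genD n) (ltr n (riD γ) (rtD γ)) (len n (riD γ) (rtD γ) - 1) ss ls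
      (by omega) (by omega)
    rwa [Nat.sub_add_cancel hp] at this

theorem isRVD_chainF {n : ℕ} (hn : 4 ≤ n) (γ : PosRootD n) (ss : ℕ → ℤ) :
    IsRVD γ (∑ k ∈ Finset.range (len n (riD γ) (rtD γ)), ss k)
      (chainF (genD n) (ltr n (riD γ) (rtD γ)) ss (fun _ => 1) (len n (riD γ) (rtD γ) - 1)) := by
  have hp := len_pos hn (validRoot γ)
  obtain ⟨m, hm⟩ : ∃ m, len n (riD γ) (rtD γ) = m + 1 := ⟨_, (Nat.sub_add_cancel hp).symm⟩
  have e := chainE_eq_chainF (genD n) (ltr n (riD γ) (rtD γ)) m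
    ((List.range (m + 1)).map ss) (List.replicate m 1) (by simp) (by simp)
  refine ⟨(List.range (m + 1)).map ss, List.replicate m 1, ?_, ?_, ?_, ?_, ?_⟩
  · simp [length_wordD hn, hm]
  · simp [length_wordD hn, hm]
  · rw [hm]; rfl
  · intro l hl
    rw [List.eq_of_mem_replicate hl]
    exact ⟨0, by simp [vpow]⟩
  · rw [wordD_eq hn, hm, e, Nat.add_sub_cancel]
    have key : ∀ k ≤ m, chainF (genD n) (ltr n (riD γ) (rtD γ)) ss (fun _ => 1) k =
        chainF (genD n) (ltr n (riD γ) (rtD γ)) (fun k => ((List.range (m + 1)).map ss).getD k 0)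
          (fun k => (List.replicate m (1 : KK)).getD k 1) k := by
      intro k hk
      have hs : ∀ j ≤ m, ((List.range (m + 1)).map ss).getD j 0 = ss j := fun j hj => by
        rw [List.getD_eq_getElem _ _ (by simpa using Nat.lt_succ_of_le hj)]
        simp
      induction k with
      | zero => simp only [chainF]; rw [hs 0 hk]
      | succ k ih =>
        have hl : (List.replicate m (1 : KK)).getD k 1 = 1 := by
          rw [List.getD_eq_getElem _ _ (by simpa using hk)]; simp
        simp only [chainF]
        rw [ih (by omega), hs _ hk, hl]
    exact key m le_rfl

theorem dpt_mono {n i k l : ℕ} (h : k ≤ l) : dpt n i k ≤ dpt n i l := by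
  unfold dpt; split_ifs <;> omega

theorem dpt_eq {n i k l : ℕ} (hi : i ≤ n) (h : k < l) (hd : dpt n i k = dpt n i l)
    (hin : i = n → l = 0) : l = k + 1 ∧ k = n - 1 - i := by
  unfold dpt at hd; split_ifs at hd <;> omega

section
variable {n : ℕ} (hn : 4 ≤ n) {N : ℕ} (β : Fin N → PosRootD n) {w : Fin N → ℚ}

/-- union of full clusters. -/
def full (A : Finset (Fin N)) : Finset (Pt β) := Finset.univ.filter fun p => p.1 ∈ A

/-- union of full clusters and of an initial part of a further cluster. -/
def seg (A : Finset (Fin N)) (b : Fin N) (k : ℕ) : Finset (Pt β) :=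
  Finset.univ.filter fun p => p.1 ∈ A ∨ (p.1 = b ∧ p.2.1 < k)

variable {β}

theorem mem_full {A : Finset (Fin N)} {p : Pt β} : p ∈ full β A ↔ p.1 ∈ A := by simp [full]

theorem mem_seg {A : Finset (Fin N)} {b : Fin N} {k : ℕ} {p : Pt β} :
    p ∈ seg β A b k ↔ p.1 ∈ A ∨ (p.1 = b ∧ p.2.1 < k) := by simp [seg]

theorem insert_seg {A : Finset (Fin N)} {b : Fin N} {k : ℕ}
    (hk : k < len n (riD (β b)) (rtD (β b))) :
    insert (⟨b, k, hk⟩ : Pt β) (seg β A b k) = seg β A b (k + 1) := by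
  ext ⟨a, l, hl⟩
  simp only [Finset.mem_insert, mem_seg, Sigma.mk.injEq]
  constructor
  · rintro (⟨rfl, h⟩ | h | ⟨rfl, h⟩)
    · have : l = k := by simpa using h
      exact Or.inr ⟨rfl, by omega⟩
    · exact Or.inl h
    · exact Or.inr ⟨rfl, by omega⟩
  · rintro (h | ⟨rfl, h⟩)
    · exact Or.inr (Or.inl h)
    · rcases Nat.lt_succ_iff_lt_or_eq.1 h with h | rfl
      · exact Or.inr (Or.inr ⟨rfl, h⟩)
      · exact Or.inl ⟨rfl, HEq.rfl⟩

theorem seg_zero (A : Finset (Fin N)) (b : Fin N) : seg β A b 0 = full β A := by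
  ext p; simp [mem_seg, mem_full]

theorem seg_len (A : Finset (Fin N)) (b : Fin N) :
    seg β A b (len n (riD (β b)) (rtD (β b))) = full β (insert b A) := by
  ext ⟨a, l, hl⟩
  simp only [mem_seg, mem_full, Finset.mem_insert]
  constructor
  · rintro (h | ⟨h, -⟩) <;> simp [h]
  · rintro (rfl | h)
    · exact Or.inr ⟨rfl, hl⟩
    · exact Or.inl h

/-- order ideals of points. -/
def IsIdl (S : Finset (Pt β)) : Prop := ∀ q ∈ S, ∀ p : Pt β, p.1 = q.1 ∧ p.dep < q.dep → p ∈ S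

/-- total structure constant. -/
def totW (w : Fin N → ℚ) (S : Finset (Pt β)) (p : Pt β) : KK := ∏ q ∈ S, Pt.θ w p q

include hn in
theorem dep_pos_iff (p : Pt β) : p.dep = 0 ↔ p.2.1 = 0 :=
  dpt_zero_iff hn (validRoot _) p.2.2

include hn in
theorem zero_of_isIdl {A : Finset (Fin N)} {p : Pt β} {S : Finset (Pt β)}
    (hS : ∀ q ∈ S, q.1 = p.1 → q.1 ∈ A) (hp : p.1 ∉ A)
    (hI : IsIdl (insert p S)) : p.2.1 = 0 := by
  by_contra h0
  have hp0 := len_pos hn (validRoot (β p.1))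
  have := hI p (Finset.mem_insert_self _ _) ⟨p.1, 0, hp0⟩ ⟨rfl, by
    have h1 : ¬ p.dep = 0 := fun e => h0 ((dep_pos_iff hn p).1 e)
    have h2 : Pt.dep (⟨p.1, 0, hp0⟩ : Pt β) = 0 := (dep_pos_iff hn _).2 rfl
    omega⟩
  rcases Finset.mem_insert.1 this with h | h
  · apply h0; rw [← h]
  · exact hp (hS ⟨p.1, ⟨0, hp0⟩⟩ h rfl)

include hn in
theorem of_isIdl_seg {A : Finset (Fin N)} {b : Fin N} (hb : b ∉ A) {k : ℕ} {p : Pt β}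
    (hp : p ∉ seg β A b k) (hI : IsIdl (insert p (seg β A b k))) :
    (p.1 ∉ A ∧ p.2.1 = 0) ∨ (p.1 = b ∧ (p.2.1 = k ∨
      (p.2.1 = k + 1 ∧ k = n - 1 - riD (β b)))) := by
  have hpA : p.1 ∉ A := fun h => hp (mem_seg.2 (Or.inl h))
  by_cases hpb : p.1 = b
  · right
    refine ⟨hpb, ?_⟩
    obtain ⟨a, l, hl⟩ := p
    obtain rfl : a = b := hpb
    have hkl : ¬ l < k := fun h => hp (mem_seg.2 (Or.inr ⟨rfl, h⟩))
    rcases (not_lt.1 hkl).eq_or_lt with h | h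
    · exact Or.inl h.symm
    right
    have hk : k < len n (riD (β a)) (rtD (β a)) := by omega
    have hd : dpt n (riD (β a)) k = dpt n (riD (β a)) l := by
      refine (dpt_mono h.le).antisymm (not_lt.1 fun hlt => ?_)
      have := hI ⟨a, l, hl⟩ (Finset.mem_insert_self _ _) ⟨a, k, hk⟩ ⟨rfl, hlt⟩
      rcases Finset.mem_insert.1 this with e | e
      · have : k = l := by simpa using e
        omega
      · rcases mem_seg.1 e with e | e
        · exact hpA e
        · exact absurd e.2 (lt_irrefl _)
    have hv := validRoot (β a)
    refine dpt_eq hv.2.1 h hd fun e => ?_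
    have := hv.2.2.1 (by omega)
    rw [this] at hl
    unfold len at hl
    split_ifs at hl <;> omega
  · left
    refine ⟨hpA, zero_of_isIdl hn (S := seg β A b k) ?_ hpA hI⟩
    intro q hq hqp
    rcases mem_seg.1 hq with h | h
    · exact h
    · exact absurd (hqp.symm.trans h.1) hpb

theorem isIdl_seg (A : Finset (Fin N)) (b : Fin N) (k : ℕ) : IsIdl (seg β A b k) := by
  intro q hq p ⟨h1, h2⟩
  rcases mem_seg.1 hq with h | h
  · exact mem_seg.2 (Or.inl (h1 ▸ h))
  · refine mem_seg.2 (Or.inr ⟨h1.trans h.1, lt_of_not_ge fun hk => ?_⟩)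
    have : p.2.1 ≥ q.2.1 := by omega
    obtain ⟨a, l, hl⟩ := p
    obtain ⟨a', l', hl'⟩ := q
    obtain rfl : a = a' := h1
    exact absurd (dpt_mono (n := n) (i := riD (β a)) this) (not_le.2 h2)

theorem totW_seg {A : Finset (Fin N)} {b : Fin N} (hb : b ∉ A) {k : ℕ}
    (hk : k < len n (riD (β b)) (rtD (β b))) :
    totW w (seg β A b k) ⟨b, k, hk⟩ = totW w (full β A) ⟨b, k, hk⟩ := by
  symm
  apply Finset.prod_subset
  · intro p hp
    exact mem_seg.2 (Or.inl (mem_full.1 hp))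
  · rintro ⟨a, l, hl⟩ hp hp'
    rw [mem_seg, mem_full] at *
    obtain ⟨rfl, h⟩ := hp.resolve_left hp'
    rw [Pt.θ, if_pos rfl, if_neg]
    exact not_lt.2 (dpt_mono (le_of_lt h))

variable (β) (hw : Function.Injective w) (hw0 : ∀ a, w a ≠ 0)

/-- the operators on the span of sets of points. -/
def rop (c : ℕ) (r : ℤ) : Module.End KK (Finset (Pt β) →₀ KK) := (rootData hn β hw hw0).op c r

/-- the representation on the span of sets of points. -/
def rrep : UD n →ₐ[KK] Module.End KK (Finset (Pt β) →₀ KK) := (rootData hn β hw hw0).rep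

theorem rrep_gen (c : ℕ) (r : ℤ) (hc : 1 ≤ c ∧ c ≤ n) :
    rrep hn β hw hw0 (genD n c r) = rop hn β hw hw0 c r :=
  (rootData hn β hw hw0).rep_genD c r hc

open Classical in
theorem rop_single (c : ℕ) (r : ℤ) (S : Finset (Pt β)) :
    rop hn β hw hw0 c r (Finsupp.single S 1) = ∑ p : Pt β,
      (if p.col = c ∧ p ∉ S ∧ IsIdl (insert p S) then Pt.x w p ^ r * totW w S p else 0) •
        Finsupp.single (insert p S) (1 : KK) :=
  (rootData hn β hw hw0).op_single c r S

theorem rop_full_zero (c : ℕ) (r : ℤ) (A : Finset (Fin N)) (h : ∀ b ∉ A, riD (β b) ≠ c) :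
    rop hn β hw hw0 c r (Finsupp.single (full β A) 1) = 0 := by
  rw [rop_single]
  refine Finset.sum_eq_zero fun p _ => ?_
  rw [if_neg, zero_smul]
  rintro ⟨h1, h2, h3⟩
  have hp : p.1 ∉ A := fun h => h2 (mem_full.2 h)
  have h0 := zero_of_isIdl hn (S := full β A) (fun q hq _ => mem_full.1 hq) hp h3
  apply h p.1 hp
  rw [← h1, Pt.col, h0, ltr_zero hn (validRoot _)]

/-- weight of a partially filled cluster. -/
def wt (w : Fin N → ℚ) (s : ℕ → ℤ) (A : Finset (Fin N)) (b : Fin N) (k : ℕ) : KK :=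
  ∏ l : Fin (len n (riD (β b)) (rtD (β b))),
    if l.1 < k then Pt.x w (⟨b, l⟩ : Pt β) ^ s l * totW w (full β A) ⟨b, l⟩ else 1

theorem wt_zero (s : ℕ → ℤ) (A : Finset (Fin N)) (b : Fin N) : wt β w s A b 0 = 1 := by
  simp [wt]

theorem wt_succ (s : ℕ → ℤ) (A : Finset (Fin N)) (b : Fin N) {k : ℕ}
    (hk : k < len n (riD (β b)) (rtD (β b))) :
    wt β w s A b (k + 1) = wt β w s A b k *
      (Pt.x w (⟨b, k, hk⟩ : Pt β) ^ s k * totW w (full β A) ⟨b, k, hk⟩) := by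
  rw [wt, wt, ← Finset.mul_prod_erase Finset.univ _ (Finset.mem_univ ⟨k, hk⟩),
    ← Finset.mul_prod_erase Finset.univ (fun l : Fin _ => if l.1 < k then _ else 1)
      (Finset.mem_univ ⟨k, hk⟩)]
  rw [if_pos (Nat.lt_succ_self k), if_neg (lt_irrefl k), one_mul, mul_comm]
  congr 1
  refine Finset.prod_congr rfl fun l hl => ?_
  have hl' : l.1 ≠ k := fun e => (Finset.mem_erase.1 hl).1 (Fin.ext e)
  have : l.1 < k + 1 ↔ l.1 < k := by omega
  simp only [this]

theorem rop_seg {c : ℕ} {r : ℤ} {A : Finset (Fin N)} {b : Fin N} (hb : b ∉ A) {k : ℕ}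
    (hc : ∀ a ∉ A, riD (β a) < c)
    (hs : k = n - 1 - riD (β b) → k + 1 < len n (riD (β b)) (rtD (β b)) → c ≠ n - 1) :
    rop hn β hw hw0 c r (Finsupp.single (seg β A b k) 1) =
      if hk : k < len n (riD (β b)) (rtD (β b)) then
        (if ltr n (riD (β b)) (rtD (β b)) k = c then
          (Pt.x w (⟨b, k, hk⟩ : Pt β) ^ r * totW w (full β A) ⟨b, k, hk⟩) •
            Finsupp.single (seg β A b (k + 1)) (1 : KK) else 0) else 0 := by
  classical
  rw [rop_single]
  have key : ∀ p : Pt β, (p.col = c ∧ p ∉ seg β A b k ∧ IsIdl (insert p (seg β A b k))) →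
      p.1 = b ∧ p.2.1 = k := by
    rintro p ⟨h1, h2, h3⟩
    rcases of_isIdl_seg hn hb h2 h3 with ⟨hA, h0⟩ | ⟨h4, h5 | ⟨h5, h6⟩⟩
    · exfalso
      have := hc p.1 hA
      rw [← h1, Pt.col, h0, ltr_zero hn (validRoot _)] at this
      exact lt_irrefl _ this
    · exact ⟨h4, h5⟩
    · exfalso
      obtain ⟨a, l, hl⟩ := p
      obtain rfl : a = b := h4
      obtain rfl : l = k + 1 := h5
      refine hs h6 hl ?_
      rw [← h1]
      have hv := validRoot (β a)
      have hl' := hl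
      simp only [Pt.col]
      unfold ValidRoot at hv
      unfold len at hl'
      unfold ltr
      split_ifs at * <;> omega
  by_cases hk : k < len n (riD (β b)) (rtD (β b))
  · rw [dif_pos hk, Finset.sum_eq_single (⟨b, k, hk⟩ : Pt β)]
    · have h1 : (⟨b, k, hk⟩ : Pt β) ∉ seg β A b k := by simp [mem_seg, hb]
      have h2 : IsIdl (insert (⟨b, k, hk⟩ : Pt β) (seg β A b k)) := by
        rw [insert_seg]; exact isIdl_seg _ _ _
      by_cases hcol : ltr n (riD (β b)) (rtD (β b)) k = c
      · rw [if_pos ⟨hcol, h1, h2⟩, if_pos hcol, totW_seg hb hk, insert_seg hk]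
      · rw [if_neg fun h => hcol h.1, if_neg hcol, zero_smul]
    · rintro ⟨a, l, hl⟩ _ hne
      rw [if_neg, zero_smul]
      intro h
      obtain ⟨h1, h2⟩ := key _ h
      obtain rfl : a = b := h1
      obtain rfl : l = k := h2
      exact hne rfl
    · simp
  · rw [dif_neg hk]
    refine Finset.sum_eq_zero fun p _ => ?_
    rw [if_neg, zero_smul]
    intro h
    obtain ⟨a, l, hl⟩ := p
    obtain ⟨h1, h2⟩ := key _ h
    obtain rfl : a = b := h1
    obtain rfl : l = k := h2
    exact hk hl

end

theorem ltr_ne_of_long {n i t t' k : ℕ} (hn : 4 ≤ n) (hv : ValidRoot n i t)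
    (ht : t' ≤ t) (h1 : k = n - 1 - i)
    (h2 : k + 1 < len n i t') : ltr n i t k ≠ n - 1 := by
  unfold ValidRoot at *
  unfold len at *
  unfold ltr
  split_ifs at * <;> omega

theorem zpow_sum_range {F : Type} [Field F] {x : F} (hx : x ≠ 0) (s : ℕ → ℤ) (m : ℕ) :
    x ^ (∑ k ∈ Finset.range m, s k) = ∏ k ∈ Finset.range m, x ^ s k := by
  induction m with
  | zero => simp
  | succ m ih => rw [Finset.sum_range_succ, Finset.prod_range_succ, zpow_add₀ hx, ih]

section
variable {n : ℕ} (hn : 4 ≤ n) {N : ℕ} (β : Fin N → PosRootD n) {w : Fin N → ℚ}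
  (hw : Function.Injective w) (hw0 : ∀ a, w a ≠ 0)

theorem rop_full (c : ℕ) (r : ℤ) (A : Finset (Fin N)) :
    rop hn β hw hw0 c r (Finsupp.single (full β A) 1) =
      ∑ b : Fin N, (if b ∉ A ∧ riD (β b) = c then
        Pt.x w (⟨b, 0, len_pos hn (validRoot (β b))⟩ : Pt β) ^ r *
          totW w (full β A) ⟨b, 0, len_pos hn (validRoot (β b))⟩ else 0) •
        Finsupp.single (seg β A b 1) (1 : KK) := by
  classical
  rw [rop_single]
  symm
  apply Finset.sum_of_injOn
    (fun b => (⟨b, 0, len_pos hn (validRoot (β b))⟩ : Pt β))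
  · intro a _ b _ h
    exact congrArg Sigma.fst h
  · intro _ _; simp
  · rintro p _ hp
    rw [if_neg, zero_smul]
    rintro ⟨-, h2, h3⟩
    have hpA : p.1 ∉ A := fun h => h2 (mem_full.2 h)
    have h0 := zero_of_isIdl hn (S := full β A) (fun q hq _ => mem_full.1 hq) hpA h3
    apply hp
    refine ⟨p.1, by simp, ?_⟩
    obtain ⟨a, l, hl⟩ := p
    obtain rfl : l = 0 := h0
    rfl
  · intro b _
    have h1 : insert (⟨b, 0, len_pos hn (validRoot (β b))⟩ : Pt β) (full β A) = seg β A b 1 := by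
      rw [← seg_zero A b, insert_seg]
    rw [h1]
    congr 1
    have hcol : Pt.col (⟨b, 0, len_pos hn (validRoot (β b))⟩ : Pt β) = riD (β b) :=
      ltr_zero hn (validRoot _)
    have hI : IsIdl (seg β A b 1) := isIdl_seg _ _ _
    rw [hcol]
    simp only [hI, mem_full, and_true]
    simp only [and_comm]

/-- the first `k` letters of the cluster `b` are those of `γ`. -/
def Agr (γ : PosRootD n) (b : Fin N) (k : ℕ) : Prop :=
  k ≤ len n (riD (β b)) (rtD (β b)) ∧
    ∀ j < k, ltr n (riD (β b)) (rtD (β b)) j = ltr n (riD γ) (rtD γ) j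

open Classical in
theorem rrep_chainF {γ : PosRootD n} (A : Finset (Fin N)) (hA : ∀ b ∉ A, β b ≤ γ)
    (s : ℕ → ℤ) (l : ℕ → KK) (k : ℕ) (hk : k < len n (riD γ) (rtD γ)) :
    rrep hn β hw hw0 (chainF (genD n) (ltr n (riD γ) (rtD γ)) s l k)
      (Finsupp.single (full β A) 1) =
      ∑ b : Fin N, (if b ∉ A ∧ Agr β γ b (k + 1) then
        (∏ j ∈ Finset.range k, (-l j)) * wt β w s A b (k + 1) else 0) •
          Finsupp.single (seg β A b (k + 1)) (1 : KK) := by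
  have hγ := validRoot γ
  induction k with
  | zero =>
    rw [chainF, rrep_gen _ _ _ _ _ _ (ltr_bounds hn hγ hk), rop_full]
    refine Finset.sum_congr rfl fun b _ => ?_
    congr 1
    have hp := len_pos hn (validRoot (β b))
    have : Agr β γ b (0 + 1) ↔ riD (β b) = ltr n (riD γ) (rtD γ) 0 := by
      rw [← ltr_zero hn (validRoot (β b))]
      constructor
      · intro h; exact h.2 0 (by omega)
      · intro h
        refine ⟨by omega, fun j hj => ?_⟩
        obtain rfl : j = 0 := by omega
        exact h
    rw [this, wt_succ β s A b hp, wt_zero]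
    simp
  | succ k ih =>
    have ih := ih (by omega)
    have hb := ltr_bounds hn hγ hk
    have hgt := ltr_gt hn hγ hk (by omega)
    have hri : ∀ a ∉ A, riD (β a) < ltr n (riD γ) (rtD γ) (k + 1) := by
      intro a ha
      have := root_le_iff.1 (hA a ha)
      omega
    rw [chainF, map_sub, map_smul, map_mul, map_mul, LinearMap.sub_apply, LinearMap.smul_apply,
      Module.End.mul_apply, Module.End.mul_apply, ih, rrep_gen _ _ _ _ _ _ hb,
      rop_full_zero _ _ _ _ _ _ _ (fun b hb => (hri b hb).ne), map_zero, zero_sub, map_sum,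
      Finset.smul_sum, ← Finset.sum_neg_distrib]
    refine Finset.sum_congr rfl fun b _ => ?_
    rw [map_smul]
    by_cases hbA : b ∈ A
    · simp [hbA]
    by_cases hag : Agr β γ b (k + 1)
    swap
    · have : ¬ Agr β γ b (k + 1 + 1) := fun h =>
        hag ⟨by have := h.1; omega, fun j hj => h.2 j (by omega)⟩
      simp [hag, this]
    rw [if_pos ⟨hbA, hag⟩, rop_seg hn β hw hw0 hbA hri]
    · by_cases hl : k + 1 < len n (riD (β b)) (rtD (β b))
      · rw [dif_pos hl]
        by_cases hc : ltr n (riD (β b)) (rtD (β b)) (k + 1) = ltr n (riD γ) (rtD γ) (k + 1)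
        · have hag' : Agr β γ b (k + 1 + 1) := by
            refine ⟨hl, fun j hj => ?_⟩
            rcases Nat.lt_succ_iff_lt_or_eq.1 hj with h | rfl
            · exact hag.2 j h
            · exact hc
          rw [if_pos hc, if_pos ⟨hbA, hag'⟩, wt_succ β s A b hl, Finset.prod_range_succ,
            smul_smul, smul_smul, ← neg_smul]
          congr 1
          ring
        · have hag' : ¬ Agr β γ b (k + 1 + 1) := fun h => hc (h.2 _ (by omega))
          rw [if_neg hc, if_neg fun h => hag' h.2]
          simp
      · have hag' : ¬ Agr β γ b (k + 1 + 1) := fun h => hl (by have := h.1; omega)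
        rw [dif_neg hl, if_neg fun h => hag' h.2]
        simp
    · intro h1 h2 h3
      have h0 := hag.2 0 (by omega)
      have hvb := validRoot (β b)
      rw [ltr_zero hn hvb, ltr_zero hn hγ] at h0
      have hle := root_le_iff.1 (hA b hbA)
      rw [h0] at h1 h2 hvb
      exact ltr_ne_of_long hn hγ (by omega) h1 h2 h3

/-- the product of all structure constants obtained when adding the cluster `b`. -/
def Thet (w : Fin N → ℚ) (A : Finset (Fin N)) (b : Fin N) : KK :=
  ∏ l : Fin (len n (riD (β b)) (rtD (β b))), totW w (full β A) ⟨b, l⟩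

include hw in
theorem Thet_regular {A : Finset (Fin N)} {b : Fin N} (hb : b ∉ A) :
    Thet β w A b ∈ locOne ∧ evOne (Thet β w A b) = 1 := by
  have key : ∀ {ι : Type} (s : Finset ι) (f : ι → KK), (∀ i ∈ s, f i ∈ locOne ∧ evOne (f i) = 1) →
      (∏ i ∈ s, f i) ∈ locOne ∧ evOne (∏ i ∈ s, f i) = 1 := by
    intro ι s f
    classical
    induction s using Finset.induction_on with
    | empty => intro _; exact ⟨one_mem _, evOne_one⟩
    | insert i s hi ih =>
      intro h
      have h1 := h i (Finset.mem_insert_self _ _)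
      have h2 := ih fun j hj => h j (Finset.mem_insert_of_mem hj)
      rw [Finset.prod_insert hi]
      exact ⟨mul_mem h1.1 h2.1, by rw [evOne_mul h1.1 h2.1, h1.2, h2.2, one_mul]⟩
  refine key _ _ fun l _ => key _ _ fun q hq => Pt.θ_regular hw ?_
  rintro rfl
  exact hb (mem_full.1 hq)

end

open Classical in
theorem IsRVD.rrep_apply {n : ℕ} (hn : 4 ≤ n) {γ : PosRootD n} {s : ℤ} {E : UD n}
    (h : IsRVD γ s E) : ∃ κ : KK, κ ≠ 0 ∧ ∀ {N : ℕ} (β : Fin N → PosRootD n) (w : Fin N → ℚ)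
      (hw : Function.Injective w) (hw0 : ∀ a, w a ≠ 0) (A : Finset (Fin N)),
      (∀ b ∉ A, β b ≤ γ) →
      rrep hn β hw hw0 E (Finsupp.single (full β A) 1) =
        κ • ∑ b : Fin N, (if b ∉ A ∧ β b = γ then RatFunc.C (w b) ^ s * Thet β w A b else 0) •
          Finsupp.single (full β (insert b A)) (1 : KK) := by
  obtain ⟨ss, l, hl, rfl, rfl⟩ := h.exists_chainF hn
  have hγ := validRoot γ
  have hp := len_pos hn hγ
  refine ⟨(∏ j ∈ Finset.range (len n (riD γ) (rtD γ) - 1), (-l j)) *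
    ∏ k ∈ Finset.range (len n (riD γ) (rtD γ)), vpow (-(dpt n (riD γ) k : ℤ)) ^ ss k, ?_, ?_⟩
  · refine mul_ne_zero (Finset.prod_ne_zero_iff.2 fun j _ => neg_ne_zero.2 ?_)
      (Finset.prod_ne_zero_iff.2 fun j _ => zpow_ne_zero _ (vpow_ne_zero _))
    obtain ⟨m, hm⟩ := hl j
    rw [hm]; exact vpow_ne_zero _
  intro N β w hw hw0 A hA
  rw [rrep_chainF hn β hw hw0 A hA ss l _ (by omega), Nat.sub_add_cancel hp, Finset.smul_sum]
  refine Finset.sum_congr rfl fun b _ => ?_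
  by_cases hbA : b ∈ A
  · simp [hbA]
  by_cases hb : β b = γ
  · have hag : Agr β γ b (len n (riD γ) (rtD γ)) := by
      rw [Agr, hb]; exact ⟨le_rfl, fun _ _ => rfl⟩
    rw [if_pos ⟨hbA, hag⟩, if_pos ⟨hbA, hb⟩, smul_smul, ← seg_len, hb, mul_assoc]
    congr 2
    subst hb
    have hC : RatFunc.C (w b) ≠ (0 : KK) := by
      simpa using hw0 b
    rw [wt, Thet, zpow_sum_range hC, Finset.prod_range (n := len n _ _),
      Finset.prod_range (n := len n _ _), ← mul_assoc, ← Finset.prod_mul_distrib,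
      ← Finset.prod_mul_distrib]
    refine Finset.prod_congr rfl fun k _ => ?_
    rw [if_pos k.2, Pt.x, mul_zpow]
    rfl
  · have hag : ¬ Agr β γ b (len n (riD γ) (rtD γ)) := by
      intro h
      apply hb
      have h0 := h.2 0 hp
      rw [ltr_zero hn (validRoot _), ltr_zero hn hγ] at h0
      refine root_ext h0 ?_
      have hle := root_le_iff.1 (hA b hbA)
      obtain ⟨h1, h2⟩ := h
      have hv := validRoot (β b)
      rw [h0] at h1 h2 hv
      exact root_eq_of_agree hn hv hγ (by omega) h1 h2
    rw [if_neg fun h => hag h.2, if_neg fun h => hb h.2]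
    simp

set_option linter.unusedSectionVars false

section
variable {α τ R : Type} [DecidableEq α] [CommSemiring R] {N : ℕ}

/-- values of `f` outside of `A`. -/
def mc (f : Fin N → α) (A : Finset (Fin N)) : Multiset α := (Finset.univ \ A).val.map f

theorem mc_insert (f : Fin N → α) {A : Finset (Fin N)} {b : Fin N} (hb : b ∉ A) :
    mc f A = f b ::ₘ mc f (insert b A) := by
  have h1 : Finset.univ \ A = insert b (Finset.univ \ insert b A) := by
    ext c
    simp only [Finset.mem_sdiff, Finset.mem_univ, true_and, Finset.mem_insert, not_or]
    by_cases hc : c = b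
    · simp [hc, hb]
    · simp [hc]
  rw [mc, h1, Finset.insert_val_of_notMem (by simp), Multiset.map_cons]
  rfl

theorem mem_mc {f : Fin N → α} {A : Finset (Fin N)} {a : α} :
    a ∈ mc f A ↔ ∃ b, b ∉ A ∧ f b = a := by
  rw [mc, Multiset.mem_map]
  simp only [Finset.mem_val, Finset.mem_sdiff, Finset.mem_univ, true_and]

theorem mc_eq_zero {f : Fin N → α} {A : Finset (Fin N)} : mc f A = 0 ↔ A = Finset.univ := by
  rw [mc, Multiset.map_eq_zero, Finset.val_eq_zero, Finset.sdiff_eq_empty_iff_subset,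
    Finset.univ_subset_iff]

/-- sum over all ways to match a list with labels, one after the other. -/
def pathSum (β : Fin N → α) (f : Fin N → τ → Finset (Fin N) → R) :
    List (α × τ) → Finset (Fin N) → R
  | [], A => if A = Finset.univ then 1 else 0
  | p :: l, A => ∑ b : Fin N,
      if b ∉ A ∧ β b = p.1 then f b p.2 A * pathSum β f l (insert b A) else 0

theorem pathSum_eq_zero (β : Fin N → α) (f : Fin N → τ → Finset (Fin N) → R)
    (l : List (α × τ)) (A : Finset (Fin N)) (h : ((l.map Prod.fst : List α) : Multiset α) ≠ mc β A) :
    pathSum β f l A = 0 := by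
  induction l generalizing A with
  | nil =>
    rw [pathSum, if_neg]
    rintro rfl
    exact h (mc_eq_zero.2 rfl).symm
  | cons p l ih =>
    rw [pathSum]
    refine Finset.sum_eq_zero fun b _ => ?_
    split_ifs with hb
    · rw [ih, mul_zero]
      intro e
      apply h
      rw [mc_insert β hb.1, hb.2, ← e]
      rfl
    · rfl

/-- generating polynomial of the matchings. -/
abbrev pathPoly (β : Fin N → α) : List (α × ℕ) → Finset (Fin N) → MvPolynomial (Fin N) ℚ :=
  pathSum β fun b s _ => MvPolynomial.monomial (Finsupp.single b s) 1

open MvPolynomial in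
theorem coeff_pathPoly (β : Fin N → α) (l : List (α × ℕ)) (A : Finset (Fin N)) (e : Fin N →₀ ℕ)
    (h : coeff e (pathPoly β l A) ≠ 0) :
    (∀ b ∈ A, e b = 0) ∧ mc (fun b => (β b, e b)) A = l := by
  classical
  induction l generalizing A e with
  | nil =>
    rw [pathPoly, pathSum] at h
    split_ifs at h with hA
    · rw [← C_1, coeff_C] at h
      split_ifs at h with he
      · subst he; exact ⟨fun _ _ => rfl, mc_eq_zero.2 hA⟩
      · exact absurd rfl h
    · simp at h
  | cons p l ih =>
    rw [pathPoly, pathSum, coeff_sum] at h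
    obtain ⟨b, -, hb⟩ := Finset.exists_ne_zero_of_sum_ne_zero h
    split_ifs at hb with hbA
    · rw [coeff_monomial_mul'] at hb
      split_ifs at hb with hle
      · rw [one_mul] at hb
        obtain ⟨h1, h2⟩ := ih _ _ hb
        have hle' : p.2 ≤ e b := by simpa using hle b
        have e1 : ∀ c, c ≠ b → (e - Finsupp.single b p.2) c = e c := fun c hc => by
          simp [Finsupp.single_eq_of_ne hc]
        have e2 : e b = p.2 := by
          have := h1 b (Finset.mem_insert_self _ _)
          rw [Finsupp.tsub_apply, Finsupp.single_eq_same] at this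
          omega
        refine ⟨fun c hc => ?_, ?_⟩
        · have hcb : c ≠ b := fun h => hbA.1 (h ▸ hc)
          rw [← e1 c hcb]
          exact h1 c (Finset.mem_insert_of_mem hc)
        · rw [mc_insert _ hbA.1, e2, hbA.2, ← Multiset.cons_coe, ← h2]
          congr 1
          refine Multiset.map_congr rfl fun c hc => ?_
          rw [e1]
          rintro rfl
          rw [Finset.mem_val, Finset.mem_sdiff] at hc
          exact hc.2 (Finset.mem_insert_self _ _)
      · exact absurd rfl hb
    · simp at hb

open MvPolynomial in
theorem pathPoly_ne_zero (β : Fin N → α) (l : List (α × ℕ)) (A : Finset (Fin N))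
    (h : ((l.map Prod.fst : List α) : Multiset α) = mc β A) : pathPoly β l A ≠ 0 := by
  suffices 0 < eval (fun _ => (1 : ℚ)) (pathPoly β l A) by
    intro h0; simp [h0] at this
  have h1 : ∀ e : Fin N →₀ ℕ, eval (fun _ => (1 : ℚ)) (monomial e 1) = 1 := fun e => by
    simp [eval_monomial, Finsupp.prod]
  have hnn : ∀ (l : List (α × ℕ)) (A : Finset (Fin N)),
      0 ≤ eval (fun _ => (1 : ℚ)) (pathPoly β l A) := by
    intro l
    induction l with
    | nil => intro A; rw [pathPoly, pathSum]; split_ifs <;> simp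
    | cons p l ih =>
      intro A
      rw [pathPoly, pathSum, map_sum]
      refine Finset.sum_nonneg fun b _ => ?_
      split_ifs
      · rw [map_mul, h1, one_mul]; exact ih _
      · simp
  induction l generalizing A with
  | nil =>
    have : A = Finset.univ := mc_eq_zero.1 h.symm
    rw [pathPoly, pathSum, if_pos this]; simp
  | cons p l ih =>
    rw [pathPoly, pathSum, map_sum]
    have hp : p.1 ∈ mc β A := by rw [← h]; simp
    obtain ⟨b, hbA, hb⟩ := mem_mc.1 hp
    refine Finset.sum_pos' (fun c _ => ?_) ⟨b, Finset.mem_univ _, ?_⟩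
    · split_ifs
      · rw [map_mul, h1, one_mul]; exact hnn _ _
      · simp
    · rw [if_pos ⟨hbA, hb⟩]
      have := ih (insert b A) (by
        rw [mc_insert β hbA, hb, List.map_cons, ← Multiset.cons_coe] at h
        exact (Multiset.cons_inj_right _).1 h)
      rw [map_mul, h1, one_mul]; exact this

open MvPolynomial in
theorem eval_pathPoly (β : Fin N → α) (w : Fin N → ℚ) (hw0 : ∀ b, w b ≠ 0) (M : ℤ)
    (l : List (α × ℤ)) (hM : ∀ p ∈ l, 0 ≤ p.2 + M) (A : Finset (Fin N)) :
    eval w (pathPoly β (l.map fun p => (p.1, (p.2 + M).toNat)) A) =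
      (∏ b ∈ Finset.univ \ A, w b ^ M) * pathSum β (fun b s _ => w b ^ s) l A := by
  classical
  induction l generalizing A with
  | nil =>
    rw [List.map_nil, pathPoly, pathSum, pathSum]
    split_ifs with h
    · subst h; simp
    · simp
  | cons p l ih =>
    rw [List.map_cons, pathPoly, pathSum, pathSum, map_sum, Finset.mul_sum]
    refine Finset.sum_congr rfl fun b _ => ?_
    split_ifs with hb
    · have hMp : ((p.2 + M).toNat : ℤ) = p.2 + M :=
        Int.toNat_of_nonneg (hM p List.mem_cons_self)
      have h1 : Finset.univ \ A = insert b (Finset.univ \ insert b A) := by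
        ext c
        simp only [Finset.mem_sdiff, Finset.mem_univ, true_and, Finset.mem_insert, not_or]
        by_cases hc : c = b
        · simp [hc, hb]
        · simp [hc]
      rw [map_mul, ih (fun q hq => hM q (List.mem_cons_of_mem _ hq)), h1,
        Finset.prod_insert (by simp), eval_monomial, one_mul, Finsupp.prod_single_index (by simp)]
      have : w b ^ (p.2 + M).toNat = w b ^ p.2 * w b ^ M := by
        rw [← zpow_add₀ (hw0 b), ← zpow_natCast, hMp]
      rw [this]; ring
    · simp

open MvPolynomial in
theorem eq_zero_of_eval_injective (P : MvPolynomial (Fin N) ℚ)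
    (h : ∀ w : Fin N → ℚ, Function.Injective w → (∀ b, w b ≠ 0) → eval w P = 0) : P = 0 := by
  classical
  have hV : (∏ p ∈ (Finset.univ : Finset (Fin N × Fin N)).filter fun p => p.1 ≠ p.2,
      (X p.1 - X p.2 : MvPolynomial (Fin N) ℚ)) * ∏ b : Fin N, X b ≠ 0 := by
    refine mul_ne_zero (Finset.prod_ne_zero_iff.2 fun p hp => ?_)
      (Finset.prod_ne_zero_iff.2 fun b _ => X_ne_zero _)
    rw [sub_ne_zero]
    exact fun e => (Finset.mem_filter.1 hp).2 (X_injective e)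
  refine (mul_eq_zero.1 (?_ : P * _ = 0)).resolve_right hV
  apply MvPolynomial.funext
  intro w
  rw [map_mul, map_zero, map_mul, map_prod, map_prod]
  simp only [map_sub, eval_X]
  by_cases hw : Function.Injective w
  · by_cases hw0 : ∀ b, w b ≠ 0
    · rw [h w hw hw0, zero_mul]
    · push Not at hw0
      obtain ⟨b, hb⟩ := hw0
      rw [Finset.prod_eq_zero (Finset.mem_univ b) hb]; ring
  · simp only [Function.Injective] at hw
    push Not at hw
    obtain ⟨a, b, hab, hne⟩ := hw
    rw [Finset.prod_eq_zero (i := (a, b)) (by simp [hne]) (by simp [hab])]; ring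

theorem pathSum_indep (β : Fin N → α) (F : Finset (List (α × ℤ)))
    (hF : ∀ l ∈ F, ((l.map Prod.fst : List α) : Multiset α) = mc β ∅)
    (hinj : ∀ l ∈ F, ∀ l' ∈ F, (l : Multiset (α × ℤ)) = l' → l = l') (c : List (α × ℤ) → ℚ)
    (h : ∀ w : Fin N → ℚ, Function.Injective w → (∀ b, w b ≠ 0) →
      ∑ l ∈ F, c l * pathSum β (fun b s _ => w b ^ s) l ∅ = 0) : ∀ l ∈ F, c l = 0 := by
  classical
  obtain ⟨M, hM⟩ : ∃ M : ℤ, ∀ l ∈ F, ∀ p ∈ l, 0 ≤ p.2 + M := by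
    have : ∀ G : Finset (α × ℤ), ∃ M : ℤ, ∀ p ∈ G, 0 ≤ p.2 + M := by
      intro G
      refine ⟨∑ p ∈ G, |p.2|, fun p hp => ?_⟩
      have := Finset.single_le_sum (f := fun p : α × ℤ => |p.2|) (fun q _ => abs_nonneg q.2) hp
      have := neg_abs_le p.2
      linarith
    obtain ⟨M, hM⟩ := this (F.biUnion fun l => l.toFinset)
    exact ⟨M, fun l hl p hp => hM p (Finset.mem_biUnion.2 ⟨l, hl, List.mem_toFinset.2 hp⟩)⟩
  set sh : α × ℤ → α × ℕ := fun p => (p.1, (p.2 + M).toNat) with hsh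
  have hP : ∑ l ∈ F, MvPolynomial.C (c l) * pathPoly β (l.map sh) ∅ = 0 := by
    apply eq_zero_of_eval_injective
    intro w hw hw0
    have := h w hw hw0
    rw [map_sum]
    rw [← mul_zero (∏ b ∈ Finset.univ \ ∅, w b ^ M), ← this, Finset.mul_sum]
    refine Finset.sum_congr rfl fun l hl => ?_
    rw [map_mul, eval_pathPoly β w hw0 M l (hM l hl), MvPolynomial.eval_C]
    ring
  intro l hl
  have hne : pathPoly β (l.map sh) ∅ ≠ 0 := by
    apply pathPoly_ne_zero
    rw [List.map_map]
    exact hF l hl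
  obtain ⟨e, he⟩ := MvPolynomial.ne_zero_iff.1 hne
  have h1 := congrArg (MvPolynomial.coeff e) hP
  rw [MvPolynomial.coeff_sum, MvPolynomial.coeff_zero, Finset.sum_eq_single l,
    MvPolynomial.coeff_C_mul] at h1
  · exact (mul_eq_zero.1 h1).resolve_right he
  · intro l' hl' hne'
    rw [MvPolynomial.coeff_C_mul]
    by_contra h0
    have he' := right_ne_zero_of_mul h0
    have e1 := (coeff_pathPoly β _ _ e he).2
    have e2 := (coeff_pathPoly β _ _ e he').2
    apply hne'
    apply hinj _ hl' _ hl
    have e3 : ((l'.map sh : List (α × ℕ)) : Multiset (α × ℕ)) = (l.map sh : List (α × ℕ)) :=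
      e2.symm.trans e1
    have back : ∀ l ∈ F, (l : Multiset (α × ℤ)) =
        ((l.map sh : List (α × ℕ)) : Multiset (α × ℕ)).map fun p => (p.1, (p.2 : ℤ) - M) := by
      intro l hl
      rw [Multiset.map_coe, List.map_map]
      conv_lhs => rw [← List.map_id l]
      congr 1
      refine List.map_congr_left fun p hp => ?_
      have := hM l hl p hp
      simp only [hsh, Function.comp, id, Int.toNat_of_nonneg this]
      ext <;> simp
    rw [back _ hl', back _ hl, e3]
  · exact fun h => absurd hl h

end

/-- ordered product of `E` along a list, the first member of the list being the last factor. -/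
def mon {B ι : Type} [Ring B] (E : ι → B) (l : List ι) : B := (l.reverse.map E).prod

theorem mon_cons {B ι : Type} [Ring B] (E : ι → B) (p : ι) (l : List ι) :
    mon E (p :: l) = mon E l * E p := by
  simp [mon]

/-- the multiset `M` of roots is dominated by a list. -/
def Dom {α : Type} [LinearOrder α] : Multiset α → List α → Prop
  | M, [] => M = 0
  | M, γ :: l => (∀ x ∈ M, x ≤ γ) ∧ (γ ∈ M → Dom (M.erase γ) l)

theorem dom_of_le {α : Type} [LinearOrder α] (d l : List α) (hd : d.Pairwise (· ≥ ·)) (h : d ≤ l) :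
    Dom (d : Multiset α) l := by
  induction l generalizing d with
  | nil =>
    cases d with
    | nil => rfl
    | cons a d => exact absurd h (by simp)
  | cons γ l ih =>
    cases d with
    | nil => exact ⟨by simp, by simp⟩
    | cons a d =>
      rw [List.pairwise_cons] at hd
      have h' : a < γ ∨ a = γ ∧ d ≤ l := by
        rcases h.lt_or_eq with h | h
        · rcases List.cons_lt_cons_iff.1 h with h | h
          · exact Or.inl h
          · exact Or.inr ⟨h.1, h.2.le⟩
        · rw [List.cons.injEq] at h
          exact Or.inr ⟨h.1, h.2.le⟩
      clear h
      rcases h' with h | ⟨rfl, h⟩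
      · have hx : ∀ x ∈ ((a :: d : List α) : Multiset α), x < γ := by
          intro x hx
          rcases List.mem_cons.1 (Multiset.mem_coe.1 hx) with rfl | hx
          · exact h
          · exact (hd.1 x hx).trans_lt h
        exact ⟨fun x h => (hx x h).le, fun h => absurd (hx _ h) (lt_irrefl _)⟩
      · refine ⟨fun x hx => ?_, fun _ => ?_⟩
        · rcases List.mem_cons.1 (Multiset.mem_coe.1 hx) with rfl | hx
          · exact le_rfl
          · exact hd.1 x hx
        · rw [← Multiset.cons_coe, Multiset.erase_cons_head]
          exact ih d hd.2 h

section
variable {n : ℕ} (hn : 4 ≤ n)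

section
variable {N : ℕ} (β : Fin N → PosRootD n) {w : Fin N → ℚ}
  (hw : Function.Injective w) (hw0 : ∀ a, w a ≠ 0)

/-- matrix coefficient from the empty to the full set of points. -/
def phi : UD n →ₗ[KK] KK where
  toFun x := (rrep hn β hw hw0 x (Finsupp.single (full β ∅) 1)) (full β Finset.univ)
  map_add' x y := by rw [map_add]; rfl
  map_smul' c x := by rw [map_smul]; rfl

/-- the matrix coefficient of a product of root vectors, up to a constant. -/
def Psi (w : Fin N → ℚ) : List (PosRootD n × ℤ) → Finset (Fin N) → KK :=
  pathSum β fun b s A => RatFunc.C (w b) ^ s * Thet β w A b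

include hw in
theorem Psi_regular (l : List (PosRootD n × ℤ)) (A : Finset (Fin N)) :
    Psi β w l A ∈ locOne ∧
      evOne (Psi β w l A) = pathSum β (fun b s _ => w b ^ s) l A := by
  induction l generalizing A with
  | nil =>
    rw [Psi, pathSum, pathSum]
    split_ifs
    · exact ⟨one_mem _, evOne_one⟩
    · exact ⟨zero_mem _, evOne_zero⟩
  | cons p l ih =>
    rw [Psi, pathSum, pathSum]
    have key : ∀ b : Fin N, (if b ∉ A ∧ β b = p.1 then
        RatFunc.C (w b) ^ p.2 * Thet β w A b * Psi β w l (insert b A) else 0) ∈ locOne ∧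
        evOne (if b ∉ A ∧ β b = p.1 then
          RatFunc.C (w b) ^ p.2 * Thet β w A b * Psi β w l (insert b A) else 0) =
        if b ∉ A ∧ β b = p.1 then
          w b ^ p.2 * pathSum β (fun b s _ => w b ^ s) l (insert b A) else 0 := by
      intro b
      split_ifs with hb
      · obtain ⟨h1, h2⟩ := ih (insert b A)
        obtain ⟨h3, h4⟩ := Thet_regular β hw hb.1
        have h5 : (RatFunc.C (w b) : KK) ^ p.2 = RatFunc.C (w b ^ p.2) := (map_zpow₀ _ _ _).symm
        have h6 := C_mem_locOne (w b ^ p.2)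
        rw [h5]
        exact ⟨mul_mem (mul_mem h6 h3) h1, by
          rw [evOne_mul (mul_mem h6 h3) h1, evOne_mul h6 h3, h4, h2, evOne_C, mul_one]⟩
      · exact ⟨zero_mem _, evOne_zero⟩
    have sumkey : ∀ (s : Finset (Fin N)) (f : Fin N → KK) (g : Fin N → ℚ),
        (∀ b, f b ∈ locOne ∧ evOne (f b) = g b) →
        (∑ b ∈ s, f b) ∈ locOne ∧ evOne (∑ b ∈ s, f b) = ∑ b ∈ s, g b := by
      intro s f g h
      induction s using Finset.induction_on with
      | empty => exact ⟨zero_mem _, evOne_zero⟩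
      | insert i s hi ih =>
        rw [Finset.sum_insert hi, Finset.sum_insert hi]
        exact ⟨add_mem (h i).1 ih.1, by rw [evOne_add (h i).1 ih.1, (h i).2, ih.2]⟩
    exact sumkey _ _ _ key

theorem rrep_mon {E : PosRootD n × ℤ → UD n} {κ : PosRootD n × ℤ → KK}
    (hκ : ∀ p (A : Finset (Fin N)), (∀ b ∉ A, β b ≤ p.1) →
      rrep hn β hw hw0 (E p) (Finsupp.single (full β A) 1) =
        κ p • ∑ b : Fin N, (if b ∉ A ∧ β b = p.1 then
          RatFunc.C (w b) ^ p.2 * Thet β w A b else 0) •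
          Finsupp.single (full β (insert b A)) (1 : KK))
    (l : List (PosRootD n × ℤ)) (A : Finset (Fin N)) (h : Dom (mc β A) (l.map Prod.fst)) :
    rrep hn β hw hw0 (mon E l) (Finsupp.single (full β A) 1) (full β Finset.univ) =
      (l.map κ).prod * Psi β w l A := by
  induction l generalizing A with
  | nil =>
    have hA : A = Finset.univ := mc_eq_zero.1 h
    subst hA
    rw [Psi, pathSum, if_pos rfl]
    simp [mon]
  | cons p l ih =>
    have hd : (∀ x ∈ mc β A, x ≤ p.1) ∧ (p.1 ∈ mc β A → Dom ((mc β A).erase p.1) (l.map Prod.fst)) :=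
      h
    rw [mon_cons, map_mul, Module.End.mul_apply,
      hκ p A fun b hb => hd.1 _ (mem_mc.2 ⟨b, hb, rfl⟩), map_smul, map_sum,
      List.map_cons, List.prod_cons, Psi, pathSum, Finsupp.smul_apply, smul_eq_mul,
      Finsupp.finsetSum_apply, mul_assoc]
    congr 1
    rw [Finset.mul_sum]
    refine Finset.sum_congr rfl fun b _ => ?_
    rw [map_smul, Finsupp.smul_apply, smul_eq_mul]
    split_ifs with hb
    · rw [ih]
      · rw [Psi]; ring
      · have hm : p.1 ∈ mc β A := mem_mc.2 ⟨b, hb⟩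
        have := hd.2 hm
        rwa [mc_insert β hb.1, hb.2, Multiset.erase_cons_head] at this
    · simp

end

/-- the types of a list of labelled roots. -/
abbrev typ (l : List (PosRootD n × ℤ)) : List (PosRootD n) := l.map Prod.fst

theorem mc_get (d : List (PosRootD n)) : mc d.get ∅ = d := by
  rw [mc, Finset.sdiff_empty, ← List.ofFn_get d, Multiset.coe_eq_coe.2 (List.Perm.refl _)]
  simp [Finset.univ, Fintype.elems, List.ofFn_eq_map]

theorem exists_kappa {E : PosRootD n × ℤ → UD n} (hE : ∀ p, IsRVD p.1 p.2 (E p)) :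
    ∃ κ : List (PosRootD n × ℤ) → KK, (∀ l, κ l ≠ 0) ∧ ∀ (d : List (PosRootD n)),
      d.Pairwise (· ≥ ·) → ∀ (w : Fin d.length → ℚ)
      (hw : Function.Injective w) (hw0 : ∀ a, w a ≠ 0) (l : List (PosRootD n × ℤ)), d ≤ typ l →
      phi hn d.get hw hw0 (mon E l) = κ l * Psi d.get w l ∅ := by
  classical
  choose κ h0 h using fun p => (hE p).rrep_apply hn
  refine ⟨fun l => (l.map κ).prod, fun l => ?_, ?_⟩
  · rw [Ne, List.prod_eq_zero_iff]
    intro hm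
    obtain ⟨p, -, hp⟩ := List.mem_map.1 hm
    exact h0 p hp
  · intro d hd w hw hw0 l hl
    refine rrep_mon hn d.get hw hw0 (fun p A hA => ?_) l ∅ ?_
    · exact h p d.get w hw hw0 A hA
    · rw [mc_get]; exact dom_of_le _ _ hd hl

theorem Psi_eq_zero {d : List (PosRootD n)} {w : Fin d.length → ℚ} {l : List (PosRootD n × ℤ)}
    (hd : d.Pairwise (· ≥ ·)) (hl : (typ l).Pairwise (· ≥ ·)) (h : typ l ≠ d) :
    Psi d.get w l ∅ = 0 := by
  apply pathSum_eq_zero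
  rw [mc_get]
  intro e
  exact h (List.Perm.eq_of_pairwise (fun a b _ _ h1 h2 => le_antisymm h2 h1) hl hd
    (Multiset.coe_eq_coe.1 e))

theorem Psi_indep {d : List (PosRootD n)} (F : Finset (List (PosRootD n × ℤ)))
    (hF : ∀ l ∈ F, typ l = d)
    (hinj : ∀ l ∈ F, ∀ l' ∈ F, (l : Multiset (PosRootD n × ℤ)) = l' → l = l')
    (c : List (PosRootD n × ℤ) → KK)
    (h : ∀ w : Fin d.length → ℚ, Function.Injective w → (∀ b, w b ≠ 0) →
      ∑ l ∈ F, c l * Psi d.get w l ∅ = 0) : ∀ l ∈ F, c l = 0 := by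
  by_contra hne
  push Not at hne
  obtain ⟨l0, hl0, hc0, hs⟩ := exists_scale F c hne
  have := pathSum_indep d.get F (fun l hl => by rw [mc_get, ← hF l hl]) hinj
    (fun l => evOne (c l / c l0)) (fun w hw hw0 => ?_) l0 hl0
  · rw [div_self hc0, evOne_one] at this
    exact one_ne_zero this
  · have h1 : ∑ l ∈ F, c l / c l0 * Psi d.get w l ∅ = 0 := by
      rw [← zero_div (c l0), ← h w hw hw0, Finset.sum_div]
      exact Finset.sum_congr rfl fun l _ => by ring
    have sumkey : ∀ s ⊆ F, (∑ l ∈ s, c l / c l0 * Psi d.get w l ∅) ∈ locOne ∧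
        evOne (∑ l ∈ s, c l / c l0 * Psi d.get w l ∅) =
          ∑ l ∈ s, evOne (c l / c l0) * pathSum d.get (fun b s _ => w b ^ s) l ∅ := by
      intro s
      induction s using Finset.induction_on with
      | empty => intro _; exact ⟨zero_mem _, evOne_zero⟩
      | insert i s hi ih =>
        intro hsub
        have ih := ih fun x hx => hsub (Finset.mem_insert_of_mem hx)
        have hi' := hs i (hsub (Finset.mem_insert_self _ _))
        obtain ⟨p1, p2⟩ := Psi_regular d.get hw i ∅
        rw [Finset.sum_insert hi, Finset.sum_insert hi]
        exact ⟨add_mem (mul_mem hi' p1) ih.1, by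
          rw [evOne_add (mul_mem hi' p1) ih.1, evOne_mul hi' p1, ih.2, p2]⟩
    rw [← (sumkey F subset_rfl).2, h1, evOne_zero]

/-- index set of the ordered monomials. -/
abbrev HH (n : ℕ) : Type := Lex (PosRootD n × ℤ) →₀ ℕ

/-- decreasing list of labelled roots. -/
def lst (h : HH n) : List (PosRootD n × ℤ) :=
  ((Finsupp.toMultiset h).sort (· ≥ ·)).map ofLex

open Classical in
theorem lst_injective {h h' : HH n} (e : (lst h : Multiset (PosRootD n × ℤ)) = lst h') :
    h = h' := by
  rw [lst, lst, ← Multiset.map_coe, ← Multiset.map_coe, Multiset.sort_eq, Multiset.sort_eq] at e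
  rw [← Finsupp.toMultiset_toFinsupp h, Multiset.map_injective ofLex.injective e,
    Finsupp.toMultiset_toFinsupp]

theorem typ_lst_sorted (h : HH n) : (typ (lst h)).Pairwise (· ≥ ·) := by
  rw [typ, lst, List.map_map, List.pairwise_map]
  refine (Multiset.pairwise_sort _ _).imp fun {a b} hab => ?_
  rcases Prod.Lex.le_iff.1 hab with h | h
  · exact h.le
  · exact h.1.le

/-- if the matrix coefficients of a combination of ordered monomials vanish for all types up to
`d`, all the monomials which occur have type larger than `d`. -/
theorem lt_typ_of_phi_eq_zero {E : PosRootD n × ℤ → UD n} (hE : ∀ p, IsRVD p.1 p.2 (E p))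
    (c : HH n →₀ KK) (d : List (PosRootD n))
    (h : ∀ d' ≤ d, ∀ (w : Fin d'.length → ℚ) (hw : Function.Injective w) (hw0 : ∀ a, w a ≠ 0),
      d'.Pairwise (· ≥ ·) →
      phi hn d'.get hw hw0 (c.sum fun h a => a • mon E (lst h)) = 0) :
    ∀ g ∈ c.support, d < typ (lst g) := by
  classical
  obtain ⟨κ, h0, hκ⟩ := exists_kappa hn hE
  by_contra hne
  push Not at hne
  obtain ⟨g, hg, hgd⟩ := hne
  obtain ⟨g0, hg0, hmin⟩ := Finset.exists_min_image c.support (fun g => typ (lst g)) ⟨g, hg⟩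
  set d0 := typ (lst g0) with hd0
  have hle : d0 ≤ d := (hmin g hg).trans hgd
  have hinjl : Function.Injective (lst (n := n)) := fun a b e => lst_injective (congrArg _ e)
  have hsorted : d0.Pairwise (· ≥ ·) := typ_lst_sorted g0
  let G := c.support.filter fun g => typ (lst g) = d0
  have key := Psi_indep (d := d0) (G.image lst) (by
      intro l hl
      obtain ⟨g, hg, rfl⟩ := Finset.mem_image.1 hl
      exact (Finset.mem_filter.1 hg).2) (by
      intro l hl l' hl' e
      obtain ⟨g, -, rfl⟩ := Finset.mem_image.1 hl
      obtain ⟨g', -, rfl⟩ := Finset.mem_image.1 hl'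
      rw [lst_injective e])
    (fun l => κ l * Function.extend lst c 0 l) (by
      intro w hw hw0
      rw [← h d0 hle w hw hw0 hsorted, Finsupp.sum, map_sum,
        Finset.sum_image fun a _ b _ e => hinjl e]
      rw [← Finset.sum_filter_add_sum_filter_not c.support (fun g => typ (lst g) = d0)]
      rw [Finset.sum_eq_zero (s := c.support.filter fun g => ¬ typ (lst g) = d0), add_zero]
      · refine Finset.sum_congr rfl fun g hg => ?_
        rw [map_smul, hκ d0 hsorted w hw hw0 _ (hmin g (Finset.mem_filter.1 hg).1),
          hinjl.extend_apply, smul_eq_mul]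
        ring
      · intro g hg
        rw [Finset.mem_filter] at hg
        rw [map_smul, hκ d0 hsorted w hw hw0 _ (hmin g hg.1),
          Psi_eq_zero hsorted (typ_lst_sorted g) hg.2, mul_zero, smul_zero])
    (lst g0) (Finset.mem_image_of_mem _ (Finset.mem_filter.2 ⟨hg0, rfl⟩))
  simp only [hinjl.extend_apply] at key
  exact (Finsupp.mem_support_iff.1 hg0) ((mul_eq_zero.1 key).resolve_left (h0 _))

end

theorem sort_toMultiset {ι : Type} [LinearOrder ι] (h : ι →₀ ℕ) :
    (Finsupp.toMultiset h).sort (· ≤ ·) =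
      (h.support.sort (· ≤ ·)).flatMap fun p => List.replicate (h p) p := by
  refine List.Perm.eq_of_pairwise (le := (· ≤ ·)) (fun a b _ _ h1 h2 => le_antisymm h1 h2)
    (Multiset.pairwise_sort _ _) ?_ ?_
  · rw [List.pairwise_flatMap]
    refine ⟨fun a _ => List.pairwise_replicate.2 (Or.inr le_rfl), ?_⟩
    refine (Finset.pairwise_sort h.support (· ≤ ·)).imp fun {a b} hab x hx y hy => ?_
    rw [List.eq_of_mem_replicate hx, List.eq_of_mem_replicate hy]
    exact hab
  · rw [← Multiset.coe_eq_coe, Multiset.sort_eq, Finsupp.toMultiset_apply, Finsupp.sum]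
    rw [← Multiset.coe_bind]
    have : ((h.support.sort (· ≤ ·) : List ι) : Multiset ι) = h.support.val := Finset.sort_eq _ _
    rw [this, Multiset.bind, Multiset.join]
    refine congrArg Multiset.sum (Multiset.map_congr rfl fun a _ => ?_)
    rw [Multiset.nsmul_singleton]
    rfl

theorem ordMon_eq_prod {B ι : Type} [Ring B] [LinearOrder ι] (E : ι → B) (h : ι →₀ ℕ) :
    ordMon E h = (((Finsupp.toMultiset h).sort (· ≤ ·)).map E).prod := by
  rw [sort_toMultiset, ordMon]
  induction h.support.sort (· ≤ ·) with
  | nil => simp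
  | cons a l ih => simp [ih]

theorem ordMon_eq_mon {n : ℕ} {B : Type} [Ring B] (E : PosRootD n × ℤ → B) (h : HH n) :
    ordMon (fun p => E (ofLex p)) h = mon E (lst h) := by
  rw [ordMon_eq_prod, mon, lst, ← List.map_reverse, List.map_map]
  congr 2
  refine List.Perm.eq_of_pairwise (le := (· ≤ ·)) (fun a b _ _ h1 h2 => le_antisymm h1 h2)
    (Multiset.pairwise_sort _ _) ?_ ?_
  · rw [List.pairwise_reverse]
    exact Multiset.pairwise_sort _ _
  · rw [← Multiset.coe_eq_coe, Multiset.sort_eq, Multiset.coe_reverse, Multiset.sort_eq]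

theorem linearIndependent_ordMon {n : ℕ} (hn : 4 ≤ n) (E : PosRootD n × ℤ → UD n)
    (hE : ∀ p, IsRVD p.1 p.2 (E p)) :
    LinearIndependent KK (fun h : HH n => ordMon (fun p => E (ofLex p)) h) := by
  simp only [ordMon_eq_mon]
  rw [linearIndependent_iff]
  intro c hc
  by_contra h0
  obtain ⟨g, hg⟩ := Finsupp.support_nonempty_iff.2 h0
  refine lt_irrefl _ (lt_typ_of_phi_eq_zero hn hE c (typ (lst g)) ?_ g hg)
  intro d' _ w hw hw0 _
  have : (c.sum fun h a => a • mon E (lst h)) = 0 := hc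
  rw [this, map_zero]

theorem lie_jac {Q : Type} [Ring Q] (a b c : Q) : ⁅⁅a, b⁆, c⁆ = ⁅⁅a, c⁆, b⁆ + ⁅a, ⁅b, c⁆⁆ := by
  simp only [Ring.lie_def]; noncomm_ring

theorem lie_neg' {Q : Type} [Ring Q] (a b : Q) : ⁅a, b⁆ = -⁅b, a⁆ := by
  simp only [Ring.lie_def]; noncomm_ring

theorem neg_lie' {Q : Type} [Ring Q] (a b : Q) : ⁅-a, b⁆ = -⁅a, b⁆ := by
  simp only [Ring.lie_def]; noncomm_ring

theorem zero_lie' {Q : Type} [Ring Q] (b : Q) : ⁅(0 : Q), b⁆ = 0 := by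
  simp [Ring.lie_def]

theorem lie_zero' {Q : Type} [Ring Q] (a : Q) : ⁅a, (0 : Q)⁆ = 0 := by
  simp [Ring.lie_def]

/-- the classical limit of the relations of the quantum loop algebra, with loop degrees
between `0` and `m`. -/
structure Cl (n m : ℕ) {Q : Type} [Ring Q] (x : ℕ → ℕ → Q) : Prop where
  two : ∀ a : Q, a + a = 0 → a = 0
  shift : ∀ i j r s, r < m → s < m → ⁅x i (r + 1), x j s⁆ = ⁅x i r, x j (s + 1)⁆
  comm : ∀ i j r s, r ≤ m → s ≤ m → aD n i j = 0 → ⁅x i r, x j s⁆ = 0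
  self : ∀ i r s, r ≤ m → s ≤ m → ⁅x i r, x i s⁆ = 0
  serre : ∀ i j r s t, r ≤ m → s ≤ m → t ≤ m → aD n i j = -1 → ⁅⁅x j t, x i r⁆, x i s⁆ = 0

/-- a family of elements depending on a loop degree, with the number of factors. -/
abbrev Fam (Q : Type) := ℕ × (ℕ → Q)

section
variable {Q : Type} [Ring Q] (m : ℕ) (x : ℕ → ℕ → Q)

/-- the bracket of `F` with `x j` is `G`. -/
def Exd (F : Fam Q) (j : ℕ) (G : Fam Q) : Prop :=
  G.1 = F.1 + 1 ∧ ∀ S r, S ≤ F.1 * m → r ≤ m → ⁅F.2 S, x j r⁆ = G.2 (S + r)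

/-- the bracket of `F` with `x j` vanishes. -/
def Ann (F : Fam Q) (j : ℕ) : Prop := ∀ S r, S ≤ F.1 * m → r ≤ m → ⁅F.2 S, x j r⁆ = 0

/-- the bracket of `F` with `x j` only depends on the total loop degree. -/
def Shf (F : Fam Q) (j : ℕ) : Prop :=
  ∀ S r, S < F.1 * m → r < m → ⁅F.2 (S + 1), x j r⁆ = ⁅F.2 S, x j (r + 1)⁆

/-- candidate for the bracket of `F` with `x j`. -/
def nxt (F : Fam Q) (j : ℕ) : Fam Q :=
  (F.1 + 1, fun S => ⁅F.2 (min S (F.1 * m)), x j (S - min S (F.1 * m))⁆)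

/-- opposite family. -/
def ngF (F : Fam Q) : Fam Q := (F.1, fun S => - F.2 S)

variable {m x}

theorem ext_nxt {F : Fam Q} {j : ℕ} (h : Shf m x F j) : Exd m x F j (nxt m x F j) := by
  refine ⟨rfl, fun S r hS hr => ?_⟩
  simp only [nxt]
  have key : ∀ d S r, S + d ≤ F.1 * m → r + d ≤ m → ⁅F.2 (S + d), x j r⁆ = ⁅F.2 S, x j (r + d)⁆ := by
    intro d
    induction d with
    | zero => intro S r _ _; rfl
    | succ d ih =>
      intro S r h1 h2
      rw [← add_assoc, h (S + d) r (by omega) (by omega), ih S (r + 1) (by omega) (by omega)]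
      congr 2; ring
  obtain ⟨d, hd, h1, h2⟩ : ∃ d, d ≤ r ∧ min (S + r) (F.1 * m) = S + d ∧
      S + r - min (S + r) (F.1 * m) = r - d := by
    refine ⟨min (S + r) (F.1 * m) - S, ?_, ?_, ?_⟩ <;> omega
  rw [h2, h1]
  have := key d S (r - d) (by omega) (by omega)
  rw [this, Nat.sub_add_cancel hd]

theorem Exd.split {F G : Fam Q} {j : ℕ} (h : Exd m x F j G) {T : ℕ} (hT : T ≤ G.1 * m) :
    ∃ S r, S ≤ F.1 * m ∧ r ≤ m ∧ S + r = T := by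
  rw [h.1, Nat.succ_mul] at hT
  exact ⟨min T (F.1 * m), T - min T (F.1 * m), by omega, by omega, by omega⟩

theorem Exd.neg {F G : Fam Q} {j : ℕ} (h : Exd m x F j G) : Exd m x (ngF F) j (ngF G) := by
  refine ⟨h.1, fun S r hS hr => ?_⟩
  simp only [ngF]
  rw [neg_lie', h.2 S r hS hr]

theorem Ann.of_neg {F : Fam Q} {j : ℕ} (h : Ann m x (ngF F) j) : Ann m x F j := by
  intro S r hS hr
  have := h S r hS hr
  simp only [ngF] at this
  rw [neg_lie', neg_eq_zero] at this
  exact this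

theorem Ann.neg {F : Fam Q} {j : ℕ} (h : Ann m x F j) : Ann m x (ngF F) j := by
  intro S r hS hr
  show ⁅- F.2 S, x j r⁆ = 0
  rw [neg_lie', h S r hS hr, neg_zero]

variable {n : ℕ} (hx : Cl n m x)
include hx

theorem Cl.shf_gen (i j : ℕ) : Shf m x (1, x i) j := by
  intro S r hS hr
  exact hx.shift i j S r (by simpa using hS) hr

theorem Cl.ann_gen {i j : ℕ} (h : aD n i j = 0) : Ann m x (1, x i) j := by
  intro S r hS hr
  exact hx.comm i j S r (by simpa using hS) hr h

theorem Cl.ann_self (i : ℕ) : Ann m x (1, x i) i := by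
  intro S r hS hr
  exact hx.self i S r (by simpa using hS) hr

theorem Cl.ann_comm {Y Z : Fam Q} {j k : ℕ} (h : Exd m x Y j Z) (hk : Ann m x Y k)
    (hjk : aD n j k = 0) : Ann m x Z k := by
  intro T s hT hs
  obtain ⟨S, r, hS, hr, rfl⟩ := h.split hT
  rw [← h.2 S r hS hr, lie_jac, hk S s hS hs, hx.comm j k r s hr hs hjk, zero_lie', lie_zero',
    add_zero]

theorem Cl.ext_comm {Y Z W V : Fam Q} {j k : ℕ} (h : Exd m x Y j Z) (hk : Exd m x Y k W)
    (hV : Exd m x W j V) (hjk : aD n j k = 0) : Exd m x Z k V := by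
  refine ⟨by rw [hV.1, hk.1, h.1], fun T s hT hs => ?_⟩
  obtain ⟨S, r, hS, hr, rfl⟩ := h.split hT
  have : S + s ≤ W.1 * m := by rw [hk.1, Nat.succ_mul]; omega
  rw [← h.2 S r hS hr, lie_jac, hx.comm j k r s hr hs hjk, lie_zero', add_zero, hk.2 S s hS hs,
    hV.2 _ r this hr]
  rw [add_right_comm]

theorem Cl.shf_comm {Y Z W : Fam Q} {j k : ℕ} (h : Exd m x Y j Z) (hk : Exd m x Y k W)
    (hjk : aD n j k = 0) (hY : 0 < Y.1) : Shf m x Z k := by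
  intro T s hT hs
  have hT' : T + 1 ≤ Z.1 * m := hT
  rw [h.1, Nat.succ_mul] at hT'
  have hm : m ≤ Y.1 * m := Nat.le_mul_of_pos_left m hY
  obtain ⟨S, r, hS, hr, rfl⟩ : ∃ S r, S + 1 ≤ Y.1 * m ∧ r ≤ m ∧ S + r = T :=
    ⟨min T (Y.1 * m - 1), T - min T (Y.1 * m - 1), by omega, by omega, by omega⟩
  have e1 : S + r + 1 = (S + 1) + r := by ring
  rw [e1, ← h.2 (S + 1) r hS hr, ← h.2 S r (by omega) hr, lie_jac, lie_jac (Y.2 S),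
    hx.comm j k r s hr hs.le hjk, hx.comm j k r (s + 1) hr hs hjk, lie_zero', lie_zero',
    hk.2 (S + 1) s hS hs.le, hk.2 S (s + 1) (by omega) hs]
  rw [add_right_comm S 1 s, add_assoc S s 1]

theorem Cl.shf_create {Y Z : Fam Q} {j k : ℕ} (h : Exd m x Y j Z) (hk : Ann m x Y k) :
    Shf m x Z k := by
  intro T s hT hs
  have hT' : T + 1 ≤ Z.1 * m := hT
  rw [h.1, Nat.succ_mul] at hT'
  obtain ⟨S, r, hS, hr, rfl⟩ : ∃ S r, S ≤ Y.1 * m ∧ r + 1 ≤ m ∧ S + r = T :=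
    ⟨min T (Y.1 * m), T - min T (Y.1 * m), by omega, by omega, by omega⟩
  rw [add_assoc, ← h.2 S (r + 1) hS hr, ← h.2 S r hS (by omega), lie_jac,
    lie_jac (Y.2 S) (x j r), hk S s hS hs.le, hk S (s + 1) hS hs, hx.shift j k r s (by omega) hs,
    zero_lie', zero_lie']

theorem Cl.ann_serre {Y Z V : Fam Q} {j k : ℕ} (h : Exd m x Y j Z) (hk : Ann m x Y k)
    (hV : Exd m x Z k V) (hjk : aD n k j = -1) : Ann m x V k := by
  intro T t hT ht
  obtain ⟨T', s, hT', hs, rfl⟩ := hV.split hT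
  obtain ⟨S, r, hS, hr, rfl⟩ := h.split hT'
  rw [← hV.2 _ s hT' hs, ← h.2 S r hS hr, lie_jac (Y.2 S), hk S s hS hs, zero_lie', zero_add,
    lie_jac (Y.2 S), hk S t hS ht, zero_lie', zero_add, hx.serre k j s t r hs ht hr hjk, lie_zero']

theorem Cl.ann_serre_gen {j k : ℕ} {V : Fam Q} (hV : Exd m x (1, x j) k V)
    (hjk : aD n k j = -1) : Ann m x V k := by
  intro T t hT ht
  obtain ⟨S, s, hS, hs, rfl⟩ := hV.split hT
  rw [← hV.2 _ s hS hs]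
  exact hx.serre k j s t S hs ht (by simpa using hS) hjk

theorem Cl.ann_serre_gen' {j k : ℕ} {V : Fam Q} (hV : Exd m x (1, x j) k V)
    (hjk : aD n j k = -1) : Ann m x V j := by
  intro T t hT ht
  obtain ⟨S, s, hS, hs, rfl⟩ := hV.split hT
  rw [← hV.2 _ s hS hs]
  show ⁅⁅x j S, x k s⁆, x j t⁆ = 0
  rw [lie_neg' (x j S), neg_lie', hx.serre j k S t s (by simpa using hS) ht hs hjk, neg_zero]

theorem Cl.ann_polar {Y Z V : Fam Q} {j k : ℕ} (hY : 0 < Y.1) (h : Exd m x Y j Z)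
    (hj : Ann m x Z j) (hk : Ann m x Y k) (hV : Exd m x Z k V) (hjk : aD n j k = -1) :
    Ann m x V j := by
  have hm : m ≤ Y.1 * m := Nat.le_mul_of_pos_left m hY
  have key : ∀ S r s t, S ≤ Y.1 * m → r ≤ m → s ≤ m → t ≤ m →
      ⁅V.2 (S + r + s), x j t⁆ = - ⁅V.2 (S + t + s), x j r⁆ := by
    intro S r s t hS hr hs ht
    have hZ : ∀ r ≤ m, S + r ≤ Z.1 * m := fun r hr => by rw [h.1, Nat.succ_mul]; omega
    have e1 : V.2 (S + r + s) = ⁅Y.2 S, ⁅x j r, x k s⁆⁆ := by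
      rw [← hV.2 _ s (hZ r hr) hs, ← h.2 S r hS hr, lie_jac, hk S s hS hs, zero_lie', zero_add]
    have e2 : ⁅⁅x j r, x k s⁆, x j t⁆ = 0 := by
      rw [lie_neg' (x j r), neg_lie', hx.serre j k r t s hr ht hs hjk, neg_zero]
    have e3 : ⁅Z.2 (S + t), ⁅x j r, x k s⁆⁆ = - ⁅V.2 (S + t + s), x j r⁆ := by
      have := lie_jac (Z.2 (S + t)) (x j r) (x k s)
      rw [hj _ r (hZ t ht) hr, zero_lie', hV.2 _ s (hZ t ht) hs] at this
      exact eq_neg_of_add_eq_zero_right this.symm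
    rw [e1, lie_jac, e2, lie_zero', add_zero, h.2 S t hS ht, e3]
  have diag : ∀ T t, t ≤ m → t ≤ T → T ≤ t + (Y.1 + 1) * m → ⁅V.2 T, x j t⁆ = 0 := by
    intro T t ht h1 h2
    rw [Nat.succ_mul] at h2
    obtain ⟨S, s, hS, hs, rfl⟩ : ∃ S s, S ≤ Y.1 * m ∧ s ≤ m ∧ S + t + s = T :=
      ⟨min (T - t) (Y.1 * m), T - t - min (T - t) (Y.1 * m), by omega, by omega, by omega⟩
    apply hx.two
    nth_rewrite 1 [key S t s t hS ht hs ht]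
    simp
  intro T t hT ht
  have hT' : T ≤ Y.1 * m + m + m := by
    rw [hV.1, h.1, Nat.succ_mul, Nat.succ_mul] at hT; exact hT
  by_cases h1 : T < t
  · have := key T 0 0 t (by omega) (by omega) (by omega) ht
    rw [add_zero, add_zero, diag (T + t + 0) 0 (by omega) (by omega)
      (by rw [Nat.succ_mul]; omega), neg_zero] at this
    exact this
  · by_cases h2 : T ≤ t + (Y.1 + 1) * m
    · exact diag T t ht (by omega) h2
    · rw [Nat.succ_mul] at h2
      obtain ⟨S, s, hS, hs, hSs⟩ : ∃ S s, S ≤ Y.1 * m ∧ s ≤ m ∧ S + m + s = T :=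
        ⟨min (T - m) (Y.1 * m), T - m - min (T - m) (Y.1 * m), by omega, by omega, by omega⟩
      have := key S m s t hS le_rfl hs ht
      rw [hSs, diag (S + t + s) m le_rfl (by omega) (by rw [Nat.succ_mul]; omega), neg_zero] at this
      exact this

end

section
variable {Q : Type} [Ring Q] (n m : ℕ) (x : ℕ → ℕ → Q)

/-- the root vectors in the classical limit, as families in the loop degree. -/
def rootFam (p : ℕ) : ℕ → Fam Q
  | 0 => (1, x p)
  | 1 => nxt m x (rootFam p 0) (p + 1)
  | t + 2 => if p + t + 2 = n then nxt m x (rootFam p t) n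
      else nxt m x (rootFam p (t + 1)) (if p + t + 2 < n then p + t + 2 else 2 * n - (p + t + 2))

/-- `k` is the letter leading from the root `(p, t)` to the root `(p, t')`. -/
def Edge (n p t k t' : ℕ) : Prop :=
  (t' = t + 1 ∧ p + t + 2 ≤ n ∧ k = p + t + 1) ∨ (t' = t + 2 ∧ p + t + 2 = n ∧ k = n) ∨
    (t' = t + 1 ∧ n ≤ p + t ∧ k + p + t + 1 = 2 * n ∧ p + 1 ≤ k)

theorem rootFam_edge {p t k t' : ℕ} (hp : p + 2 ≤ n) (h : Edge n p t k t') :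
    rootFam n m x p t' = nxt m x (rootFam n m x p t) k := by
  rcases h with ⟨rfl, h, rfl⟩ | ⟨rfl, h, rfl⟩ | ⟨rfl, h, h', h''⟩
  · cases t with
    | zero => rfl
    | succ t =>
      rw [rootFam, if_neg (by omega), if_pos (by omega)]
      rfl
  · rw [rootFam, if_pos h]
  · obtain ⟨t, rfl⟩ : ∃ s, t = s + 1 := ⟨t - 1, by omega⟩
    rw [rootFam, if_neg (by omega), if_neg (by omega)]
    congr 1; omega

theorem rootFam_pos (p t : ℕ) : 0 < (rootFam n m x p t).1 := by
  rcases t with _ | _ | t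
  · simp [rootFam]
  · simp [rootFam, nxt]
  · rw [rootFam]; split_ifs <;> simp [nxt]

theorem edge_induction {n p : ℕ} (hp : p + 2 ≤ n) (P : ℕ → Prop) (h0 : P 0)
    (hs : ∀ t k t', Edge n p t k t' → P t → P t') : ∀ t, t + 2 * p + 1 ≤ 2 * n → P t := by
  intro t
  induction t using Nat.strong_induction_on with
  | _ t ih =>
  intro ht
  rcases t with _ | t
  · exact h0
  by_cases h1 : p + t + 2 ≤ n
  · exact hs t (p + t + 1) _ (by unfold Edge; omega) (ih t (by omega) (by omega))
  by_cases h2 : p + t + 1 = n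
  · obtain ⟨t, rfl⟩ : ∃ s, t = s + 1 := ⟨t - 1, by omega⟩
    exact hs t n _ (by unfold Edge; omega) (ih t (by omega) (by omega))
  · exact hs t (2 * n - (p + t + 1)) _ (by unfold Edge; omega) (ih t (by omega) (by omega))

theorem Exd.swap {m : ℕ} {x : ℕ → ℕ → Q} {i j : ℕ} {G : Fam Q} (h : Exd m x (1, x i) j G) :
    Exd m x (1, x j) i (ngF G) := by
  refine ⟨h.1, fun S r hS hr => ?_⟩
  show ⁅x j S, x i r⁆ = - G.2 (S + r)
  rw [lie_neg', ← add_comm r, ← h.2 r S (by simpa using hr) (by simpa using hS)]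

variable {n m x} (hx : Cl n m x)
include hx

theorem Cl.row_start {p : ℕ} (hp1 : 1 ≤ p) (hp : p + 2 ≤ n) : ∀ t, p + t + 1 ≤ n →
    (∀ c, c ≤ n → p + t + 2 ≤ c → ¬ (p + t + 2 = n ∧ c = n) → Ann m x (rootFam n m x p t) c) ∧
    (∀ c, p ≤ c → c ≤ p + t → Ann m x (rootFam n m x p t) c) ∧
    (∀ s, t = s + 1 → Exd m x (rootFam n m x p s) (p + t) (rootFam n m x p t)) := by
  intro t
  induction t using Nat.strong_induction_on with
  | _ t ih =>
  intro ht
  rcases t with _ | t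
  · refine ⟨fun c h1 h2 h3 => ?_, fun c h1 h2 => ?_, fun s hs => by omega⟩
    · exact hx.ann_gen (by unfold aD; split_ifs <;> omega)
    · obtain rfl : c = p := by omega
      exact hx.ann_self c
  · obtain ⟨A1, A2, A3⟩ := ih t (by omega) (by omega)
    have hE : Exd m x (rootFam n m x p t) (p + t + 1) (rootFam n m x p (t + 1)) := by
      rw [rootFam_edge n m x hp (show Edge n p t (p + t + 1) (t + 1) by unfold Edge; omega)]
      apply ext_nxt
      rcases t with _ | t
      · exact hx.shf_gen _ _
      · exact hx.shf_create (A3 t rfl)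
          ((ih t (by omega) (by omega)).1 _ (by omega) (by omega) (by omega))
    refine ⟨fun c h1 h2 h3 => ?_, fun c h1 h2 => ?_, fun s hs => ?_⟩
    · exact hx.ann_comm hE (A1 c h1 (by omega) (by omega)) (by unfold aD; split_ifs <;> omega)
    · obtain rfl | rfl | h : c = p + t + 1 ∨ c = p + t ∨ c + 2 ≤ p + t + 1 := by omega
      · rcases t with _ | t
        · exact hx.ann_serre_gen hE (by unfold aD; split_ifs <;> omega)
        · exact hx.ann_serre (A3 t rfl)
            ((ih t (by omega) (by omega)).1 _ (by omega) (by omega) (by omega)) hE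
            (by unfold aD; split_ifs <;> omega)
      · rcases t with _ | t
        · exact hx.ann_serre_gen' hE (by unfold aD; split_ifs <;> omega)
        · exact hx.ann_polar (rootFam_pos n m x _ _) (A3 t rfl) (A2 _ (by omega) (by omega))
            ((ih t (by omega) (by omega)).1 _ (by omega) (by omega) (by omega)) hE
            (by unfold aD; split_ifs <;> omega)
      · exact hx.ann_comm hE (A2 c h1 (by omega)) (by unfold aD; split_ifs <;> omega)
    · obtain rfl : t = s := by omega
      exact hE

theorem Cl.row_mid {p : ℕ} (hp1 : 1 ≤ p) (hp : p + 2 ≤ n) {a : ℕ} (ha : p + a + 2 = n) :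
    Exd m x (rootFam n m x p a) n (rootFam n m x p (a + 2)) ∧
    (∀ c, p ≤ c → c ≤ n → c + 1 ≠ n → Ann m x (rootFam n m x p (a + 2)) c) ∧
    Exd m x (rootFam n m x p (a + 2)) (n - 1) (rootFam n m x p (a + 3)) ∧ Exd m x (rootFam n m x p (a + 1)) n (rootFam n m x p (a + 3)) ∧
    (∀ c, p ≤ c → c ≤ n → c + 2 ≠ n → Ann m x (rootFam n m x p (a + 3)) c) := by
  obtain ⟨A1, A2, A3⟩ := hx.row_start hp1 hp a (by omega)
  obtain ⟨B1, B2, B3⟩ := hx.row_start hp1 hp (a + 1) (by omega)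
  have hB : Exd m x (rootFam n m x p a) (n - 1) (rootFam n m x p (a + 1)) := by
    have := B3 a rfl
    rwa [show p + (a + 1) = n - 1 by omega] at this
  have hC : Exd m x (rootFam n m x p a) n (rootFam n m x p (a + 2)) := by
    rw [rootFam_edge n m x hp (show Edge n p a n (a + 2) by unfold Edge; omega)]
    apply ext_nxt
    rcases a with _ | a
    · exact hx.shf_gen _ _
    · exact hx.shf_create (A3 a rfl)
        ((hx.row_start hp1 hp a (by omega)).1 _ (by omega) (by omega) (by omega))
  have hCA : ∀ c, p ≤ c → c ≤ n → c + 1 ≠ n → Ann m x (rootFam n m x p (a + 2)) c := by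
    intro c h1 h2 h3
    obtain rfl | rfl | h : c = n ∨ c = p + a ∨ c < p + a := by omega
    · rcases a with _ | a
      · exact hx.ann_serre_gen hC (by unfold aD; split_ifs <;> omega)
      · exact hx.ann_serre (A3 a rfl)
          ((hx.row_start hp1 hp a (by omega)).1 _ (by omega) (by omega) (by omega)) hC
          (by unfold aD; split_ifs <;> omega)
    · rcases a with _ | a
      · exact hx.ann_serre_gen' hC (by unfold aD; split_ifs <;> omega)
      · exact hx.ann_polar (rootFam_pos n m x _ _) (A3 a rfl) (A2 _ (by omega) (by omega))
          ((hx.row_start hp1 hp a (by omega)).1 _ (by omega) (by omega) (by omega)) hC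
          (by unfold aD; split_ifs <;> omega)
    · exact hx.ann_comm hC (A2 c h1 (by omega)) (by unfold aD; split_ifs <;> omega)
  have hD : Exd m x (rootFam n m x p (a + 2)) (n - 1) (rootFam n m x p (a + 3)) := by
    rw [rootFam_edge n m x hp (show Edge n p (a + 2) (n - 1) (a + 3) by unfold Edge; omega)]
    exact ext_nxt (hx.shf_comm hC hB (by unfold aD; split_ifs <;> omega) (rootFam_pos n m x _ _))
  have hD' : Exd m x (rootFam n m x p (a + 1)) n (rootFam n m x p (a + 3)) :=
    hx.ext_comm hB hC hD (by unfold aD; split_ifs <;> omega)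
  refine ⟨hC, hCA, hD, hD', fun c h1 h2 h3 => ?_⟩
  obtain h | h : c + 1 = n ∨ c + 1 ≠ n := by omega
  · exact hx.ann_comm hD' (B2 c h1 (by omega)) (by unfold aD; split_ifs <;> omega)
  · exact hx.ann_comm hD (hCA c h1 h2 h) (by unfold aD; split_ifs <;> omega)

theorem Cl.row_end {p : ℕ} (hp1 : 1 ≤ p) (hp : p + 2 ≤ n) : ∀ t j, p + t + 1 + j = 2 * n → p < j →
    j + 1 ≤ n →
    (∀ c, p ≤ c → c ≤ n → c + 1 ≠ j → Ann m x (rootFam n m x p (t + 1)) c) ∧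
    Ann m x (rootFam n m x p t) (j - 1) ∧ Exd m x (rootFam n m x p t) j (rootFam n m x p (t + 1)) := by
  obtain ⟨a, ha⟩ : ∃ a, p + a + 2 = n := ⟨n - 2 - p, by omega⟩
  obtain ⟨hC, hCA, hD, hD', hDA⟩ := hx.row_mid hp1 hp ha
  have hs : ∀ d t j, t = a + 2 + d → p + t + 1 + j = 2 * n → p < j → j + 1 ≤ n →
    (∀ c, p ≤ c → c ≤ n → c + 1 ≠ j → Ann m x (rootFam n m x p (t + 1)) c) ∧
    Ann m x (rootFam n m x p t) (j - 1) ∧ Exd m x (rootFam n m x p t) j (rootFam n m x p (t + 1)) := by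
    intro d
    induction d with
    | zero =>
      rintro t j rfl h1 h2 h3
      obtain rfl : j = n - 1 := by omega
      exact ⟨fun c h4 h5 h6 => hDA c h4 h5 (by omega), hCA _ (by omega) (by omega) (by omega), hD⟩
    | succ d ih =>
      rintro t j ht h1 h2 h3
      obtain ⟨t, rfl⟩ : ∃ s, t = s + 1 := ⟨t - 1, by omega⟩
      obtain ⟨I1, I2, I3⟩ := ih t (j + 1) (by omega) (by omega) (by omega) (by omega)
      rw [Nat.add_sub_cancel] at I2
      have hE : Exd m x (rootFam n m x p (t + 1)) j (rootFam n m x p (t + 2)) := by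
        rw [rootFam_edge n m x hp (show Edge n p (t + 1) j (t + 2) by unfold Edge; omega)]
        exact ext_nxt (hx.shf_create I3 I2)
      refine ⟨fun c h4 h5 h6 => ?_, I1 _ (by omega) (by omega) (by omega), hE⟩
      obtain rfl | rfl | h : c = j ∨ c = j + 1 ∨ c + 1 < j ∨ j + 1 < c := by omega
      · exact hx.ann_serre I3 I2 hE (by unfold aD; split_ifs <;> omega)
      · exact hx.ann_polar (rootFam_pos n m x _ _) I3 (I1 _ h4 h5 (by omega)) I2 hE
          (by unfold aD; split_ifs <;> omega)
      · by_cases h7 : j + 2 = n ∧ c = n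
        · obtain ⟨h7, rfl⟩ := h7
          obtain rfl : t = a + 2 := by omega
          exact hx.ann_polar (rootFam_pos c m x _ _) hD' (hDA _ h4 h5 (by omega))
            ((hx.row_start hp1 hp (a + 1) (by omega)).2.1 j (by omega) (by omega)) hE
            (by unfold aD; split_ifs <;> omega)
        · exact hx.ann_comm hE (I1 c h4 h5 (by omega)) (by unfold aD; split_ifs <;> omega)
  intro t j h1 h2 h3
  exact hs (t - (a + 2)) t j (by omega) h1 h2 h3

theorem Cl.ext_edge {p t k t' : ℕ} (hp1 : 1 ≤ p) (hp : p + 2 ≤ n) (h : Edge n p t k t') :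
    Exd m x (rootFam n m x p t) k (rootFam n m x p t') := by
  rcases h with ⟨rfl, h, rfl⟩ | ⟨rfl, h, rfl⟩ | ⟨rfl, h, h', h''⟩
  · exact (hx.row_start hp1 hp (t + 1) (by omega)).2.2 t rfl
  · exact (hx.row_mid hp1 hp h).1
  · exact (hx.row_end hp1 hp t k (by omega) (by omega) (by omega)).2.2

theorem Cl.ext_left {p : ℕ} (hp1 : 1 ≤ p) (hp : p + 3 ≤ n) : ∀ t, t + 2 * (p + 1) + 1 ≤ 2 * n →
    Exd m x (rootFam n m x (p + 1) t) p (ngF (rootFam n m x p (t + 1))) := by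
  apply edge_induction (by omega)
  · exact Exd.swap (hx.ext_edge (t := 0) hp1 (by omega) (by unfold Edge; omega))
  · intro t k t' he ih
    have he' : Edge n p (t + 1) k (t' + 1) := by unfold Edge at he ⊢; omega
    refine hx.ext_comm (hx.ext_edge (by omega) (by omega) he) ih
      (hx.ext_edge hp1 (by omega) he').neg ?_
    unfold Edge at he; unfold aD; split_ifs <;> omega

theorem Cl.ann_left {p c : ℕ} (hp : p + 2 ≤ n) (hc : c + 2 ≤ p) : ∀ t, t + 2 * p + 1 ≤ 2 * n →
    Ann m x (rootFam n m x p t) c := by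
  apply edge_induction hp
  · exact hx.ann_gen (by unfold aD; split_ifs <;> omega)
  · intro t k t' he ih
    refine hx.ann_comm (hx.ext_edge (by omega) hp he) ih ?_
    unfold Edge at he; unfold aD; split_ifs <;> omega

theorem Cl.ann_long (hn : 4 ≤ n) : ∀ d p t, 1 ≤ p → p + 2 + d = n → t + 2 * p + 1 = 2 * n →
    Ann m x (rootFam n m x p t) p := by
  intro d
  induction d with
  | zero =>
    intro p t hp1 hp ht
    obtain rfl : t = 3 := by omega
    obtain ⟨hC, hCA, hD, hD', hDA⟩ := hx.row_mid hp1 (by omega) (a := 0) (by omega)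
    exact (hx.ann_polar (Y := (1, x n)) (j := p) (k := n - 1) (by simp)
      (Exd.swap hC) (hCA p (by omega) (by omega) (by omega)).neg
      (hx.ann_gen (by unfold aD; split_ifs <;> omega)) hD.neg
      (by unfold aD; split_ifs <;> omega)).of_neg
  | succ d ih =>
    intro p t hp1 hp ht
    obtain ⟨t, rfl⟩ : ∃ s, t = s + 2 := ⟨t - 2, by omega⟩
    obtain ⟨I1, I2, I3⟩ := hx.row_end hp1 (by omega) (t + 1) (p + 1) (by omega) (by omega)
      (by omega)
    exact (hx.ann_polar (k := p + 1) (rootFam_pos n m x _ _)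
      (hx.ext_left hp1 (by omega) t (by omega)) (Ann.neg I2)
      (ih (p + 1) t (by omega) (by omega) (by omega)) I3.neg
      (by unfold aD; split_ifs <;> omega)).of_neg

/-- the bracket of a root vector with a generator is zero or, up to sign, a root vector. -/
theorem Cl.bracket_gen (hn : 4 ≤ n) {p t c : ℕ} (h : ValidRoot n p t) (hc1 : 1 ≤ c) (hc : c ≤ n) :
    Ann m x (rootFam n m x p t) c ∨ ∃ p' t', ValidRoot n p' t' ∧
      (Exd m x (rootFam n m x p t) c (rootFam n m x p' t') ∨ Exd m x (rootFam n m x p t) c (ngF (rootFam n m x p' t'))) := by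
  obtain ⟨h1, h2, h3, h4⟩ := h
  by_cases hp : p + 2 ≤ n
  · have edge : ∀ t', Edge n p t c t' → t' + 2 * p + 1 ≤ 2 * n → Ann m x (rootFam n m x p t) c ∨
        ∃ p' t', ValidRoot n p' t' ∧
      (Exd m x (rootFam n m x p t) c (rootFam n m x p' t') ∨ Exd m x (rootFam n m x p t) c (ngF (rootFam n m x p' t'))) := fun t' he ht' =>
      Or.inr ⟨p, t', ⟨h1, h2, by omega, by omega⟩, Or.inl (hx.ext_edge h1 hp he)⟩
    by_cases hl : c + 2 ≤ p
    · exact Or.inl (hx.ann_left hp hl t (by omega))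
    by_cases hl' : c + 1 = p
    · subst hl'
      exact Or.inr ⟨c, t + 1, ⟨by omega, by omega, by omega, by omega⟩,
        Or.inr (hx.ext_left (by omega) (by omega) t (by omega))⟩
    by_cases hq : p + t + 1 ≤ n
    · obtain ⟨A1, A2, A3⟩ := hx.row_start h1 hp t (by omega)
      by_cases hc2 : c ≤ p + t
      · exact Or.inl (A2 c (by omega) hc2)
      by_cases hc3 : c = p + t + 1
      · by_cases hc4 : p + t + 2 ≤ n
        · exact edge (t + 1) (by unfold Edge; omega) (by omega)
        · obtain ⟨t, rfl⟩ : ∃ s, t = s + 1 := ⟨t - 1, by omega⟩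
          obtain rfl : c = n := by omega
          exact Or.inr ⟨p, t + 3, ⟨by omega, by omega, by omega, by omega⟩,
            Or.inl (hx.row_mid h1 hp (by omega)).2.2.2.1⟩
      by_cases hc4 : p + t + 2 = n ∧ c = n
      · exact edge (t + 2) (by unfold Edge; omega) (by omega)
      · exact Or.inl (A1 c hc (by omega) hc4)
    by_cases hq2 : p + t = n
    · obtain ⟨t, rfl⟩ : ∃ s, t = s + 2 := ⟨t - 2, by omega⟩
      by_cases hc2 : c + 1 = n
      · exact edge (t + 3) (by unfold Edge; omega) (by omega)
      · exact Or.inl ((hx.row_mid h1 hp (by omega)).2.1 c (by omega) hc hc2)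
    · obtain ⟨t, rfl⟩ : ∃ s, t = s + 1 := ⟨t - 1, by omega⟩
      obtain ⟨I1, I2, I3⟩ := hx.row_end h1 hp t (2 * n - (p + t + 1)) (by omega) (by omega)
        (by omega)
      by_cases hc2 : c + 1 = 2 * n - (p + t + 1)
      · by_cases hc3 : c = p
        · subst hc3
          exact Or.inl (hx.ann_long hn (n - 2 - c) c (t + 1) h1 (by omega) (by omega))
        · exact edge (t + 2) (by unfold Edge; omega) (by omega)
      · exact Or.inl (I1 c (by omega) hc hc2)
  · obtain rfl : t = 0 := h3 (by omega)
    by_cases hself : c = p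
    · subst hself
      exact Or.inl (hx.ann_self c)
    by_cases h5 : aD n p c = 0
    · exact Or.inl (hx.ann_gen h5)
    obtain h6 : c + 2 = n := by
      unfold aD at h5; split_ifs at h5 <;> omega
    by_cases h7 : p = n
    · subst h7
      exact Or.inr ⟨c, 2, ⟨by omega, by omega, by omega, by omega⟩,
        Or.inr (Exd.swap (hx.ext_edge (t := 0) hc1 (by omega) (by unfold Edge; omega)))⟩
    · obtain rfl : p = c + 1 := by omega
      exact Or.inr ⟨c, 1, ⟨by omega, by omega, by omega, by omega⟩,
        Or.inr (Exd.swap (hx.ext_edge (t := 0) hc1 (by omega) (by unfold Edge; omega)))⟩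

end

theorem add_lie' {Q : Type} [Ring Q] (a b c : Q) : ⁅a + b, c⁆ = ⁅a, c⁆ + ⁅b, c⁆ := by
  simp only [Ring.lie_def]; noncomm_ring

theorem lie_jac' {Q : Type} [Ring Q] (a b c : Q) : ⁅a, ⁅b, c⁆⁆ = ⁅⁅a, b⁆, c⁆ - ⁅⁅a, c⁆, b⁆ := by
  simp only [Ring.lie_def]; noncomm_ring

section
variable {Q : Type} [Ring Q] (n m : ℕ) (x : ℕ → ℕ → Q)

/-- the additive span of the root vectors of a given height. -/
def rootSpan (l : ℕ) : AddSubgroup Q := AddSubgroup.closure {z | ∃ p t S, ValidRoot n p t ∧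
  (rootFam n m x p t).1 = l ∧ S ≤ l * m ∧ z = (rootFam n m x p t).2 S}

/-- iterated commutators. -/
def chainL (y : ℕ → ℕ → Q) (c s : ℕ → ℕ) : ℕ → Q
  | 0 => y (c 0) (s 0)
  | k + 1 => ⁅chainL y c s k, y (c (k + 1)) (s (k + 1))⁆

variable {n m x} (hx : Cl n m x)

theorem rootFam_fst {p t : ℕ} (h : ValidRoot n p t) : (rootFam n m x p t).1 = len n p t := by
  obtain ⟨h1, h2, h3, h4⟩ := h
  by_cases hp : p + 2 ≤ n
  · have : ∀ t, t + 2 * p + 1 ≤ 2 * n → (rootFam n m x p t).1 = len n p t := by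
      apply edge_induction hp
      · simp only [rootFam, len]; rw [if_pos (by omega)]
      · intro t k t' he ih
        rw [rootFam_edge n m x hp he]
        simp only [nxt, ih]
        unfold Edge at he; unfold len; split_ifs <;> omega
    exact this t (by omega)
  · obtain rfl : t = 0 := h3 (by omega)
    simp only [rootFam, len]; rw [if_pos (by omega)]

include hx

theorem Cl.lie_gen_mem (hn : 4 ≤ n) {l : ℕ} {y : Q} (hy : y ∈ rootSpan n m x l) {c r : ℕ}
    (hc1 : 1 ≤ c) (hc : c ≤ n) (hr : r ≤ m) : ⁅y, x c r⁆ ∈ rootSpan n m x (l + 1) := by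
  induction hy using AddSubgroup.closure_induction with
  | mem y hy =>
    obtain ⟨p, t, S, hv, rfl, hS, rfl⟩ := hy
    rcases hx.bracket_gen hn hv hc1 hc with h | ⟨p', t', hv', h | h⟩
    · rw [h S r hS hr]; exact zero_mem _
    · rw [h.2 S r hS hr]
      exact AddSubgroup.subset_closure ⟨p', t', S + r, hv', h.1, by rw [Nat.succ_mul]; omega, rfl⟩
    · rw [h.2 S r hS hr]
      exact neg_mem (AddSubgroup.subset_closure
        ⟨p', t', S + r, hv', h.1, by rw [Nat.succ_mul]; omega, rfl⟩)
  | zero => rw [zero_lie']; exact zero_mem _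
  | add a b _ _ ha hb => rw [add_lie']; exact add_mem ha hb
  | neg a _ ha => rw [neg_lie']; exact neg_mem ha

theorem Cl.lie_mem (hn : 4 ≤ n) {p t : ℕ} (hv : ValidRoot n p t) : ∀ (l : ℕ) (y : Q),
    y ∈ rootSpan n m x l → ∀ S : ℕ, S ≤ (rootFam n m x p t).1 * m →
      ⁅y, (rootFam n m x p t).2 S⁆ ∈ rootSpan n m x (l + (rootFam n m x p t).1) := by
  obtain ⟨h1, h2, h3, h4⟩ := hv
  have h0 : ∀ (l : ℕ) (y : Q), y ∈ rootSpan n m x l → ∀ S : ℕ, S ≤ (rootFam n m x p 0).1 * m →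
      ⁅y, (rootFam n m x p 0).2 S⁆ ∈ rootSpan n m x (l + (rootFam n m x p 0).1) := by
    intro l y hy S hS
    exact hx.lie_gen_mem hn hy h1 h2 (by simpa [rootFam] using hS)
  by_cases hp : p + 2 ≤ n
  · revert t
    intro t h3 h4
    apply edge_induction (P := fun t => ∀ (l : ℕ) (y : Q),
      y ∈ rootSpan n m x l → ∀ S : ℕ, S ≤ (rootFam n m x p t).1 * m →
      ⁅y, (rootFam n m x p t).2 S⁆ ∈ rootSpan n m x (l + (rootFam n m x p t).1)) hp h0 _ t (by omega)
    intro t k t' he ih l y hy S hS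
    have hE := hx.ext_edge h1 hp he
    have hk : 1 ≤ k ∧ k ≤ n := by unfold Edge at he; omega
    obtain ⟨T, r, hT, hr, rfl⟩ := hE.split hS
    rw [← hE.2 T r hT hr, hE.1, lie_jac']
    refine sub_mem ?_ ?_
    · exact hx.lie_gen_mem hn (ih _ _ hy _ hT) hk.1 hk.2 hr
    · have := ih _ _ (hx.lie_gen_mem hn hy hk.1 hk.2 hr) _ hT
      rwa [add_right_comm] at this
  · obtain rfl : t = 0 := h3 (by omega)
    exact h0

theorem Cl.chainL_eq {p t : ℕ} (hv : ValidRoot n p t) (s : ℕ → ℕ) (hs : ∀ k, s k ≤ m) :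
    chainL x (ltr n p t) s (len n p t - 1) =
      (rootFam n m x p t).2 (∑ k ∈ Finset.range (len n p t), s k) := by
  obtain ⟨h1, h2, h3, h4⟩ := hv
  by_cases hp : p + 2 ≤ n
  · have key : ∀ k, k < len n p t → chainL x (ltr n p t) s k =
        (rootFam n m x p (if p + t < n ∨ k + p + 1 < n then k else k + 1)).2
          (∑ j ∈ Finset.range (k + 1), s j) ∧ ∑ j ∈ Finset.range (k + 1), s j ≤
        (rootFam n m x p (if p + t < n ∨ k + p + 1 < n then k else k + 1)).1 * m := by
      intro k
      induction k with
      | zero =>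
        intro hk
        rw [if_pos (by omega)]
        have : ltr n p t 0 = p := by unfold ltr; split_ifs <;> omega
        simp [chainL, rootFam, this, hs]
      | succ k ih =>
        intro hk
        obtain ⟨i1, i2⟩ := ih (by omega)
        have he : Edge n p (if p + t < n ∨ k + p + 1 < n then k else k + 1) (ltr n p t (k + 1))
            (if p + t < n ∨ k + 1 + p + 1 < n then k + 1 else k + 1 + 1) := by
          unfold len at hk; unfold Edge ltr; split_ifs at * <;> omega
        have hE := hx.ext_edge h1 hp he
        rw [chainL, i1, hE.2 _ _ i2 (hs _), hE.1, Finset.sum_range_succ _ (k + 1), Nat.succ_mul]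
        exact ⟨rfl, add_le_add i2 (hs _)⟩
    have hl : 0 < len n p t := by unfold len; split_ifs <;> omega
    have := (key (len n p t - 1) (by omega)).1
    rw [Nat.sub_add_cancel hl] at this
    have e : (if p + t < n ∨ len n p t - 1 + p + 1 < n then len n p t - 1
        else len n p t) = t := by
      unfold len; split_ifs <;> omega
    rw [this, e]
  · obtain rfl : t = 0 := h3 (by omega)
    have : len n p 0 = 1 := by unfold len; rw [if_pos (by omega)]
    have h : ltr n p 0 0 = p := by unfold ltr; rw [if_pos (by omega)]; rfl
    simp [this, chainL, rootFam, h]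

end

section straighten
variable {Q κ : Type} [Ring Q] [LinearOrder κ] (F : κ → Q) (ht : κ → ℕ) (ok : κ → Prop)

/-- the additive span of the products of a given height with fewer than `N` factors. -/
def shortSpan (N H : ℕ) : AddSubgroup Q := AddSubgroup.closure
  {z | ∃ l : List κ, (∀ a ∈ l, ok a) ∧ l.length < N ∧ (l.map ht).sum = H ∧ z = (l.map F).prod}

/-- the additive span of the ordered products of a given height. -/
def sortedSpan (H : ℕ) : AddSubgroup Q := AddSubgroup.closure
  {z | ∃ l : List κ, l.Pairwise (· ≤ ·) ∧ (∀ a ∈ l, ok a) ∧ (l.map ht).sum = H ∧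
    z = (l.map F).prod}

variable {F ht ok}

omit [LinearOrder κ] in
theorem mul_shortSpan {a : κ} (ha : ok a) {N H : ℕ} {z : Q} (hz : z ∈ shortSpan F ht ok N H) :
    F a * z ∈ shortSpan F ht ok (N + 1) (ht a + H) := by
  induction hz using AddSubgroup.closure_induction with
  | mem z hz =>
    obtain ⟨l, h1, h2, h3, rfl⟩ := hz
    refine AddSubgroup.subset_closure ⟨a :: l, ?_, ?_, ?_, ?_⟩
    · simpa using ⟨ha, h1⟩
    · simpa using h2
    · simp [h3]
    · simp
  | zero => rw [mul_zero]; exact zero_mem _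
  | add y z _ _ hy hz => rw [mul_add]; exact add_mem hy hz
  | neg y _ hy => rw [mul_neg]; exact neg_mem hy

omit [LinearOrder κ] in
theorem perm_sub_mem (hb : ∀ a b, ok a → ok b →
      ⁅F a, F b⁆ ∈ AddSubgroup.closure {z | ∃ c, ok c ∧ ht c = ht a + ht b ∧ z = F c})
    {l₁ l₂ : List κ} (hp : l₁.Perm l₂) : (∀ a ∈ l₁, ok a) →
    (l₁.map F).prod - (l₂.map F).prod ∈ shortSpan F ht ok l₁.length (l₁.map ht).sum := by
  induction hp with
  | nil => intro _; simp
  | cons a _ ih =>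
    intro h
    simp only [List.map_cons, List.prod_cons, List.sum_cons, List.length_cons, ← mul_sub]
    exact mul_shortSpan (h a (by simp)) (ih fun b hb => h b (by simp [hb]))
  | swap a b l =>
    intro h
    have h' := hb b a (h b (by simp)) (h a (by simp))
    have e : ((b :: a :: l).map F).prod - ((a :: b :: l).map F).prod =
        ⁅F b, F a⁆ * (l.map F).prod := by
      simp only [List.map_cons, List.prod_cons, Ring.lie_def]; noncomm_ring
    rw [e]
    generalize ⁅F b, F a⁆ = y at h'
    induction h' using AddSubgroup.closure_induction with
    | mem y hy =>
      obtain ⟨c, h1, h2, rfl⟩ := hy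
      refine AddSubgroup.subset_closure ⟨c :: l, ?_, ?_, ?_, ?_⟩
      · intro d hd
        rcases List.mem_cons.1 hd with rfl | hd
        · exact h1
        · exact h d (by simp [hd])
      · simp
      · simp [h2, add_assoc]
      · simp
    | zero => rw [zero_mul]; exact zero_mem _
    | add y z _ _ hy hz => rw [add_mul]; exact add_mem hy hz
    | neg y _ hy => rw [neg_mul]; exact neg_mem hy
  | trans h1 h2 ih1 ih2 =>
    intro h
    have := ih2 fun a ha => h a (h1.mem_iff.2 ha)
    rw [← h1.length_eq, ← (h1.map ht).sum_eq] at this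
    simpa using add_mem (ih1 h) this

theorem prod_mem_sortedSpan (hb : ∀ a b, ok a → ok b →
      ⁅F a, F b⁆ ∈ AddSubgroup.closure {z | ∃ c, ok c ∧ ht c = ht a + ht b ∧ z = F c}) :
    ∀ N, ∀ l : List κ, l.length ≤ N → (∀ a ∈ l, ok a) →
      (l.map F).prod ∈ sortedSpan F ht ok (l.map ht).sum := by
  intro N
  induction N using Nat.strong_induction_on with
  | _ N ih =>
  intro l hl hok
  have hp : l.Perm (l.mergeSort (· ≤ ·)) := (List.mergeSort_perm _ _).symm
  have h1 := perm_sub_mem hb hp hok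
  have h2 : shortSpan F ht ok l.length (l.map ht).sum ≤ sortedSpan F ht ok (l.map ht).sum := by
    refine (AddSubgroup.closure_le _).2 ?_
    rintro _ ⟨l', h1, h2, h3, rfl⟩
    rw [← h3]
    exact ih l'.length (by omega) l' le_rfl h1
  have h3 : ((l.mergeSort (· ≤ ·)).map F).prod ∈ sortedSpan F ht ok (l.map ht).sum := by
    refine AddSubgroup.subset_closure ⟨_, ?_, fun a ha => hok a (hp.mem_iff.2 ha),
      ((hp.map ht).sum_eq).symm, rfl⟩
    have := List.pairwise_mergeSort (le := fun a b : κ => decide (a ≤ b))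
      (by simpa using fun a b c => le_trans) (by simpa using fun a b => le_total a b) l
    simpa using this
  simpa using add_mem (h2 h1) h3

end straighten

/-- the relations of the quantum loop algebra in a window of loop degrees. -/
structure Qrel (n m : ℕ) {U : Type} [Ring U] [Algebra KK U] (y : ℕ → ℕ → U) : Prop where
  junk : ∀ i r, ¬ (1 ≤ i ∧ i ≤ n ∧ r ≤ m) → y i r = 0
  loop : ∀ i j r s, r < m → s < m → y i (r + 1) * y j s - vpow (aD n i j) • (y i r * y j (s + 1)) =
    vpow (aD n i j) • (y j s * y i (r + 1)) - y j (s + 1) * y i r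
  comm : ∀ i j r s, aD n i j = 0 → y i r * y j s = y j s * y i r
  serre : ∀ i j r s t, aD n i j = -1 →
    y i r * y i s * y j t - (vv + vv⁻¹) • (y i r * y j t * y i s) + y j t * y i r * y i s +
    (y i s * y i r * y j t - (vv + vv⁻¹) • (y i s * y j t * y i r) + y j t * y i s * y i r) = 0

section
open Polynomial
variable {U : Type} [Ring U] [Algebra KK U] (y : ℕ → ℕ → U)

/-- the Rees algebra of the lattice spanned by the generators. -/
def rees : Subalgebra locOne U[X] :=
  Algebra.adjoin locOne (Set.range fun p : ℕ × ℕ => monomial 1 (y p.1 p.2))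

/-- the lattice spanned by the generators. -/
def genLat : Submodule locOne U := Submodule.span locOne (Set.range fun p : ℕ × ℕ => y p.1 p.2)

theorem coeff_mem_genLat {f : U[X]} (hf : f ∈ rees y) : ∀ L, f.coeff L ∈ genLat y ^ L := by
  induction hf using Algebra.adjoin_induction with
  | mem f hf =>
    obtain ⟨p, rfl⟩ := hf
    intro L
    simp only [coeff_monomial]
    split_ifs with h
    · subst h
      rw [pow_one]
      exact Submodule.subset_span ⟨p, rfl⟩
    · exact zero_mem _
  | algebraMap c =>
    intro L
    rw [Polynomial.algebraMap_apply, coeff_C]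
    split_ifs with h
    · subst h
      rw [pow_zero]
      exact Submodule.algebraMap_mem c
    · exact zero_mem _
  | add f g _ _ hf hg => intro L; rw [coeff_add]; exact add_mem (hf L) (hg L)
  | mul f g _ _ hf hg =>
    intro L
    rw [coeff_mul]
    refine sum_mem fun ij hij => ?_
    rw [← Finset.HasAntidiagonal.mem_antidiagonal.1 hij, pow_add]
    exact Submodule.mul_mem_mul (hf _) (hg _)

/-- the generators of the Rees algebra. -/
def reesGen (i r : ℕ) : rees y := ⟨monomial 1 (y i r), Algebra.subset_adjoin ⟨(i, r), rfl⟩⟩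

/-- the ideal generated by the uniformizer. -/
def reesIdeal : Ideal (rees y) := Ideal.span {algebraMap locOne (rees y) unif}

theorem mem_reesIdeal {z : rees y} : z ∈ reesIdeal y ↔ ∃ w : rees y, z = unif • w := by
  rw [reesIdeal, Ideal.mem_span_singleton']
  constructor
  · rintro ⟨a, rfl⟩
    exact ⟨a, by rw [Algebra.smul_def, Algebra.commutes]⟩
  · rintro ⟨a, rfl⟩
    exact ⟨a, by rw [Algebra.smul_def, Algebra.commutes]⟩

instance : (reesIdeal y).IsTwoSided := ⟨fun {a} b ha => by
  rw [mem_reesIdeal] at *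
  obtain ⟨w, rfl⟩ := ha
  exact ⟨w * b, by rw [smul_mul_assoc]⟩⟩

/-- the special fibre of the Rees algebra. -/
abbrev ReesQ : Type := rees y ⧸ reesIdeal y

/-- the generators of the special fibre. -/
def reesX (i r : ℕ) : ReesQ y := Ideal.Quotient.mk (reesIdeal y) (reesGen y i r)

variable {y}

theorem mk_eq_zero_of_smul {z w : rees y} {c : locOne} (hc : evHom c = 0) (h : z = c • w) :
    Ideal.Quotient.mk (reesIdeal y) z = 0 := by
  rw [Ideal.Quotient.eq_zero_iff_mem, mem_reesIdeal]
  obtain ⟨d, rfl⟩ := dvd_of_evHom_eq_zero hc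
  exact ⟨d • w, by rw [h, mul_smul]⟩

theorem coe_gen_mul (i r j s : ℕ) :
    ((reesGen y i r * reesGen y j s : rees y) : U[X]) = monomial 2 (y i r * y j s) := by
  show monomial 1 (y i r) * monomial 1 (y j s) = _
  rw [monomial_mul_monomial]

theorem coe_gen_mul_mul (i r j s k t : ℕ) :
    ((reesGen y i r * reesGen y j s * reesGen y k t : rees y) : U[X]) =
      monomial 3 (y i r * y j s * y k t) := by
  show monomial 1 (y i r) * monomial 1 (y j s) * monomial 1 (y k t) = _
  rw [monomial_mul_monomial, monomial_mul_monomial]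

theorem locOne_smul (c : locOne) (u : U) : c • u = (c : KK) • u := rfl

theorem reesQ_two (a : ReesQ y) (h : a + a = 0) : a = 0 := by
  obtain ⟨b, rfl⟩ := Ideal.Quotient.mk_surjective a
  rw [← map_add, Ideal.Quotient.eq_zero_iff_mem] at h
  rw [Ideal.Quotient.eq_zero_iff_mem]
  have h2 : RatFunc.C (1 / 2 : ℚ) ∈ locOne := C_mem_locOne _
  have e : b = algebraMap locOne (rees y) ⟨_, h2⟩ * (b + b) := by
    rw [← two_mul, ← mul_assoc]
    have : algebraMap locOne (rees y) ⟨_, h2⟩ * 2 = 1 := by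
      rw [← map_ofNat (algebraMap locOne (rees y)) 2, ← map_mul, ← map_one (algebraMap locOne (rees y))]
      congr 1
      apply Subtype.ext
      show RatFunc.C (1 / 2 : ℚ) * 2 = 1
      rw [← map_ofNat (RatFunc.C (K := ℚ)) 2, ← map_mul]
      norm_num
    rw [this, one_mul]
  rw [e]
  exact Ideal.mul_mem_left _ _ h

variable {n m : ℕ} (hy : Qrel n m y)
include hy

theorem Qrel.shift (i j r s : ℕ) (hr : r < m) (hs : s < m) :
    ⁅reesX y i (r + 1), reesX y j s⁆ = ⁅reesX y i r, reesX y j (s + 1)⁆ := by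
  rw [← sub_eq_zero]
  simp only [Ring.lie_def, reesX, ← map_mul, ← map_sub]
  refine mk_eq_zero_of_smul (c := ⟨vpow (aD n i j) - 1, sub_mem (vpow_mem _) (one_mem _)⟩)
    (w := reesGen y i r * reesGen y j (s + 1) + reesGen y j s * reesGen y i (r + 1)) ?_ ?_
  · show evOne _ = 0
    rw [evOne_sub (vpow_mem _) (one_mem _), evOne_vpow, evOne_one, sub_self]
  · apply Subtype.ext
    push_cast
    simp only [← Subalgebra.coe_mul, coe_gen_mul]
    simp only [← map_sub, ← map_add, smul_monomial]
    congr 1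
    rw [locOne_smul]
    have := hy.loop i j r s hr hs
    simp only [sub_smul, one_smul, smul_add]
    rw [sub_eq_iff_eq_add] at this
    rw [this]
    abel

theorem Qrel.serreQ (i j r s t : ℕ) (hij : aD n i j = -1) :
    reesX y i r * reesX y i s * reesX y j t - 2 * (reesX y i r * reesX y j t * reesX y i s) +
      reesX y j t * reesX y i r * reesX y i s +
    (reesX y i s * reesX y i r * reesX y j t - 2 * (reesX y i s * reesX y j t * reesX y i r) +
      reesX y j t * reesX y i s * reesX y i r) = 0 := by
  simp only [reesX, two_mul, ← map_mul, ← map_sub, ← map_add]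
  have hv : vv + vv⁻¹ ∈ locOne := add_mem vv_mem (inv_mem_of_evOne (by simp))
  refine mk_eq_zero_of_smul (c := ⟨vv + vv⁻¹ - 2, sub_mem hv (ofNat_mem _ _)⟩)
    (w := reesGen y i r * reesGen y j t * reesGen y i s +
      reesGen y i s * reesGen y j t * reesGen y i r) ?_ ?_
  · show evOne (vv + vv⁻¹ - 2) = 0
    have h2 : (2 : KK) = RatFunc.C 2 := (map_ofNat (RatFunc.C (K := ℚ)) 2).symm
    rw [h2, evOne_sub hv (C_mem_locOne _), evOne_add vv_mem (inv_mem_of_evOne (by simp)), evOne_C,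
      evOne_inv vv_mem (by simp), evOne_vv]
    norm_num
  · apply Subtype.ext
    push_cast
    simp only [← Subalgebra.coe_mul, coe_gen_mul_mul]
    simp only [← map_sub, ← map_add, smul_monomial]
    congr 1
    rw [locOne_smul]
    have := hy.serre i j r s t hij
    rw [← sub_eq_zero, ← this]
    simp only [sub_smul, smul_add, two_smul]
    abel

theorem Qrel.cl : Cl n m (reesX y) := by
  have hself : ∀ i r s, r ≤ m → s ≤ m → ⁅reesX y i r, reesX y i s⁆ = 0 := by
    intro i
    have key : ∀ d r s, r + d ≤ m → s + d ≤ m →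
        ⁅reesX y i (r + d), reesX y i s⁆ = ⁅reesX y i r, reesX y i (s + d)⁆ := by
      intro d
      induction d with
      | zero => intro r s _ _; rfl
      | succ d ih =>
        intro r s hr hs
        rw [← add_assoc, hy.shift i i (r + d) s (by omega) (by omega),
          ih r (s + 1) (by omega) (by omega), add_right_comm, add_assoc s d 1]
    have half : ∀ r s, r ≤ s → s ≤ m → ⁅reesX y i r, reesX y i s⁆ = 0 := by
      intro r s hrs hs
      apply reesQ_two
      have h := key (s - r) r r (by omega) (by omega)
      rw [Nat.add_sub_cancel' hrs] at h
      nth_rewrite 1 [← h]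
      rw [lie_neg' (reesX y i s), neg_add_cancel]
    intro r s hr hs
    rcases le_total r s with h | h
    · exact half r s h hs
    · rw [lie_neg', half s r h hr, neg_zero]
  refine ⟨reesQ_two, fun i j r s hr hs => hy.shift i j r s hr hs, ?_, hself, ?_⟩
  · intro i j r s _ _ hij
    simp only [Ring.lie_def, reesX, ← map_mul, ← map_sub]
    convert map_zero (Ideal.Quotient.mk (reesIdeal y))
    apply Subtype.ext
    push_cast
    simp only [← Subalgebra.coe_mul, coe_gen_mul, hy.comm i j r s hij, sub_self]
  · intro i j r s t hr hs ht hij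
    apply reesQ_two
    have h1 := hy.serreQ i j r s t hij
    have h2 := hself i r s hr hs
    rw [Ring.lie_def, sub_eq_zero] at h2
    rw [← h2, mul_assoc (reesX y j t) (reesX y i s), ← h2] at h1
    rw [← h1]
    simp only [Ring.lie_def, sub_mul, mul_sub, two_mul, mul_assoc]
    rw [← mul_assoc (reesX y i s) (reesX y i r), ← h2, mul_assoc]
    abel

end

section
open Polynomial
variable {U : Type} [Ring U] [Algebra KK U] {y : ℕ → ℕ → U}

theorem coe_chainL (c s : ℕ → ℕ) (k : ℕ) :
    ((chainL (reesGen y) c s k : rees y) : U[X]) = monomial (k + 1) (chainL y c s k) := by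
  induction k with
  | zero => rfl
  | succ k ih =>
    rw [chainL, chainL, Ring.lie_def, Ring.lie_def, map_sub, ← monomial_mul_monomial, ← ih,
      add_comm (k + 1) 1, ← monomial_mul_monomial, ← ih]
    rfl

theorem mk_chainL (c s : ℕ → ℕ) (k : ℕ) :
    Ideal.Quotient.mk (reesIdeal y) (chainL (reesGen y) c s k) = chainL (reesX y) c s k := by
  induction k with
  | zero => rfl
  | succ k ih =>
    simp only [chainL, Ring.lie_def, map_sub, map_mul, ih]
    rfl

theorem coe_gen_prod (w : List (ℕ × ℕ)) :
    (((w.map fun p => reesGen y p.1 p.2).prod : rees y) : U[X]) =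
      monomial w.length (w.map fun p => y p.1 p.2).prod := by
  induction w with
  | nil => rfl
  | cons p w ih =>
    rw [List.map_cons, List.prod_cons, List.map_cons, List.prod_cons, List.length_cons,
      add_comm, ← monomial_mul_monomial, ← ih]
    rfl

variable {κ : Type} [LinearOrder κ] (F : κ → U) (ht : κ → ℕ) (ok : κ → Prop)

/-- products of a given height over sorted lists of keys. -/
def sortedSet (L : ℕ) : Set U := {z | ∃ l : List κ, l.Pairwise (· ≤ ·) ∧ (∀ a ∈ l, ok a) ∧
  (l.map ht).sum = L ∧ z = (l.map F).prod}

variable {F ht ok}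

theorem coe_sortedSpan {G : κ → rees y}
    (hG : ∀ k, ok k → (G k : U[X]) = monomial (ht k) (F k)) {L : ℕ} {z : rees y}
    (hz : z ∈ sortedSpan G ht ok L) :
    ∃ u ∈ Submodule.span locOne (sortedSet F ht ok L), (z : U[X]) = monomial L u := by
  induction hz using AddSubgroup.closure_induction with
  | mem z h =>
    obtain ⟨l, h1, h2, h3, rfl⟩ := h
    refine ⟨_, Submodule.subset_span ⟨l, h1, h2, h3, rfl⟩, ?_⟩
    rw [← h3]
    clear h1 h3
    induction l with
    | nil => rfl
    | cons a l ih =>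
      simp only [List.map_cons, List.prod_cons, List.sum_cons]
      rw [← monomial_mul_monomial, ← hG a (h2 a (by simp)),
        ← ih fun b hb => h2 b (List.mem_cons_of_mem _ hb)]
      rfl
  | zero => exact ⟨0, zero_mem _, by simp⟩
  | add a b _ _ ha hb =>
    obtain ⟨u, hu, e⟩ := ha
    obtain ⟨v, hv, f⟩ := hb
    exact ⟨u + v, add_mem hu hv, by rw [map_add, ← e, ← f]; rfl⟩
  | neg a _ ha =>
    obtain ⟨u, hu, e⟩ := ha
    exact ⟨-u, neg_mem hu, by rw [map_neg, ← e]; rfl⟩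

theorem sortedSpan_map {R S : Type} [Ring R] [Ring S] (f : R →+* S) (G : κ → R) (L : ℕ) {z : S}
    (hz : z ∈ sortedSpan (fun k => f (G k)) ht ok L) :
    ∃ w ∈ sortedSpan G ht ok L, f w = z := by
  induction hz using AddSubgroup.closure_induction with
  | mem z h =>
    obtain ⟨l, h1, h2, h3, rfl⟩ := h
    refine ⟨_, AddSubgroup.subset_closure ⟨l, h1, h2, h3, rfl⟩, ?_⟩
    rw [map_list_prod, List.map_map]
    rfl
  | zero => exact ⟨0, zero_mem _, map_zero f⟩
  | add a b _ _ ha hb =>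
    obtain ⟨u, hu, rfl⟩ := ha
    obtain ⟨v, hv, rfl⟩ := hb
    exact ⟨u + v, add_mem hu hv, map_add f u v⟩
  | neg a _ ha =>
    obtain ⟨u, hu, rfl⟩ := ha
    exact ⟨-u, neg_mem hu, map_neg f u⟩

theorem sortedSpan_congr {R : Type} [Ring R] {G G' : κ → R} (h : ∀ k, ok k → G k = G' k) (L : ℕ) :
    sortedSpan G ht ok L = sortedSpan G' ht ok L := by
  unfold sortedSpan
  congr 1
  ext z
  constructor
  · rintro ⟨l, h1, h2, h3, rfl⟩
    exact ⟨l, h1, h2, h3, by rw [List.map_congr_left fun a ha => h a (h2 a ha)]⟩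
  · rintro ⟨l, h1, h2, h3, rfl⟩
    exact ⟨l, h1, h2, h3, by rw [List.map_congr_left fun a ha => h a (h2 a ha)]⟩

variable {n m : ℕ}

theorem rees_word_mem (hn : 4 ≤ n) (hy : Qrel n m y) (p t S : κ → ℕ) (σ : κ → ℕ → ℕ)
    (hok : ∀ k, ok k → ValidRoot n (p k) (t k) ∧ S k ≤ len n (p k) (t k) * m)
    (hex : ∀ a b c, ValidRoot n a b → c ≤ len n a b * m → ∃ k, ok k ∧ p k = a ∧ t k = b ∧ S k = c)
    (hσ : ∀ k, ok k → ∀ j, σ k j ≤ m)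
    (hsum : ∀ k, ok k → ∑ j ∈ Finset.range (len n (p k) (t k)), σ k j = S k)
    (w : List (ℕ × ℕ)) : (w.map fun q => reesX y q.1 q.2).prod ∈
      sortedSpan (fun k => Ideal.Quotient.mk (reesIdeal y)
        (chainL (reesGen y) (ltr n (p k) (t k)) (σ k) (len n (p k) (t k) - 1)))
        (fun k => len n (p k) (t k)) ok w.length := by
  have hx := hy.cl
  rw [sortedSpan_congr (G' := fun k => (rootFam n m (reesX y) (p k) (t k)).2 (S k)) fun k hk => by
    rw [mk_chainL, hx.chainL_eq (hok k hk).1 (σ k) (hσ k hk), hsum k hk]]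
  by_cases hw : ∀ q ∈ w, 1 ≤ q.1 ∧ q.1 ≤ n ∧ q.2 ≤ m
  · have hl : ∃ l : List κ, (∀ a ∈ l, ok a) ∧
        (l.map fun k => len n (p k) (t k)).sum = w.length ∧
        l.map (fun k => (rootFam n m (reesX y) (p k) (t k)).2 (S k)) =
          w.map fun q => reesX y q.1 q.2 := by
      induction w with
      | nil => exact ⟨[], by simp, rfl, rfl⟩
      | cons q w ih =>
        obtain ⟨l, h1, h2, h3⟩ := ih fun q hq => hw q (List.mem_cons_of_mem _ hq)
        obtain ⟨g1, g2, g3⟩ := hw q (by simp)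
        have hv : ValidRoot n q.1 0 := ⟨g1, g2, fun _ => rfl, Or.inl rfl⟩
        have hlen : len n q.1 0 = 1 := by unfold len; split_ifs <;> omega
        obtain ⟨k, k1, k2, k3, k4⟩ := hex q.1 0 q.2 hv (by rw [hlen]; omega)
        refine ⟨k :: l, by simpa using ⟨k1, h1⟩, ?_, ?_⟩
        · simp only [List.map_cons, List.sum_cons, List.length_cons, h2, k2, k3, hlen]
          omega
        · simp only [List.map_cons, h3, k2, k3, k4]
          rfl
    obtain ⟨l, h1, h2, h3⟩ := hl
    rw [← h2, ← h3]
    refine prod_mem_sortedSpan (fun a b ha hb => ?_) l.length l le_rfl h1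
    obtain ⟨a1, a2⟩ := hok a ha
    obtain ⟨b1, b2⟩ := hok b hb
    have h := hx.lie_mem hn b1 (len n (p a) (t a)) ((rootFam n m (reesX y) (p a) (t a)).2 (S a))
      (AddSubgroup.subset_closure ⟨p a, t a, S a, a1, rootFam_fst a1, a2, rfl⟩) (S b)
      (by rwa [rootFam_fst b1])
    rw [rootFam_fst b1] at h
    refine (AddSubgroup.closure_le _).2 ?_ h
    rintro _ ⟨p', t', S', h1, h2, h3, rfl⟩
    rw [rootFam_fst h1] at h2
    obtain ⟨k, k1, rfl, rfl, rfl⟩ := hex p' t' S' h1 (by rwa [h2])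
    exact AddSubgroup.subset_closure ⟨k, k1, h2, rfl⟩
  · push Not at hw
    obtain ⟨q, hq, h⟩ := hw
    have h0 : reesX y q.1 q.2 = 0 := by
      have : reesGen y q.1 q.2 = 0 := by
        apply Subtype.ext
        show monomial 1 (y q.1 q.2) = 0
        rw [hy.junk q.1 q.2 (by intro h'; have := h h'.1 h'.2.1; omega), map_zero]
      rw [reesX, this, map_zero]
    rw [List.prod_eq_zero (List.mem_map.2 ⟨q, hq, h0⟩)]
    exact zero_mem _

theorem genLat_pow_eq (L : ℕ) : genLat y ^ L = Submodule.span locOne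
    {z | ∃ w : List (ℕ × ℕ), w.length = L ∧ z = (w.map fun q => y q.1 q.2).prod} := by
  rw [genLat, Submodule.span_pow]
  congr 1
  ext z
  rw [Set.mem_pow]
  constructor
  · rintro ⟨f, rfl⟩
    choose q hq using fun i => (f i).2
    refine ⟨List.ofFn q, by simp, ?_⟩
    rw [List.map_ofFn]
    congr 2
    ext i
    exact (hq i).symm
  · rintro ⟨w, rfl, rfl⟩
    refine ⟨fun i => ⟨y (w.get i).1 (w.get i).2, ⟨w.get i, rfl⟩⟩, ?_⟩
    congr 1
    conv_rhs => rw [← List.ofFn_get w, List.map_ofFn]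
    rfl

theorem genLat_fg (hy : Qrel n m y) (L : ℕ) : (genLat y ^ L).FG := by
  refine Submodule.FG.pow ?_ L
  refine Submodule.fg_span ?_
  refine Set.Finite.subset (Set.Finite.union
    (((Set.finite_Iic (n, m))).image fun q : ℕ × ℕ => y q.1 q.2) (Set.finite_singleton 0)) ?_
  rintro _ ⟨q, rfl⟩
  by_cases h : 1 ≤ q.1 ∧ q.1 ≤ n ∧ q.2 ≤ m
  · exact Or.inl ⟨q, ⟨h.2.1, h.2.2⟩, rfl⟩
  · exact Or.inr (hy.junk _ _ h)

theorem Qrel.word_mem (hn : 4 ≤ n) (hy : Qrel n m y) (p t S : κ → ℕ) (σ : κ → ℕ → ℕ)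
    (hok : ∀ k, ok k → ValidRoot n (p k) (t k) ∧ S k ≤ len n (p k) (t k) * m)
    (hex : ∀ a b c, ValidRoot n a b → c ≤ len n a b * m → ∃ k, ok k ∧ p k = a ∧ t k = b ∧ S k = c)
    (hσ : ∀ k, ok k → ∀ j, σ k j ≤ m)
    (hsum : ∀ k, ok k → ∑ j ∈ Finset.range (len n (p k) (t k)), σ k j = S k)
    (w : List (ℕ × ℕ)) : (w.map fun q => y q.1 q.2).prod ∈ Submodule.span KK
      (sortedSet (fun k => chainL y (ltr n (p k) (t k)) (σ k) (len n (p k) (t k) - 1))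
        (fun k => len n (p k) (t k)) ok w.length) := by
  set F := fun k => chainL y (ltr n (p k) (t k)) (σ k) (len n (p k) (t k) - 1) with hF
  set ht := fun k => len n (p k) (t k) with hht
  have main : ∀ L, genLat y ^ L ≤ Submodule.span locOne (sortedSet F ht ok L) := by
    intro L
    refine Submodule.le_of_le_smul_of_le_jacobson_bot (genLat_fg hy L) unif_mem_jacobson ?_
    conv_lhs => rw [genLat_pow_eq]
    refine Submodule.span_le.2 ?_
    rintro _ ⟨w, rfl, rfl⟩
    obtain ⟨b, hb, e⟩ := sortedSpan_map _ _ _ (rees_word_mem hn hy p t S σ hok hex hσ hsum w)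
    have hG : ∀ k, ok k → ((chainL (reesGen y) (ltr n (p k) (t k)) (σ k) (len n (p k) (t k) - 1)
        : rees y) : U[X]) = monomial (ht k) (F k) := by
      intro k hk
      rw [coe_chainL]
      have : len n (p k) (t k) - 1 + 1 = ht k := by
        have := len_pos hn (hok k hk).1
        simp only [hht]; omega
      rw [this]
    obtain ⟨u, hu, hbu⟩ := coe_sortedSpan hG hb
    have hw : (w.map fun q => reesX y q.1 q.2).prod = Ideal.Quotient.mk (reesIdeal y)
        (w.map fun q => reesGen y q.1 q.2).prod := by
      rw [map_list_prod, List.map_map]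
      rfl
    rw [hw, eq_comm, ← sub_eq_zero, ← map_sub, Ideal.Quotient.eq_zero_iff_mem, mem_reesIdeal] at e
    obtain ⟨c, hc⟩ := e
    have h1 := congrArg (fun z : rees y => (z : U[X]).coeff w.length) hc
    have h2 : (w.map fun q => y q.1 q.2).prod - u = unif • (c : U[X]).coeff w.length := by
      rw [← coeff_smul]
      refine Eq.trans ?_ h1
      show _ = ((_ : U[X]) - (b : U[X])).coeff w.length
      rw [coe_gen_prod, hbu, coeff_sub, coeff_monomial_same, coeff_monomial_same]
    rw [sub_eq_iff_eq_add'] at h2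
    rw [h2]
    refine add_mem (Submodule.mem_sup_left hu) (Submodule.mem_sup_right ?_)
    exact Submodule.smul_mem_smul (Ideal.mem_span_singleton_self _) (coeff_mem_genLat y c.2 _)
  have h := main w.length (by
    rw [genLat_pow_eq]
    exact Submodule.subset_span ⟨w, rfl, rfl⟩)
  exact Submodule.span_subset_span locOne KK _ h

end

section
variable {n : ℕ}

theorem genD_of_not {i : ℕ} (h : ¬ (1 ≤ i ∧ i ≤ n)) (r : ℤ) : genD n i r = 0 := by
  rw [genD, g1, dif_neg h]

theorem genD_succ (i : Fin n) (r : ℤ) :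
    genD n (i.1 + 1) r = RingQuot.mkAlgHom KK (URel n (aD n) (dD n)) (fg n i r) := by
  rw [genD, g1, dif_pos ⟨by omega, i.2⟩, ug]
  rfl

theorem genD_loop (i j : ℕ) (r s : ℤ) :
    genD n i (r + 1) * genD n j s - vpow (aD n i j) • (genD n i r * genD n j (s + 1)) =
      vpow (aD n i j) • (genD n j s * genD n i (r + 1)) - genD n j (s + 1) * genD n i r := by
  by_cases hi : 1 ≤ i ∧ i ≤ n
  · by_cases hj : 1 ≤ j ∧ j ≤ n
    · obtain ⟨i, rfl⟩ : ∃ k : Fin n, i = k.1 + 1 := ⟨⟨i - 1, by omega⟩, by simp; omega⟩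
      obtain ⟨j, rfl⟩ : ∃ k : Fin n, j = k.1 + 1 := ⟨⟨j - 1, by omega⟩, by simp; omega⟩
      have := RingQuot.mkAlgHom_rel KK (URel.loop (n := n) (A := aD n) (Dd := dD n) i j r s)
      simp only [map_sub, map_smul, map_mul, dD, Nat.cast_one, one_mul] at this
      simpa only [genD_succ] using this
    · simp [genD_of_not hj]
  · simp [genD_of_not hi]

theorem serreElt_eq_zero (i j : Fin n) (hij : i ≠ j) (m : ℕ)
    (hm : m = (1 - aD n (i.1 + 1) (j.1 + 1)).toNat) (r : Fin m → ℤ) (t : ℤ) :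
    RingQuot.mkAlgHom KK (URel n (aD n) (dD n)) (serreElt n (dD n) i j m r t) = 0 := by
  subst hm
  rw [RingQuot.mkAlgHom_rel KK (URel.serre (n := n) (A := aD n) (Dd := dD n) i j hij r t), map_zero]

theorem genD_comm (i j : ℕ) (hij : aD n i j = 0) (r s : ℤ) :
    genD n i r * genD n j s = genD n j s * genD n i r := by
  by_cases hi : 1 ≤ i ∧ i ≤ n
  · by_cases hj : 1 ≤ j ∧ j ≤ n
    · obtain ⟨i, rfl⟩ : ∃ k : Fin n, i = k.1 + 1 := ⟨⟨i - 1, by omega⟩, by simp; omega⟩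
      obtain ⟨j, rfl⟩ : ∃ k : Fin n, j = k.1 + 1 := ⟨⟨j - 1, by omega⟩, by simp; omega⟩
      have hne : i ≠ j := by rintro rfl; simp [aD] at hij
      have := serreElt_eq_zero i j hne 1 (by rw [hij]; rfl) (fun _ => r) s
      rw [serreElt_one, map_sub, map_mul, map_mul, sub_eq_zero] at this
      simpa only [genD_succ] using this.symm
    · simp [genD_of_not hj]
  · simp [genD_of_not hi]

theorem genD_serre (i j : ℕ) (hij : aD n i j = -1) (r s t : ℤ) :
    genD n i r * genD n i s * genD n j t - (vv + vv⁻¹) • (genD n i r * genD n j t * genD n i s) +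
      genD n j t * genD n i r * genD n i s +
    (genD n i s * genD n i r * genD n j t - (vv + vv⁻¹) • (genD n i s * genD n j t * genD n i r) +
      genD n j t * genD n i s * genD n i r) = 0 := by
  by_cases hi : 1 ≤ i ∧ i ≤ n
  · by_cases hj : 1 ≤ j ∧ j ≤ n
    · obtain ⟨i, rfl⟩ : ∃ k : Fin n, i = k.1 + 1 := ⟨⟨i - 1, by omega⟩, by simp; omega⟩
      obtain ⟨j, rfl⟩ : ∃ k : Fin n, j = k.1 + 1 := ⟨⟨j - 1, by omega⟩, by simp; omega⟩
      have hne : i ≠ j := by rintro rfl; simp [aD] at hij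
      have := serreElt_eq_zero i j hne 2 (by rw [hij]; rfl) ![r, s] t
      rw [serreElt_two] at this
      simp only [map_add, map_sub, map_smul, map_mul] at this
      simp only [genD_succ]
      exact this
    · simp [genD_of_not hj]
  · simp [genD_of_not hi]

/-- the generators in a window of loop degrees. -/
def winGen (n : ℕ) (a : ℤ) (m i r : ℕ) : UD n := if r ≤ m then genD n i (a + r) else 0

theorem qrel_winGen (a : ℤ) (m : ℕ) : Qrel n m (winGen n a m) := by
  constructor
  · intro i r h
    unfold winGen
    split_ifs with hr
    · exact genD_of_not (by tauto) _
    · rfl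
  · intro i j r s hr hs
    have := genD_loop (n := n) i j (a + r) (a + s)
    simp only [winGen, if_pos hr.le, if_pos hs.le, if_pos (Nat.succ_le_of_lt hr),
      if_pos (Nat.succ_le_of_lt hs)]
    push_cast
    simpa only [add_assoc] using this
  · intro i j r s h
    unfold winGen
    split_ifs <;> simp [genD_comm i j h]
  · intro i j r s t h
    have := genD_serre i j h (a + r) (a + s) (a + t)
    unfold winGen
    split_ifs
    all_goals first | exact this | simp

/-- the balanced decomposition of an integer as a sum. -/
def balDec (l : ℕ) (s : ℤ) (k : ℕ) : ℤ := s / l + if (k : ℤ) < s % l then 1 else 0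

theorem sum_balDec {l : ℕ} (hl : 0 < l) (s : ℤ) : ∑ k ∈ Finset.range l, balDec l s k = s := by
  have h0 : 0 ≤ s % l := Int.emod_nonneg _ (by omega)
  have h1 : s % l < l := Int.emod_lt_of_pos _ (by omega)
  obtain ⟨r, hr⟩ := Int.eq_ofNat_of_zero_le h0
  simp only [balDec, Finset.sum_add_distrib, Finset.sum_const, Finset.card_range, hr]
  have : ∑ k ∈ Finset.range l, (if (k : ℤ) < (r : ℤ) then (1 : ℤ) else 0) = r := by
    rw [Finset.sum_boole]
    have : (Finset.range l).filter (fun k : ℕ => (k : ℤ) < (r : ℤ)) = Finset.range r := by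
      ext k
      simp only [Finset.mem_filter, Finset.mem_range]
      omega
    rw [this, Finset.card_range]
  rw [this, nsmul_eq_mul, ← hr]
  exact Int.mul_ediv_add_emod s l

theorem balDec_mem {l : ℕ} (hl : 0 < l) {a s : ℤ} {m : ℕ} (h1 : a * l ≤ s)
    (h2 : s ≤ (a + m) * l) (k : ℕ) : a ≤ balDec l s k ∧ balDec l s k ≤ a + m := by
  have hl' : (0 : ℤ) < l := by omega
  have e1 : a ≤ s / l := (Int.le_ediv_iff_mul_le hl').2 h1
  unfold balDec
  split_ifs with h
  · refine ⟨by omega, ?_⟩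
    have : s / l < a + m := by
      rw [Int.ediv_lt_iff_lt_mul hl']
      refine lt_of_le_of_ne h2 ?_
      rintro rfl
      rw [Int.mul_emod_left] at h
      omega
    omega
  · refine ⟨by omega, ?_⟩
    rw [add_zero]
    have := Int.ediv_le_ediv hl' h2
    rwa [Int.mul_ediv_cancel _ hl'.ne'] at this

/-- the height of a root. -/
def htR (β : PosRootD n) : ℕ := len n (riD β) (rtD β)

/-- a standard choice of root vectors. -/
def stdE (p : PosRootD n × ℤ) : UD n :=
  chainF (genD n) (ltr n (riD p.1) (rtD p.1)) (balDec (htR p.1) p.2) (fun _ => 1) (htR p.1 - 1)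

theorem htR_pos (hn : 4 ≤ n) (β : PosRootD n) : 0 < htR β := len_pos hn (validRoot β)

theorem isRVD_stdE (hn : 4 ≤ n) (p : PosRootD n × ℤ) : IsRVD p.1 p.2 (stdE p) := by
  have := isRVD_chainF hn p.1 (balDec (htR p.1) p.2)
  rwa [← htR, sum_balDec (htR_pos hn p.1)] at this

theorem chainL_winGen {a : ℤ} {m : ℕ} (c : ℕ → ℕ) (s : ℕ → ℤ) (hs : ∀ k, a ≤ s k ∧ s k ≤ a + m)
    (k : ℕ) : chainL (winGen n a m) c (fun k => (s k - a).toNat) k =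
      chainF (genD n) c s (fun _ => 1) k := by
  have h : ∀ i k, winGen n a m i (s k - a).toNat = genD n i (s k) := by
    intro i k
    have := hs k
    rw [winGen, if_pos (by omega)]
    congr 1
    omega
  induction k with
  | zero => exact h _ _
  | succ k ih => rw [chainL, chainF, ih, h, one_smul, Ring.lie_def]

theorem exists_root {i t : ℕ} (h : ValidRoot n i t) : ∃ β : PosRootD n, riD β = i ∧ rtD β = t := by
  have hb : i < n + 1 ∧ t < 2 * n + 1 := by unfold ValidRoot at h; omega
  refine ⟨⟨toLex (⟨i, hb.1⟩, ⟨t, hb.2⟩), ?_⟩, rfl, rfl⟩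
  obtain ⟨h1, h2, h3, h4⟩ := h
  exact ⟨h1, h3, h4⟩

/-- the exponent with a given sorted list of keys. -/
theorem exists_lst (l : List (Lex (PosRootD n × ℤ))) (hl : l.Pairwise (· ≤ ·)) :
    ∃ h : HH n, lst h = l.reverse.map ofLex := by
  refine ⟨Multiset.toFinsupp (l : Multiset _), ?_⟩
  rw [lst, Multiset.toFinsupp_toMultiset]
  congr 1
  refine List.Perm.eq_of_pairwise (le := (· ≥ ·)) (fun a b _ _ h1 h2 => le_antisymm h2 h1)
    (Multiset.pairwise_sort _ _) (List.pairwise_reverse.2 hl) ?_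
  rw [← Multiset.coe_eq_coe, Multiset.sort_eq, Multiset.coe_reverse]

/-- monomials in the standard root vectors of a given height. -/
theorem word_mem_span (hn : 4 ≤ n) (w : List (ℕ × ℤ)) :
    (w.map fun q => genD n q.1 q.2).prod ∈ Submodule.span KK
      ((fun h : HH n => mon stdE (lst h)) ''
        {h | ((lst h).map fun p => htR p.1).sum = w.length}) := by
  obtain ⟨a, m, ham⟩ : ∃ (a : ℤ) (m : ℕ), ∀ q ∈ w, a ≤ q.2 ∧ q.2 ≤ a + m := by
    induction w with
    | nil => exact ⟨0, 0, by simp⟩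
    | cons q w ih =>
      obtain ⟨a, m, h⟩ := ih
      refine ⟨min a q.2, (max (a + m) q.2 - min a q.2).toNat, fun p hp => ?_⟩
      rcases List.mem_cons.1 hp with rfl | hp
      · omega
      · have := h p hp
        omega
  have key := Qrel.word_mem (κ := Lex (PosRootD n × ℤ))
    (ok := fun k => a * htR (ofLex k).1 ≤ (ofLex k).2 ∧ (ofLex k).2 ≤ (a + m) * htR (ofLex k).1)
    hn (qrel_winGen a m) (fun k => riD (ofLex k).1) (fun k => rtD (ofLex k).1)
    (fun k => ((ofLex k).2 - a * htR (ofLex k).1).toNat)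
    (fun k j => (balDec (htR (ofLex k).1) (ofLex k).2 j - a).toNat)
    (fun k hk => ⟨validRoot _, by
      rw [← htR, ← Nat.cast_le (α := ℤ), Nat.cast_mul, Int.toNat_of_nonneg (by linarith [hk.1])]
      linarith [hk.2]⟩)
    (fun i t S hv hS => by
      obtain ⟨β, rfl, rfl⟩ := exists_root hv
      refine ⟨toLex (β, a * htR β + S), ⟨?_, ?_⟩, rfl, rfl, ?_⟩
      · simp
      · have : (S : ℤ) ≤ htR β * m := by exact_mod_cast hS
        simp only [ofLex_toLex]
        linarith
      · simp)
    (fun k hk j => by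
      have := balDec_mem (htR_pos hn _) hk.1 hk.2 j
      omega)
    (fun k hk => by
      rw [← htR]
      zify
      rw [Int.toNat_of_nonneg (by linarith [hk.1])]
      have : ∀ j, (((balDec (htR (ofLex k).1) (ofLex k).2 j - a).toNat : ℕ) : ℤ) =
          balDec (htR (ofLex k).1) (ofLex k).2 j - a := fun j => by
        have := balDec_mem (htR_pos hn _) hk.1 hk.2 j
        omega
      simp only [this, Finset.sum_sub_distrib, sum_balDec (htR_pos hn _), Finset.sum_const,
        Finset.card_range, nsmul_eq_mul]
      ring)
    (w.map fun q => (q.1, (q.2 - a).toNat))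
  have e : ((w.map fun q => (q.1, (q.2 - a).toNat)).map fun q => winGen n a m q.1 q.2) =
      w.map fun q => genD n q.1 q.2 := by
    rw [List.map_map]
    refine List.map_congr_left fun q hq => ?_
    have := ham q hq
    simp only [Function.comp, winGen]
    rw [if_pos (by omega)]
    congr 1
    omega
  rw [e, List.length_map] at key
  refine Submodule.span_mono ?_ key
  rintro _ ⟨l, h1, h2, h3, rfl⟩
  obtain ⟨h, hh⟩ := exists_lst l h1
  refine ⟨h, ?_, ?_⟩
  · show ((lst h).map fun p => htR p.1).sum = w.length
    rw [hh, List.map_map, List.map_reverse, List.sum_reverse, ← h3]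
    rfl
  · show mon stdE (lst h) = _
    rw [mon, hh, ← List.map_reverse, List.reverse_reverse, List.map_map]
    congr 1
    refine List.map_congr_left fun k hk => ?_
    obtain ⟨k1, k2⟩ := h2 k hk
    exact (chainL_winGen _ _ (fun j => balDec_mem (htR_pos hn _) k1 k2 j) _).symm

end

section
variable {n : ℕ}

variable (n) in
/-- the span of the generators. -/
def genSpan : Submodule KK (UD n) := Submodule.span KK (Set.range fun q : ℕ × ℤ => genD n q.1 q.2)

theorem genD_mem_genSpan (i : ℕ) (r : ℤ) : genD n i r ∈ genSpan n := Submodule.subset_span ⟨(i, r), rfl⟩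

theorem genSpan_pow_le (hn : 4 ≤ n) (L : ℕ) : genSpan n ^ L ≤ Submodule.span KK
      ((fun h : HH n => mon stdE (lst h)) '' {h | ((lst h).map fun p => htR p.1).sum = L}) := by
  rw [genSpan, Submodule.span_pow]
  refine Submodule.span_le.2 ?_
  intro z hz
  obtain ⟨f, rfl⟩ := Set.mem_pow.1 hz
  choose q hq using fun i => (f i).2
  have h := word_mem_span hn (List.ofFn q)
  rw [List.length_ofFn, List.map_ofFn] at h
  have e : (fun i => ((f i : Set.range fun q : ℕ × ℤ => genD n q.1 q.2) : UD n)) =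
      (fun q : ℕ × ℤ => genD n q.1 q.2) ∘ q := funext fun i => (hq i).symm
  rw [e]
  exact h

theorem chainF_mem (c : ℕ → ℕ) (s : ℕ → ℤ) (l : ℕ → KK) (k : ℕ) :
    chainF (genD n) c s l k ∈ genSpan n ^ (k + 1) := by
  induction k with
  | zero => rw [zero_add, pow_one]; exact genD_mem_genSpan _ _
  | succ k ih =>
    rw [chainF]
    refine sub_mem ?_ (Submodule.smul_mem _ _ ?_)
    · rw [pow_succ]
      exact Submodule.mul_mem_mul ih (genD_mem_genSpan _ _)
    · rw [pow_succ']
      exact Submodule.mul_mem_mul (genD_mem_genSpan _ _) ih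

theorem mon_mem (hn : 4 ≤ n) {E : PosRootD n × ℤ → UD n} (hE : ∀ p, IsRVD p.1 p.2 (E p))
    (l : List (PosRootD n × ℤ)) : mon E l ∈ genSpan n ^ (l.map fun p => htR p.1).sum := by
  induction l with
  | nil => simpa [mon] using ⟨1, map_one _⟩
  | cons p l ih =>
    rw [mon_cons, List.map_cons, List.sum_cons, add_comm, pow_add]
    refine Submodule.mul_mem_mul ih ?_
    obtain ⟨ss, ll, _, _, e⟩ := (hE p).exists_chainF hn
    rw [e]
    have := chainF_mem (n := n) (ltr n (riD p.1) (rtD p.1)) ss ll (htR p.1 - 1)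
    rwa [Nat.sub_add_cancel (htR_pos hn p.1)] at this

theorem length_le_sum_htR (hn : 4 ≤ n) (l : List (PosRootD n × ℤ)) :
    l.length ≤ (l.map fun p => htR p.1).sum := by
  induction l with
  | nil => simp
  | cons p l ih =>
    have := htR_pos hn p.1
    simp only [List.length_cons, List.map_cons, List.sum_cons]
    omega

theorem std_mem_span (hn : 4 ≤ n) {E : PosRootD n × ℤ → UD n} (hE : ∀ p, IsRVD p.1 p.2 (E p))
    (L : ℕ) (h : HH n) (hh : ((lst h).map fun p => htR p.1).sum = L) :
    mon stdE (lst h) ∈ Submodule.span KK (Set.range fun h : HH n => mon E (lst h)) := by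
  set T := Submodule.span KK (Set.range fun h : HH n => mon E (lst h)) with hT
  have hfin : {d : List (PosRootD n) | d.length ≤ L}.Finite := List.finite_length_le _ _
  have hwf : {d : List (PosRootD n) | d.length ≤ L}.WellFoundedOn (· > ·) :=
    hfin.wellFoundedOn
  have hlen : ∀ h : HH n, ((lst h).map fun p => htR p.1).sum = L →
      typ (lst h) ∈ {d : List (PosRootD n) | d.length ≤ L} := fun h hh => by
    have := length_le_sum_htR hn (lst h)
    simp only [Set.mem_ofPred_eq, List.length_map]
    omega
  obtain ⟨κ, hκ, H1⟩ := exists_kappa hn (isRVD_stdE hn)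
  obtain ⟨κ', hκ', H2⟩ := exists_kappa hn hE
  suffices key : ∀ d ∈ {d : List (PosRootD n) | d.length ≤ L}, ∀ h : HH n, typ (lst h) = d →
      ((lst h).map fun p => htR p.1).sum = L → mon stdE (lst h) ∈ T from
    key _ (hlen h hh) h rfl hh
  intro d hd
  refine hwf.induction (P := fun d => ∀ h : HH n, typ (lst h) = d →
      ((lst h).map fun p => htR p.1).sum = L → mon stdE (lst h) ∈ T) hd ?_
  clear d hd h hh
  rintro d hd ih h rfl hh
  set a : KK := κ (lst h) / κ' (lst h) with ha
  have hy : mon stdE (lst h) - a • mon E (lst h) ∈ genSpan n ^ L := by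
    refine sub_mem ?_ (Submodule.smul_mem _ _ ?_)
    · rw [← hh]; exact mon_mem hn (isRVD_stdE hn) _
    · rw [← hh]; exact mon_mem hn hE _
  obtain ⟨c, hc, e⟩ := (Finsupp.mem_span_image_iff_linearCombination KK).1
    (genSpan_pow_le hn L hy)
  rw [Finsupp.linearCombination_apply] at e
  have hlt := lt_typ_of_phi_eq_zero hn (isRVD_stdE hn) c (typ (lst h)) (by
    intro d' hd' w hw hw0 hs
    rw [e, map_sub, map_smul, H1 d' hs w hw hw0 _ hd', H2 d' hs w hw hw0 _ hd', smul_eq_mul,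
      ← mul_assoc, ha, div_mul_cancel₀ _ (hκ' _), sub_self])
  have hyT : mon stdE (lst h) - a • mon E (lst h) ∈ T := by
    rw [← e]
    refine Submodule.sum_mem _ fun g hg => Submodule.smul_mem _ _ ?_
    have hgL := (Finsupp.mem_supported _ _).1 hc hg
    exact ih _ (hlen g hgL) (hlt g hg) g rfl hgL
  rw [← sub_add_cancel (mon stdE (lst h)) (a • mon E (lst h))]
  exact add_mem hyT (Submodule.smul_mem _ _ (Submodule.subset_span ⟨h, rfl⟩))

theorem adjoin_genD : Algebra.adjoin KK (Set.range fun q : ℕ × ℤ => genD n q.1 q.2) = ⊤ := by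
  refine top_le_iff.1 ?_
  have h1 : (⊤ : Subalgebra KK (UD n)) =
      (⊤ : Subalgebra KK (FA n)).map (RingQuot.mkAlgHom KK (URel n (aD n) (dD n))) := by
    rw [Algebra.map_top, (AlgHom.range_eq_top _).2 (RingQuot.mkAlgHom_surjective KK _)]
  rw [h1, ← FreeAlgebra.adjoin_range_ι, AlgHom.map_adjoin]
  refine Algebra.adjoin_mono ?_
  rintro _ ⟨_, ⟨p, rfl⟩, rfl⟩
  exact ⟨(p.1.1 + 1, p.2), genD_succ p.1 p.2⟩

theorem span_ordMon (hn : 4 ≤ n) (E : PosRootD n × ℤ → UD n) (hE : ∀ p, IsRVD p.1 p.2 (E p)) :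
    Submodule.span KK (Set.range fun h : HH n => ordMon (fun p => E (ofLex p)) h) = ⊤ := by
  simp only [ordMon_eq_mon]
  refine top_le_iff.1 ?_
  rw [← Algebra.top_toSubmodule, ← adjoin_genD, Algebra.adjoin_eq_span]
  refine Submodule.span_le.2 ?_
  intro z hz
  obtain ⟨l, hl, rfl⟩ := Submonoid.exists_list_of_mem_closure hz
  have hw : ∃ w : List (ℕ × ℤ), w.map (fun q => genD n q.1 q.2) = l := by
    clear hz
    induction l with
    | nil => exact ⟨[], rfl⟩
    | cons u l ih =>
      obtain ⟨w, rfl⟩ := ih fun y hy => hl y (List.mem_cons_of_mem _ hy)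
      obtain ⟨q, rfl⟩ := hl u (by simp)
      exact ⟨q :: w, rfl⟩
  obtain ⟨w, rfl⟩ := hw
  refine Submodule.span_le.2 ?_ (word_mem_span hn w)
  rintro _ ⟨h, hh, rfl⟩
  exact std_mem_span hn hE w.length h hh

end

/-- **PBWD basis of `U_v^>(Lo_{2n})` (type `D_n`)**: for any choice of the parameters
`λ_k ∈ v^ℤ` and of the decompositions used in the definition of the quantum root vectors
`E_{β,s}`, the ordered PBWD monomials `{E_h}_{h∈H}` form a `ℚ(v)`-basis of `U_v^>(Lo_{2n})`. -/
theorem pbwd_basis_typeD (n : ℕ) (hn : 4 ≤ n)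
    (E : PosRootD n × ℤ → UD n) (hE : ∀ p, IsRVD p.1 p.2 (E p)) :
    LinearIndependent KK
      (fun h : Lex (PosRootD n × ℤ) →₀ ℕ => ordMon (fun p => E (ofLex p)) h) ∧
    Submodule.span KK
      (Set.range (fun h : Lex (PosRootD n × ℤ) →₀ ℕ => ordMon (fun p => E (ofLex p)) h)) = ⊤ :=
  ⟨linearIndependent_ordMon hn E hE, span_ordMon hn E hE⟩
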